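/- arXiv:2206.09527 — 2 statements merged into one kernel-verified Lean document; each statement's English description precedes it below -/
import Mathlib

section
/- Let d, p be positive integers, let ℓ be a nonnegative integer, let Q, R > 0, and let f : ℝ^d → ℝ^p be (Q,R)-analytic. Let K be an integer with K > 2ed·9^d/R, set s = ℓ + ⌊KR/(2ed·9^d)⌋, and assume s ≥ 3. Then there exists a ReQU network h_f : [0,1]^d → ℝ^p with width at most max{4d(K+s−1)^d, 12(K+2s−2)+12, p}, with 6 + 2(s−3) + ⌈log₂ d⌉ + 2·max{⌈max{log₂(2d(s−1)+d), log₂ log₂(Q R^{−s} s!)}⌉, 1} hidden layers (where log₂ log₂ t is interpreted as 0 whenever t ≤ 2), all weights in [−1,1], and at most p(K+s−1)^d ( 60·max{⌈max{log₂(2d(s−1)+d), log₂ log₂(Q R^{−s} s!)}⌉, 1} + 38 + 20d² + 144d(s−1) + 8d ) nonzero weights, such that ‖f − h_f‖_{H^ℓ([0,1]^d)} ≤ Q e (√2·e·d·9^d)^ℓ (2s−1)^{2d+2ℓ} R^{−ℓ} exp( −⌊KR/(2ed·9^d)⌋ ). -/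
open scoped BigOperators Classical

noncomputable def requ (t : ℝ) : ℝ := (max t 0) ^ 2

structure ReQUNet where
  L : ℕ
  arch : ℕ → ℕ
  W : ℕ → ℕ → ℕ → ℝ
  v : ℕ → ℕ → ℝ

namespace ReQUNet

noncomputable def hidden (N : ReQUNet) (x : ℕ → ℝ) : ℕ → ℕ → ℝ
  | 0, j => ∑ k ∈ Finset.range (N.arch 0), N.W 0 j k * x k
  | i + 1, j =>
      ∑ k ∈ Finset.range (N.arch (i + 1)),
        N.W (i + 1) j k * requ (N.hidden x i k - N.v (i + 1) k)

noncomputable def eval (N : ReQUNet) (x : ℕ → ℝ) : ℕ → ℝ := N.hidden x N.L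

noncomputable def evalVec (N : ReQUNet) (d : ℕ) (x : Fin d → ℝ) : ℕ → ℝ :=
  N.eval fun k => if h : k < d then x ⟨k, h⟩ else 0

def width (N : ReQUNet) : ℕ := (Finset.range (N.L + 2)).sup N.arch

def weightsIn (N : ReQUNet) (s : Set ℝ) : Prop :=
  (∀ i ≤ N.L, ∀ j < N.arch (i + 1), ∀ k < N.arch i, N.W i j k ∈ s) ∧
  ∀ i, 1 ≤ i → i ≤ N.L → ∀ j < N.arch i, N.v i j ∈ s

noncomputable def numNonzero (N : ReQUNet) : ℕ :=
  (∑ i ∈ Finset.range (N.L + 1),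
    ((Finset.range (N.arch (i + 1)) ×ˢ Finset.range (N.arch i)).filter
      fun p => N.W i p.1 p.2 ≠ 0).card) +
  ∑ i ∈ Finset.Icc 1 N.L,
    ((Finset.range (N.arch i)).filter fun j => N.v i j ≠ 0).card

end ReQUNet

noncomputable def pderiv1 {d : ℕ} (i : Fin d) (g : (Fin d → ℝ) → ℝ) : (Fin d → ℝ) → ℝ :=
  fun x => fderiv ℝ g x (Pi.single i 1)

noncomputable def mderiv {d : ℕ} (γ : Fin d → ℕ) (g : (Fin d → ℝ) → ℝ) : (Fin d → ℝ) → ℝ :=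
  (List.finRange d).foldr (fun i h => (pderiv1 i)^[γ i] h) g

noncomputable def eucDist {d : ℕ} (x y : Fin d → ℝ) : ℝ :=
  Real.sqrt (∑ i, (x i - y i) ^ 2)

def cube (d : ℕ) : Set (Fin d → ℝ) := Set.Icc 0 1

def cubeHO (d : ℕ) : Set (Fin d → ℝ) := Set.Ico 0 1

def HolderNormLeOn {d : ℕ} (Ω : Set (Fin d → ℝ)) : ℕ → ((Fin d → ℝ) → ℝ) → ℝ → Prop
  | 0, g, E => ∀ x ∈ Ω, |g x| ≤ E
  | m + 1, g, E =>
      (∀ γ : Fin d → ℕ, (∑ i, γ i) ≤ m → ∀ x ∈ Ω, |mderiv γ g x| ≤ E) ∧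
      ∀ γ : Fin d → ℕ, (∑ i, γ i) = m → ∀ x ∈ Ω, ∀ y ∈ Ω, x ≠ y →
        |mderiv γ g x - mderiv γ g y| ≤ E * min 1 (eucDist x y)

def VHolderNormLe {d : ℕ} (p ℓ : ℕ) (f : (Fin d → ℝ) → Fin p → ℝ) (E : ℝ) : Prop :=
  ∀ i : Fin p, HolderNormLeOn (cube d) ℓ (fun x => f x i) E

noncomputable def lfloor (β : ℝ) : ℕ := ⌈β⌉₊ - 1

def MemHolderBall {d : ℕ} (p : ℕ) (β H : ℝ) (f : (Fin d → ℝ) → Fin p → ℝ) : Prop :=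
  (∀ i : Fin p, ContDiff ℝ (lfloor β : ℕ∞) fun x => f x i) ∧
  (∀ i : Fin p, ∀ γ : Fin d → ℕ, (∑ j, γ j) ≤ lfloor β →
      ∀ x ∈ cube d, |mderiv γ (fun y => f y i) x| ≤ H) ∧
  ∀ i : Fin p, ∀ γ : Fin d → ℕ, (∑ j, γ j) = lfloor β →
      ∀ x ∈ cube d, ∀ y ∈ cube d, x ≠ y →
        |mderiv γ (fun z => f z i) x - mderiv γ (fun z => f z i) y| ≤
          H * min 1 (eucDist x y) ^ (β - (lfloor β : ℝ))

def MemHolderBall1 {d : ℕ} (β H : ℝ) (f : (Fin d → ℝ) → ℝ) : Prop :=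
  (ContDiff ℝ (lfloor β : ℕ∞) f) ∧
  (∀ γ : Fin d → ℕ, (∑ j, γ j) ≤ lfloor β → ∀ x ∈ cube d, |mderiv γ f x| ≤ H) ∧
  ∀ γ : Fin d → ℕ, (∑ j, γ j) = lfloor β →
      ∀ x ∈ cube d, ∀ y ∈ cube d, x ≠ y →
        |mderiv γ f x - mderiv γ f y| ≤ H * min 1 (eucDist x y) ^ (β - (lfloor β : ℝ))

noncomputable def loglog2 (H : ℝ) : ℝ := if H ≤ 2 then 0 else Real.logb 2 (Real.logb 2 H)

noncomputable def knot (q K j : ℕ) : ℝ :=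
  if j ≤ q + 1 then 0 else if j ≤ q + K then ((j - (q + 1) : ℕ) : ℝ) / K else 1

noncomputable def Bspl (q K : ℕ) : ℕ → ℕ → ℝ → ℝ
  | 0, j, x =>
      if knot q K j < knot q K (j + 1) ∧ knot q K j ≤ x ∧ x < knot q K (j + 1) then
        1 / (knot q K (j + 1) - knot q K j)
      else 0
  | m + 1, j, x =>
      if knot q K j < knot q K (j + m + 2) ∧ knot q K j ≤ x ∧ x < knot q K (j + m + 2) then
        ((x - knot q K j) * Bspl q K m j x
            + (knot q K (j + m + 2) - x) * Bspl q K m (j + 1) x) /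
          (knot q K (j + m + 2) - knot q K j)
      else 0

noncomputable def Nspl (q K m j : ℕ) (x : ℝ) : ℝ :=
  (knot q K (j + m + 1) - knot q K j) * Bspl q K m j x

def QRanalytic {d : ℕ} (p : ℕ) (Q R : ℝ) (f : (Fin d → ℝ) → Fin p → ℝ) : Prop :=
  (∀ i : Fin p, ContDiff ℝ (⊤ : ℕ∞) fun x => f x i) ∧
  ∀ s : ℕ, VHolderNormLe p s f (Q * ((R : ℝ) ^ s)⁻¹ * (Nat.factorial s : ℝ))

def archSpec (q K i : ℕ) : ℕ :=
  if i = 0 then 1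
  else if i = 1 then 4 * (K + 2 * q - 1) + K
  else if i ≤ 4 then 4 * K + 8 * q
  else if i ≤ 4 + 2 * (q - 2) then
    (if (i - 5) % 2 = 0 then 12 * (K + 2 * q - (3 + (i - 5) / 2)) + 12
      else 8 * (K + 2 * q - (3 + (i - 5) / 2)) + 8)
  else K + q + 2

/-- The number of nonzero coefficients of a linear form. -/
noncomputable def formSize {κ : Type*} [Fintype κ] (a : κ → ℝ) : ℕ :=
  (Finset.univ.filter fun i => a i ≠ 0).card

/-- A unit of a layer: a linear combination of four ReQU neurons reading the state `κ → ℝ`. -/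
structure Gate (κ : Type*) where
  w : Fin 4 → κ → ℝ
  v : Fin 4 → ℝ
  e : Fin 4 → ℝ

namespace Gate

variable {κ : Type*} [Fintype κ]

noncomputable def act (g : Gate κ) (z : κ → ℝ) (q : Fin 4) : ℝ :=
  requ (∑ i, g.w q i * z i - g.v q)

noncomputable def val (g : Gate κ) (z : κ → ℝ) : ℝ := ∑ q, g.e q * g.act z q

noncomputable def cost (g : Gate κ) : ℕ :=
  ∑ q, (4 * formSize (g.w q) + if g.v q ≠ 0 then 1 else 0)

def IsBounded (g : Gate κ) : Prop :=
  (∀ q i, |g.w q i| ≤ 1) ∧ (∀ q, |g.v q| ≤ 1) ∧ ∀ q, |g.e q| ≤ 1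

/-- The gate that is constantly zero and uses no weights. -/
def zero : Gate κ := ⟨0, 0, 0⟩

end Gate

section Compile

variable {ι : Type} [Fintype ι] {d p : ℕ}

noncomputable def layerCost {κ : Type*} [Fintype κ] (l : ι → Gate κ) : ℕ := ∑ j, (l j).cost

noncomputable def runLayers (l : List (ι → Gate ι)) (z : ι → ℝ) : ι → ℝ :=
  l.foldl (fun z g j => (g j).val z) z

def numUnits (ι : Type) [Fintype ι] : ℕ := Fintype.card (ι × Fin 4)

theorem numUnits_eq (ι : Type) [Fintype ι] : numUnits ι = 4 * Fintype.card ι := by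
  simp [numUnits, mul_comm]

noncomputable def unitEquiv (ι : Type) [Fintype ι] : Fin (numUnits ι) ≃ ι × Fin 4 :=
  (Fintype.equivFin (ι × Fin 4)).symm

/-- Outgoing coefficients of the neurons of hidden layer `t + 1`. -/
noncomputable def outCoef (first : ι → Gate (Fin d)) (rest : List (ι → Gate ι)) :
    ℕ → ι → Fin 4 → ℝ
  | 0, i => (first i).e
  | t + 1, i => (rest.getD t (fun _ => Gate.zero) i).e

/-- The ReQU network obtained by unfolding the gates of a layered circuit into neurons. -/
noncomputable def compileNet (first : ι → Gate (Fin d)) (rest : List (ι → Gate ι))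
    (out : Fin p → ι → ℝ) : ReQUNet where
  L := rest.length + 1
  arch i := if i = 0 then d else if i ≤ rest.length + 1 then numUnits ι else p
  W i j k :=
    match i with
    | 0 => if h : j < numUnits ι ∧ k < d then
        (first (unitEquiv ι ⟨j, h.1⟩).1).w (unitEquiv ι ⟨j, h.1⟩).2 ⟨k, h.2⟩ else 0
    | t + 1 =>
      if t < rest.length then
        if h : j < numUnits ι ∧ k < numUnits ι then
          (rest.getD t (fun _ => Gate.zero) (unitEquiv ι ⟨j, h.1⟩).1).w
            (unitEquiv ι ⟨j, h.1⟩).2 (unitEquiv ι ⟨k, h.2⟩).1 *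
          outCoef first rest t (unitEquiv ι ⟨k, h.2⟩).1 (unitEquiv ι ⟨k, h.2⟩).2 else 0
      else
        if h : j < p ∧ k < numUnits ι then
          out ⟨j, h.1⟩ (unitEquiv ι ⟨k, h.2⟩).1 *
          outCoef first rest t (unitEquiv ι ⟨k, h.2⟩).1 (unitEquiv ι ⟨k, h.2⟩).2 else 0
  v i j :=
    if h : j < numUnits ι then
      match i with
      | 0 => 0
      | 1 => (first (unitEquiv ι ⟨j, h⟩).1).v (unitEquiv ι ⟨j, h⟩).2
      | t + 2 => (rest.getD t (fun _ => Gate.zero) (unitEquiv ι ⟨j, h⟩).1).v (unitEquiv ι ⟨j, h⟩).2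
    else 0

variable (first : ι → Gate (Fin d)) (rest : List (ι → Gate ι)) (out : Fin p → ι → ℝ)

theorem compileNet_L : (compileNet first rest out).L = rest.length + 1 := rfl

theorem compileNet_arch_zero : (compileNet first rest out).arch 0 = d := rfl

theorem compileNet_arch_hidden {i : ℕ} (h : i ≤ rest.length) :
    (compileNet first rest out).arch (i + 1) = numUnits ι := by
  simp [compileNet, h]

theorem compileNet_arch_last : (compileNet first rest out).arch (rest.length + 2) = p := by
  simp [compileNet]

theorem compileNet_width :
    (compileNet first rest out).width ≤ max d (max (4 * Fintype.card ι) p) := by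
  refine Finset.sup_le fun i _ => ?_
  simp only [compileNet, numUnits_eq]
  split_ifs <;> simp

/-- The activations of hidden layer `t + 1`. -/
noncomputable def layerAct (x : Fin d → ℝ) : ℕ → ι × Fin 4 → ℝ
  | 0, u => (first u.1).act x u.2
  | t + 1, u => (rest.getD t (fun _ => Gate.zero) u.1).act
      (runLayers (rest.take t) fun j => (first j).val x) u.2

theorem sum_outCoef_layerAct (x : Fin d → ℝ) {t : ℕ} (ht : t ≤ rest.length) (i : ι) :
    ∑ q, outCoef first rest t i q * layerAct first rest x t (i, q) =
      runLayers (rest.take t) (fun j => (first j).val x) i := by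
  cases t with
  | zero => simp [outCoef, layerAct, runLayers, Gate.val]
  | succ t =>
    have h : t < rest.length := ht
    rw [List.take_succ_eq_append_getElem h, runLayers, List.foldl_append]
    simp [outCoef, layerAct, runLayers, Gate.val, h]

theorem requ_compileNet_hidden (x : Fin d → ℝ) {t : ℕ} (ht : t ≤ rest.length)
    (j : Fin (numUnits ι)) :
    requ ((compileNet first rest out).hidden (fun k => if h : k < d then x ⟨k, h⟩ else 0) t j -
      (compileNet first rest out).v (t + 1) j) = layerAct first rest x t (unitEquiv ι j) := by
  induction t generalizing j with
  | zero =>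
    rw [ReQUNet.hidden, compileNet_arch_zero, Finset.sum_range]
    simp [compileNet, layerAct, Gate.act]
  | succ t ih =>
    have h : t < rest.length := ht
    rw [ReQUNet.hidden, compileNet_arch_hidden _ _ _ h.le, Finset.sum_range]
    simp_rw [ih h.le]
    have hs : ∀ k : Fin (numUnits ι),
        (compileNet first rest out).W (t + 1) j k =
        (rest.getD t (fun _ => Gate.zero) (unitEquiv ι j).1).w
            (unitEquiv ι j).2 (unitEquiv ι k).1 *
          outCoef first rest t (unitEquiv ι k).1 (unitEquiv ι k).2 := by
      intro k
      simp [compileNet, h]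
    simp_rw [hs]
    rw [(unitEquiv ι).sum_comp (fun u => (rest.getD t (fun _ => Gate.zero) (unitEquiv ι j).1).w
            (unitEquiv ι j).2 u.1 * outCoef first rest t u.1 u.2 * layerAct first rest x t u),
      Fintype.sum_prod_type]
    simp_rw [mul_assoc, ← Finset.mul_sum, sum_outCoef_layerAct first rest x h.le]
    simp [compileNet, layerAct, Gate.act]

theorem compileNet_evalVec (x : Fin d → ℝ) (o : Fin p) :
    (compileNet first rest out).evalVec d x o =
      ∑ i, out o i * runLayers rest (fun j => (first j).val x) i := by
  rw [ReQUNet.evalVec, ReQUNet.eval, compileNet_L, ReQUNet.hidden,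
    compileNet_arch_hidden _ _ _ le_rfl, Finset.sum_range]
  simp_rw [requ_compileNet_hidden first rest out x le_rfl]
  have hs : ∀ k : Fin (numUnits ι),
      (compileNet first rest out).W (rest.length + 1) o k =
      out o (unitEquiv ι k).1 *
        outCoef first rest rest.length (unitEquiv ι k).1 (unitEquiv ι k).2 := by
    intro k
    simp [compileNet]
  simp_rw [hs]
  rw [(unitEquiv ι).sum_comp (fun u => out o u.1 * outCoef first rest rest.length u.1 u.2 *
      layerAct first rest x rest.length u), Fintype.sum_prod_type]
  simp_rw [mul_assoc, ← Finset.mul_sum, sum_outCoef_layerAct first rest x le_rfl]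
  simp

theorem mul_mem_Icc_neg_one_one {a b : ℝ} (ha : |a| ≤ 1) (hb : |b| ≤ 1) :
    a * b ∈ Set.Icc (-1 : ℝ) 1 := by
  rw [Set.mem_Icc, ← abs_le, abs_mul]
  exact mul_le_one₀ ha (abs_nonneg _) hb

theorem compileNet_weightsIn (hfirst : ∀ i, (first i).IsBounded)
    (hrest : ∀ l ∈ rest, ∀ i, (l i).IsBounded) (hout : ∀ o i, |out o i| ≤ 1) :
    (compileNet first rest out).weightsIn (Set.Icc (-1) 1) := by
  have hgetD : ∀ t i, (rest.getD t (fun _ => Gate.zero) i).IsBounded := by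
    intro t i
    by_cases h : t < rest.length
    · rw [List.getD_eq_getElem _ _ h]
      exact hrest _ (List.getElem_mem h) i
    · rw [List.getD_eq_default _ _ (not_lt.1 h)]
      simp [Gate.IsBounded, Gate.zero]
  have hcoef : ∀ t i q, |outCoef first rest t i q| ≤ 1 := by
    intro t i q
    cases t with
    | zero => exact (hfirst i).2.2 q
    | succ t => exact (hgetD t i).2.2 q
  have h0 : (0 : ℝ) ∈ Set.Icc (-1 : ℝ) 1 := by simp
  constructor
  · intro i _ j _ k _
    rcases i with _ | t
    · simp only [compileNet]
      split_ifs with h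
      · exact abs_le.1 ((hfirst _).1 _ _)
      · exact h0
    · simp only [compileNet]
      split_ifs
      · exact mul_mem_Icc_neg_one_one ((hgetD t _).1 _ _) (hcoef _ _ _)
      · exact h0
      · exact mul_mem_Icc_neg_one_one (hout _ _) (hcoef _ _ _)
      · exact h0
  · intro i _ _ j _
    simp only [compileNet]
    split_ifs with h
    · rcases i with _ | _ | t
      · exact h0
      · exact abs_le.1 ((hfirst _).2.1 _)
      · exact abs_le.1 ((hgetD t _).2.1 _)
    · exact h0

theorem card_filter_range_product (m n : ℕ) (P : ℕ → ℕ → Prop)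
    [DecidablePred fun q : ℕ × ℕ => P q.1 q.2] :
    ((Finset.range m ×ˢ Finset.range n).filter fun q => P q.1 q.2).card =
      ∑ j : Fin m, ∑ k : Fin n, if P j k then 1 else 0 := by
  rw [Finset.card_filter, Finset.sum_product, Finset.sum_range]
  simp_rw [Finset.sum_range]
  refine Finset.sum_congr rfl fun j _ => Finset.sum_congr rfl fun k _ => ?_
  congr

theorem card_filter_range_fin (m : ℕ) (P : ℕ → Prop) [DecidablePred P] :
    ((Finset.range m).filter fun j => P j).card = ∑ j : Fin m, if P j then 1 else 0 := by
  rw [Finset.card_filter, Finset.sum_range]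
theorem sum_unit_ite_le {κ : Type} [Fintype κ] (a : κ → ℝ) (b : κ → Fin 4 → ℝ) :
    (∑ u : κ × Fin 4, if a u.1 * b u.1 u.2 ≠ 0 then 1 else 0) ≤
      4 * formSize a := by
  rw [Fintype.sum_prod_type, formSize, Finset.card_filter, Finset.mul_sum]
  refine Finset.sum_le_sum fun i _ => ?_
  by_cases h : a i = 0
  · simp [h]
  · refine (Finset.sum_le_card_nsmul _ _ 1 fun q _ => ?_).trans (by simp [h])
    split_ifs <;> simp

theorem layerCost_eq {κ : Type} [Fintype κ] (l : ι → Gate κ) :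
    layerCost l = ∑ u : ι × Fin 4, 4 * formSize ((l u.1).w u.2) +
      ∑ u : ι × Fin 4, if (l u.1).v u.2 ≠ 0 then 1 else 0 := by
  rw [← Finset.sum_add_distrib, Fintype.sum_prod_type]
  rfl

theorem compileNet_numNonzero :
    (compileNet first rest out).numNonzero ≤
      layerCost first + (rest.map layerCost).sum +
        ∑ o, 4 * formSize (out o) := by
  have hrest : (rest.map layerCost).sum =
      ∑ t ∈ Finset.range rest.length, layerCost (rest.getD t (fun _ => Gate.zero)) := by
    rw [Finset.sum_range, ← List.sum_ofFn]
    congr 1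
    refine List.ext_getElem (by simp) fun i h1 h2 => ?_
    simp
  have hW : ∑ i ∈ Finset.range (rest.length + 2),
      ((Finset.range ((compileNet first rest out).arch (i + 1)) ×ˢ
        Finset.range ((compileNet first rest out).arch i)).filter
      fun q => (compileNet first rest out).W i q.1 q.2 ≠ 0).card ≤
      ∑ u : ι × Fin 4, 4 * formSize ((first u.1).w u.2) +
      ∑ t ∈ Finset.range rest.length, ∑ u : ι × Fin 4, 4 * formSize
        ((rest.getD t (fun _ => Gate.zero) u.1).w u.2) +
      ∑ o, 4 * formSize (out o) := by
    rw [Finset.sum_range_succ, Finset.sum_range_succ']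
    rw [add_comm (∑ k ∈ Finset.range rest.length, _)]
    refine add_le_add (add_le_add ?_ (Finset.sum_le_sum fun t ht => ?_)) ?_
    · rw [compileNet_arch_hidden _ _ _ (Nat.zero_le _), compileNet_arch_zero,
        card_filter_range_product _ _ fun j k => (compileNet first rest out).W 0 j k ≠ 0,
        ← (unitEquiv ι).sum_comp]
      refine Finset.sum_le_sum fun j _ => ?_
      rw [formSize, Finset.card_filter]
      simp only [compileNet, Fin.is_lt, and_self, dite_true, Fin.eta]
      exact Nat.le_mul_of_pos_left _ (by norm_num)
    · rw [Finset.mem_range] at ht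
      rw [compileNet_arch_hidden _ _ _ ht, compileNet_arch_hidden _ _ _ ht.le,
        card_filter_range_product _ _ fun j k => (compileNet first rest out).W (t + 1) j k ≠ 0,
        ← (unitEquiv ι).sum_comp]
      refine Finset.sum_le_sum fun j _ => ?_
      refine le_trans (le_of_eq ?_) (sum_unit_ite_le _ (outCoef first rest t))
      rw [← (unitEquiv ι).sum_comp]
      refine Finset.sum_congr rfl fun k _ => ?_
      simp [compileNet, ht]
    · rw [compileNet_arch_last, compileNet_arch_hidden _ _ _ le_rfl,
        card_filter_range_product _ _ fun j k =>
          (compileNet first rest out).W (rest.length + 1) j k ≠ 0]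
      refine Finset.sum_le_sum fun j _ => ?_
      refine le_trans (le_of_eq ?_) (sum_unit_ite_le _ (outCoef first rest rest.length))
      rw [← (unitEquiv ι).sum_comp]
      refine Finset.sum_congr rfl fun k _ => ?_
      simp [compileNet]
  have hv : ∑ i ∈ Finset.Icc 1 (rest.length + 1),
      ((Finset.range ((compileNet first rest out).arch i)).filter
        fun j => (compileNet first rest out).v i j ≠ 0).card =
      (∑ u : ι × Fin 4, if (first u.1).v u.2 ≠ 0 then 1 else 0) +
      ∑ t ∈ Finset.range rest.length, ∑ u : ι × Fin 4,
        if (rest.getD t (fun _ => Gate.zero) u.1).v u.2 ≠ 0 then 1 else 0 := by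
    have : Finset.Icc 1 (rest.length + 1) = Finset.Ico 1 (rest.length + 2) := by
      ext; simp; omega
    rw [this, Finset.sum_Ico_eq_sum_range, show rest.length + 2 - 1 = rest.length + 1 by omega,
      Finset.sum_range_succ', add_comm]
    congr 1
    · rw [show 1 + 0 = 0 + 1 from rfl, compileNet_arch_hidden _ _ _ (Nat.zero_le _),
        card_filter_range_fin _ fun j => (compileNet first rest out).v 1 j ≠ 0,
        ← (unitEquiv ι).sum_comp]
      simp [compileNet]
    · refine Finset.sum_congr rfl fun t ht => ?_
      rw [Finset.mem_range] at ht
      rw [add_comm 1, compileNet_arch_hidden _ _ _ ht,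
        card_filter_range_fin _ fun j => (compileNet first rest out).v (t + 1 + 1) j ≠ 0,
        ← (unitEquiv ι).sum_comp]
      simp [compileNet]
  rw [ReQUNet.numNonzero, compileNet_L, hv, hrest]
  refine (add_le_add_left hW _).trans (le_of_eq ?_)
  simp_rw [layerCost_eq, Finset.sum_add_distrib]
  ring

end Compile

namespace Gate

variable {κ : Type*}

/-- The linear form reading off one coordinate of the state. -/
noncomputable def coord (i : κ) : κ → ℝ := fun j => if j = i then 1 else 0

/-- The gate computing the product of two affine forms, by polarization. -/
noncomputable def mulAffine (a b : κ → ℝ) (α β : ℝ) : Gate κ where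
  w := ![a + b, -(a + b), a - b, -(a - b)]
  v := ![-(α + β), α + β, -(α - β), α - β]
  e := ![1 / 4, 1 / 4, -1 / 4, -1 / 4]

/-- The gate computing the ReQU of an affine form. -/
noncomputable def requAffine (a : κ → ℝ) (α : ℝ) : Gate κ where
  w := ![a, 0, 0, 0]
  v := ![-α, 0, 0, 0]
  e := ![1, 0, 0, 0]

theorem isBounded_zero : (zero : Gate κ).IsBounded := by simp [IsBounded, zero]

theorem isBounded_mulAffine {a b : κ → ℝ} {α β : ℝ} (h : ∀ i, |a i| + |b i| ≤ 1)
    (h' : |α| + |β| ≤ 1) : (mulAffine a b α β).IsBounded := by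
  have ha : ∀ i, |a i + b i| ≤ 1 := fun i => (abs_add_le _ _).trans (h i)
  have hb : ∀ i, |a i - b i| ≤ 1 := fun i => (abs_sub _ _).trans (h i)
  have ha' : |α + β| ≤ 1 := (abs_add_le _ _).trans h'
  have hb' : |α - β| ≤ 1 := (abs_sub _ _).trans h'
  refine ⟨fun q i => ?_, fun q => ?_, fun q => ?_⟩ <;> fin_cases q
  · exact ha i
  · simpa [mulAffine, -neg_add_rev, abs_neg] using (abs_neg (a i + b i)).trans_le (ha i)
  · exact hb i
  · simpa [mulAffine, abs_neg, abs_sub_comm] using hb i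
  · exact (abs_neg (α + β)).trans_le ha'
  · exact ha'
  · exact (abs_neg (α - β)).trans_le hb'
  · exact hb'
  all_goals norm_num [mulAffine, abs_le]

theorem isBounded_requAffine {a : κ → ℝ} {α : ℝ} (h : ∀ i, |a i| ≤ 1) (h' : |α| ≤ 1) :
    (requAffine a α).IsBounded := by
  refine ⟨fun q i => ?_, fun q => ?_, fun q => ?_⟩ <;> fin_cases q <;>
    simp [requAffine, h, h']

/-- The gate copying one coordinate. -/
noncomputable def carry (i : κ) : Gate κ := mulAffine (coord i) 0 0 1

theorem abs_coord_le (i j : κ) : |coord i j| ≤ 1 := by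
  unfold coord; split_ifs <;> simp

theorem isBounded_carry (i : κ) : (carry i).IsBounded :=
  isBounded_mulAffine (by simpa using abs_coord_le i) (by simp)

/-- The gate `z_i * (z_j - t)`. -/
noncomputable def mulShift (i j : κ) (t : ℝ) : Gate κ := mulAffine (coord i) (coord j) 0 (-t)

theorem isBounded_mulShift {i j : κ} (hij : i ≠ j) {t : ℝ} (ht : |t| ≤ 1) :
    (mulShift i j t).IsBounded := by
  refine isBounded_mulAffine (fun k => ?_) (by simpa using ht)
  unfold coord
  split_ifs with h1 h2 <;> simp_all

variable [Fintype κ]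

theorem sum_coord_mul (i : κ) (z : κ → ℝ) : ∑ j, coord i j * z j = z i := by
  simp [coord]

theorem formSize_coord (i : κ) : formSize (coord i) = 1 := by
  rw [formSize, Finset.card_eq_one]
  exact ⟨i, by ext j; simp [coord]⟩

theorem formSize_zero : formSize (0 : κ → ℝ) = 0 := by simp [formSize]

theorem formSize_neg (a : κ → ℝ) : formSize (-a) = formSize a := by simp [formSize]

theorem formSize_add_le (a b : κ → ℝ) : formSize (a + b) ≤ formSize a + formSize b := by
  refine (Finset.card_le_card fun j hj => ?_).trans (Finset.card_union_le _ _)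
  simp only [Finset.mem_filter, Finset.mem_univ, true_and, Finset.mem_union,
    Pi.add_apply] at hj ⊢
  by_contra! h
  exact hj (by rw [h.1, h.2, add_zero])

theorem formSize_sub_le (a b : κ → ℝ) : formSize (a - b) ≤ formSize a + formSize b := by
  simpa [sub_eq_add_neg, formSize_neg] using formSize_add_le a (-b)

theorem requ_add_requ_neg (t : ℝ) : requ t + requ (-t) = t ^ 2 := by
  unfold requ
  rcases le_total t 0 with h | h
  · rw [max_eq_right h, max_eq_left (by linarith)]; ring
  · rw [max_eq_left h, max_eq_right (by linarith)]; ring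

theorem val_mulAffine (a b : κ → ℝ) (α β : ℝ) (z : κ → ℝ) :
    (mulAffine a b α β).val z = (∑ i, a i * z i + α) * (∑ i, b i * z i + β) := by
  simp only [val, act, mulAffine, Fin.sum_univ_four, Matrix.cons_val_zero, Matrix.cons_val_one,
    Matrix.cons_val, Pi.add_apply, Pi.sub_apply, Pi.neg_apply, add_mul, sub_mul, neg_mul,
    Finset.sum_add_distrib, Finset.sum_sub_distrib, Finset.sum_neg_distrib]
  set A := ∑ i, a i * z i
  set B := ∑ i, b i * z i
  have h1 := requ_add_requ_neg (A + B - -(α + β))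
  have h2 := requ_add_requ_neg (A - B - -(α - β))
  rw [show -(A + B - -(α + β)) = -(A + B) - (α + β) by ring] at h1
  rw [show -(A - B - -(α - β)) = -(A - B) - (α - β) by ring] at h2
  linear_combination (1 / 4) * h1 - (1 / 4) * h2

theorem val_requAffine (a : κ → ℝ) (α : ℝ) (z : κ → ℝ) :
    (requAffine a α).val z = requ (∑ i, a i * z i + α) := by
  simp [val, act, requAffine, Fin.sum_univ_four]

theorem val_zero (z : κ → ℝ) : (zero : Gate κ).val z = 0 := by simp [val, zero]

theorem cost_zero : (zero : Gate κ).cost = 0 := by simp [cost, zero, formSize_zero]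

theorem cost_le (g : Gate κ) : g.cost ≤ ∑ q, (4 * formSize (g.w q) + 1) :=
  Finset.sum_le_sum fun q _ => by split_ifs <;> simp

theorem cost_mulAffine_le (a b : κ → ℝ) (α β : ℝ) :
    (mulAffine a b α β).cost ≤ 16 * (formSize a + formSize b) + 4 := by
  have h1 := formSize_add_le a b
  have h2 := formSize_sub_le a b
  refine (cost_le _).trans ?_
  simp only [mulAffine, Fin.sum_univ_four, Matrix.cons_val_zero, Matrix.cons_val_one,
    Matrix.cons_val, formSize_neg]
  omega

theorem cost_requAffine_le (a : κ → ℝ) (α : ℝ) :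
    (requAffine a α).cost ≤ 4 * formSize a + 1 := by
  simp only [cost, requAffine, Fin.sum_univ_four, Matrix.cons_val_zero, Matrix.cons_val_one,
    Matrix.cons_val, formSize_zero]
  split_ifs <;> simp_all

theorem val_carry (i : κ) (z : κ → ℝ) : (carry i).val z = z i := by
  simp [carry, val_mulAffine, sum_coord_mul]

theorem cost_carry_le (i : κ) : (carry i).cost ≤ 20 := by
  refine (cost_mulAffine_le _ _ _ _).trans ?_
  rw [formSize_coord, formSize_zero]

theorem val_mulShift (i j : κ) (t : ℝ) (z : κ → ℝ) :
    (mulShift i j t).val z = z i * (z j - t) := by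
  simp [mulShift, val_mulAffine, sum_coord_mul, sub_eq_add_neg]

theorem cost_mulShift_le (i j : κ) (t : ℝ) : (mulShift i j t).cost ≤ 36 := by
  refine (cost_mulAffine_le _ _ _ _).trans ?_
  rw [formSize_coord, formSize_coord]

end Gate

/-- The state of the approximating circuit: coordinates, constants, ones, local coordinates,
step functions, and weighted monomials. -/
abbrev Cell (d G s : ℕ) : Type :=
  Fin d ⊕ Fin 3 ⊕ Fin G ⊕ (Fin d × Fin G) ⊕ (Fin d × Fin G) ⊕ ((Fin d → Fin G) × (Fin d → Fin s))

namespace Cell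

variable {d G s : ℕ}

abbrev x (i : Fin d) : Cell d G s := .inl i
abbrev c (i : Fin 3) : Cell d G s := .inr (.inl i)
abbrev o (k : Fin G) : Cell d G s := .inr (.inr (.inl k))
abbrev y (i : Fin d × Fin G) : Cell d G s := .inr (.inr (.inr (.inl i)))
abbrev t (i : Fin d × Fin G) : Cell d G s := .inr (.inr (.inr (.inr (.inl i))))
abbrev f (i : (Fin d → Fin G) × (Fin d → Fin s)) : Cell d G s :=
  .inr (.inr (.inr (.inr (.inr i))))

def vec {α : Type*} (vx : Fin d → α) (vc : Fin 3 → α) (vo : Fin G → α) (vy vt : Fin d × Fin G → α)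
    (vf : (Fin d → Fin G) × (Fin d → Fin s) → α) : Cell d G s → α :=
  Sum.elim vx (Sum.elim vc (Sum.elim vo (Sum.elim vy (Sum.elim vt vf))))

theorem card_eq : Fintype.card (Cell d G s) = d + 3 + G + 2 * (d * G) + G ^ d * s ^ d := by
  simp [Cell]; ring

section Gates

variable {κ : Type*} (gx : Fin d → Gate κ) (gc : Fin 3 → Gate κ) (go : Fin G → Gate κ)
  (gy gt : Fin d × Fin G → Gate κ) (gf : (Fin d → Fin G) × (Fin d → Fin s) → Gate κ)

theorem val_vec [Fintype κ] (z : κ → ℝ) :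
    (fun j => (vec gx gc go gy gt gf j).val z) = vec (fun i => (gx i).val z)
      (fun i => (gc i).val z) (fun i => (go i).val z) (fun i => (gy i).val z)
      (fun i => (gt i).val z) (fun i => (gf i).val z) := by
  funext j
  rcases j with j | j | j | j | j | j <;> rfl

variable {gx gc go gy gt gf}

theorem isBounded_vec (hx : ∀ i, (gx i).IsBounded) (hc : ∀ i, (gc i).IsBounded)
    (ho : ∀ i, (go i).IsBounded) (hy : ∀ i, (gy i).IsBounded) (ht : ∀ i, (gt i).IsBounded)
    (hf : ∀ i, (gf i).IsBounded) (j : Cell d G s) : (vec gx gc go gy gt gf j).IsBounded := by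
  rcases j with j | j | j | j | j | j
  exacts [hx j, hc j, ho j, hy j, ht j, hf j]

theorem layerCost_vec_le [Fintype κ] {a b c e g h : ℕ} (hx : ∀ i, (gx i).cost ≤ a)
    (hc : ∀ i, (gc i).cost ≤ b) (ho : ∀ i, (go i).cost ≤ c) (hy : ∀ i, (gy i).cost ≤ e)
    (ht : ∀ i, (gt i).cost ≤ g) (hf : ∀ i, (gf i).cost ≤ h) :
    layerCost (vec gx gc go gy gt gf) ≤
      d * a + 3 * b + G * c + d * G * e + d * G * g + G ^ d * s ^ d * h := by
  simp only [layerCost, Fintype.sum_sum_type]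
  have key : ∀ {β : Type} [Fintype β] (v : β → ℕ) (a : ℕ), (∀ i, v i ≤ a) →
      ∑ i, v i ≤ Fintype.card β * a := fun v a h => by
    simpa using Finset.sum_le_card_nsmul Finset.univ v a fun i _ => h i
  have h1 := key (fun i => (gx i).cost) a hx
  have h2 := key (fun i => (gc i).cost) b hc
  have h3 := key (fun i => (go i).cost) c ho
  have h4 := key (fun i => (gy i).cost) e hy
  have h5 := key (fun i => (gt i).cost) g ht
  have h6 := key (fun i => (gf i).cost) h hf
  simp only [Fintype.card_fin, Fintype.card_prod, Fintype.card_fun] at h1 h2 h3 h4 h5 h6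
  simp only [vec, Sum.elim_inl, Sum.elim_inr]
  linarith

end Gates

open Gate

/-- The linear form summing the ones. -/
noncomputable def onesForm : Cell d G s → ℝ := vec 0 0 1 0 0 0

theorem sum_onesForm_mul (z : Cell d G s → ℝ) : ∑ j, onesForm j * z j = ∑ k, z (o k) := by
  simp [onesForm, vec, Fintype.sum_sum_type]

theorem formSize_onesForm : formSize (onesForm : Cell d G s → ℝ) ≤ G := by
  refine (Finset.card_le_card (t := Finset.univ.image (o : Fin G → Cell d G s))
    fun j hj => ?_).trans (Finset.card_image_le.trans (by simp))
  rcases j with j | j | j | j | j | j <;> simp [onesForm, vec] at hj ⊢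

theorem abs_onesForm_le (j : Cell d G s) : |onesForm j| ≤ 1 := by
  rcases j with j | j | j | j | j | j <;> simp [onesForm, vec]

noncomputable def inputLayer : Cell d G s → Gate (Fin d) :=
  vec carry ![requAffine 0 1, requAffine 0 1, zero] (fun _ => requAffine 0 1)
    (fun _ => zero) (fun _ => zero) (fun _ => zero)

noncomputable def countLayer : Cell d G s → Gate (Cell d G s) :=
  vec (fun i => carry (x i)) ![carry (c 0), carry (c 1), mulAffine onesForm 0 0 1]
    (fun _ => zero) (fun _ => zero) (fun _ => zero) (fun _ => zero)

noncomputable def growLayer : Cell d G s → Gate (Cell d G s) :=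
  vec (fun i => carry (x i))
    ![requAffine (coord (c 0) + coord (c 1)) 0, requAffine (coord (c 0) + coord (c 1)) 0,
      carry (c 2)]
    (fun _ => zero) (fun _ => zero) (fun _ => zero) (fun _ => zero)

noncomputable def idleLayer : Cell d G s → Gate (Cell d G s) :=
  vec (fun i => carry (x i)) (fun i => carry (c i))
    (fun _ => zero) (fun _ => zero) (fun _ => zero) (fun _ => zero)

noncomputable def localLayer : Cell d G s → Gate (Cell d G s) :=
  vec (fun _ => zero) (fun i => carry (c i)) (fun _ => zero)
    (fun i => mulShift (c 2) (x i.1) (((i.2 : ℕ) + 1 / 2) / G))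
    (fun i => mulShift (c 2) (x i.1) (((i.2 : ℕ) - 1 / 2) / G)) (fun _ => zero)

noncomputable def squareLayer : Cell d G s → Gate (Cell d G s) :=
  vec (fun _ => zero) (fun i => carry (c i)) (fun _ => zero) (fun i => carry (y i))
    (fun i => requAffine (coord (t i)) 0) (fun _ => zero)

noncomputable def flipLayer : Cell d G s → Gate (Cell d G s) :=
  vec (fun _ => zero) (fun i => carry (c i)) (fun _ => zero) (fun i => carry (y i))
    (fun i => requAffine (-coord (t i)) 1) (fun _ => zero)

noncomputable def deg (α : Fin d → Fin s) : ℕ := ∑ i, (α i : ℕ)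

noncomputable def seedLayer : Cell d G s → Gate (Cell d G s) :=
  vec (fun _ => zero) (fun _ => zero) (fun _ => zero) (fun i => carry (y i)) (fun i => carry (t i))
    (fun q => if deg q.2 = 0 then carry (c 0) else zero)

/-- The value of a member of the partition of unity, in terms of the step functions. -/
noncomputable def bumpValue (T : Fin d × Fin G → ℝ) (i : Fin d) (k : Fin G) : ℝ :=
  (if h : (k : ℕ) + 1 < G then T (i, ⟨k + 1, h⟩) else 1) - if (k : ℕ) = 0 then 0 else T (i, k)

noncomputable def bumpForm (i : Fin d) (k : Fin G) : Cell d G s → ℝ :=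
  (if h : (k : ℕ) + 1 < G then coord (t (i, ⟨k + 1, h⟩)) else 0) -
    if (k : ℕ) = 0 then 0 else coord (t (i, k))

noncomputable def bumpBias (k : Fin G) : ℝ := if (k : ℕ) + 1 < G then 0 else 1

theorem sum_bumpForm_mul (i : Fin d) (k : Fin G) (z : Cell d G s → ℝ) :
    ∑ j, bumpForm i k j * z j + bumpBias k = bumpValue (fun q => z (t q)) i k := by
  unfold bumpForm bumpBias bumpValue
  split_ifs <;> (simp [sub_mul, Finset.sum_sub_distrib, sum_coord_mul]; try ring)

theorem formSize_bumpForm (i : Fin d) (k : Fin G) :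
    formSize (bumpForm i k : Cell d G s → ℝ) ≤ 2 := by
  refine (formSize_sub_le _ _).trans (add_le_add (b := 1) (d := 1) ?_ ?_) <;> split_ifs <;>
    simp [formSize_coord, formSize_zero]

noncomputable def bumpLayer (i : Fin d) : Cell d G s → Gate (Cell d G s) :=
  vec (fun _ => zero) (fun _ => zero) (fun _ => zero) (fun i => carry (y i)) (fun i => carry (t i))
    (fun q => mulAffine (coord (f q)) (bumpForm i (q.1 i)) 0 (bumpBias (q.1 i)))

def lower (α : Fin d → Fin s) (i : Fin d) : Fin d → Fin s :=
  Function.update α i ⟨α i - 1, by omega⟩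

noncomputable def powLayer (τ : ℕ) : Cell d G s → Gate (Cell d G s) :=
  vec (fun _ => zero) (fun _ => zero) (fun _ => zero) (fun i => carry (y i)) (fun _ => zero)
    (fun q => if h : ∃ i, 0 < (q.2 i : ℕ) ∧ deg q.2 = τ then
      mulShift (f (q.1, lower q.2 h.choose)) (y (h.choose, q.1 h.choose)) 0 else carry (f q))

theorem layerCost_inputLayer : layerCost (inputLayer : Cell d G s → _) ≤ 20 * d + 3 + G := by
  have h1 : (requAffine 0 1 : Gate (Fin d)).cost ≤ 1 := by
    simpa [formSize_zero] using cost_requAffine_le (0 : Fin d → ℝ) 1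
  refine (layerCost_vec_le (a := 20) (b := 1) (c := 1) (e := 0) (g := 0) (h := 0)
    cost_carry_le (fun i => ?_) (fun _ => h1) ?_ ?_ ?_).trans ?_
  · fin_cases i
    exacts [h1, h1, cost_zero.trans_le zero_le_one]
  iterate 3 exact fun _ => cost_zero.le
  linarith

theorem layerCost_countLayer :
    layerCost (countLayer : Cell d G s → _) ≤ 20 * d + 16 * (3 * G) + 72 := by
  refine (layerCost_vec_le (a := 20) (b := 16 * G + 24) (c := 0) (e := 0) (g := 0) (h := 0)
    (fun _ => cost_carry_le _) (fun i => ?_) ?_ ?_ ?_ ?_).trans ?_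
  · have h1 := cost_mulAffine_le (onesForm : Cell d G s → ℝ) 0 0 1
    have h2 := formSize_onesForm (d := d) (G := G) (s := s)
    rw [formSize_zero] at h1
    fin_cases i
    · exact (cost_carry_le _).trans (by omega)
    · exact (cost_carry_le _).trans (by omega)
    · exact h1.trans (by omega)
  iterate 4 exact fun _ => cost_zero.le
  linarith

theorem layerCost_growLayer : layerCost (growLayer : Cell d G s → _) ≤ 20 * d + 60 := by
  have h : (requAffine (coord (c 0) + coord (c 1) : Cell d G s → ℝ) 0).cost ≤ 20 := by
    refine (cost_requAffine_le _ _).trans ?_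
    have := formSize_add_le (coord (c 0) : Cell d G s → ℝ) (coord (c 1))
    simp only [formSize_coord] at this
    omega
  refine (layerCost_vec_le (a := 20) (b := 20) (c := 0) (e := 0) (g := 0) (h := 0)
    (fun _ => cost_carry_le _) (fun i => ?_) ?_ ?_ ?_ ?_).trans ?_
  · fin_cases i
    exacts [h, h, cost_carry_le _]
  iterate 4 exact fun _ => cost_zero.le
  linarith

theorem layerCost_idleLayer : layerCost (idleLayer : Cell d G s → _) ≤ 20 * d + 60 := by
  refine (layerCost_vec_le (a := 20) (b := 20) (c := 0) (e := 0) (g := 0) (h := 0)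
    (fun _ => cost_carry_le _) (fun _ => cost_carry_le _) ?_ ?_ ?_ ?_).trans ?_
  iterate 4 exact fun _ => cost_zero.le
  linarith

theorem layerCost_localLayer : layerCost (localLayer : Cell d G s → _) ≤ 72 * (d * G) + 60 := by
  refine (layerCost_vec_le (a := 0) (b := 20) (c := 0) (e := 36) (g := 36) (h := 0)
    (fun _ => cost_zero.le) (fun _ => cost_carry_le _) (fun _ => cost_zero.le)
    (fun _ => cost_mulShift_le _ _ _) (fun _ => cost_mulShift_le _ _ _)
    (fun _ => cost_zero.le)).trans ?_
  linarith

theorem layerCost_squareLayer : layerCost (squareLayer : Cell d G s → _) ≤ 25 * (d * G) + 60 := by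
  refine (layerCost_vec_le (a := 0) (b := 20) (c := 0) (e := 20) (g := 5) (h := 0)
    (fun _ => cost_zero.le) (fun _ => cost_carry_le _) (fun _ => cost_zero.le)
    (fun _ => cost_carry_le _) (fun _ => (cost_requAffine_le _ _).trans ?_)
    (fun _ => cost_zero.le)).trans ?_
  · rw [formSize_coord]
  linarith

theorem layerCost_flipLayer : layerCost (flipLayer : Cell d G s → _) ≤ 25 * (d * G) + 60 := by
  refine (layerCost_vec_le (a := 0) (b := 20) (c := 0) (e := 20) (g := 5) (h := 0)
    (fun _ => cost_zero.le) (fun _ => cost_carry_le _) (fun _ => cost_zero.le)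
    (fun _ => cost_carry_le _) (fun _ => (cost_requAffine_le _ _).trans ?_)
    (fun _ => cost_zero.le)).trans ?_
  · rw [formSize_neg, formSize_coord]
  linarith

theorem layerCost_seedLayer :
    layerCost (seedLayer : Cell d G s → _) ≤ 40 * (d * G) + 20 * (G ^ d * s ^ d) := by
  refine (layerCost_vec_le (a := 0) (b := 0) (c := 0) (e := 20) (g := 20) (h := 20)
    (fun _ => cost_zero.le) (fun _ => cost_zero.le) (fun _ => cost_zero.le)
    (fun _ => cost_carry_le _) (fun _ => cost_carry_le _) (fun _ => ?_)).trans ?_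
  · split_ifs
    exacts [cost_carry_le _, cost_zero.trans_le (by norm_num)]
  linarith

theorem layerCost_bumpLayer (i : Fin d) :
    layerCost (bumpLayer i : Cell d G s → _) ≤ 40 * (d * G) + 52 * (G ^ d * s ^ d) := by
  refine (layerCost_vec_le (a := 0) (b := 0) (c := 0) (e := 20) (g := 20) (h := 52)
    (fun _ => cost_zero.le) (fun _ => cost_zero.le) (fun _ => cost_zero.le)
    (fun _ => cost_carry_le _) (fun _ => cost_carry_le _)
    (fun q => (cost_mulAffine_le _ _ _ _).trans ?_)).trans ?_
  · have := formSize_bumpForm (s := s) i (q.1 i)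
    rw [formSize_coord]
    omega
  linarith

theorem layerCost_powLayer (τ : ℕ) :
    layerCost (powLayer τ : Cell d G s → _) ≤ 20 * (d * G) + 36 * (G ^ d * s ^ d) := by
  refine (layerCost_vec_le (a := 0) (b := 0) (c := 0) (e := 20) (g := 0) (h := 36)
    (fun _ => cost_zero.le) (fun _ => cost_zero.le) (fun _ => cost_zero.le)
    (fun _ => cost_carry_le _) (fun _ => cost_zero.le) (fun _ => ?_)).trans ?_
  · split_ifs
    exacts [cost_mulShift_le _ _ _, (cost_carry_le _).trans (by norm_num)]
  linarith

theorem isBounded_inputLayer (j : Cell d G s) : (inputLayer j).IsBounded := by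
  have h : (requAffine 0 1 : Gate (Fin d)).IsBounded := isBounded_requAffine (by simp) (by simp)
  refine isBounded_vec isBounded_carry (fun i => ?_) (fun _ => h) ?_ ?_ ?_ j
  · fin_cases i
    exacts [h, h, isBounded_zero]
  iterate 3 exact fun _ => isBounded_zero

theorem isBounded_countLayer (j : Cell d G s) : (countLayer j).IsBounded := by
  refine isBounded_vec (fun _ => isBounded_carry _) (fun i => ?_) ?_ ?_ ?_ ?_ j
  · fin_cases i
    exacts [isBounded_carry _, isBounded_carry _,
      isBounded_mulAffine (by simpa using abs_onesForm_le) (by simp)]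
  iterate 4 exact fun _ => isBounded_zero

theorem isBounded_growLayer (j : Cell d G s) : (growLayer j).IsBounded := by
  have h : (requAffine (coord (c 0) + coord (c 1) : Cell d G s → ℝ) 0).IsBounded := by
    refine isBounded_requAffine (fun i => ?_) (by simp)
    simp only [Pi.add_apply, coord]
    split_ifs <;> simp_all
  refine isBounded_vec (fun _ => isBounded_carry _) (fun i => ?_) ?_ ?_ ?_ ?_ j
  · fin_cases i
    exacts [h, h, isBounded_carry _]
  iterate 4 exact fun _ => isBounded_zero

theorem isBounded_idleLayer (j : Cell d G s) : (idleLayer j).IsBounded :=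
  isBounded_vec (fun _ => isBounded_carry _) (fun _ => isBounded_carry _)
    (fun _ => isBounded_zero) (fun _ => isBounded_zero) (fun _ => isBounded_zero)
    (fun _ => isBounded_zero) j

theorem isBounded_localLayer (j : Cell d G s) : (localLayer j).IsBounded := by
  have hk : ∀ k : Fin G, (k : ℝ) + 1 ≤ G := fun k => by exact_mod_cast k.2
  refine isBounded_vec (fun _ => isBounded_zero) (fun _ => isBounded_carry _)
    (fun _ => isBounded_zero) (fun i => isBounded_mulShift (by simp) ?_)
    (fun i => isBounded_mulShift (by simp) ?_) (fun _ => isBounded_zero) j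
  all_goals
    have h1 := hk i.2
    have h2 : (0 : ℝ) ≤ (i.2 : ℕ) := Nat.cast_nonneg _
    rw [abs_div, Nat.abs_cast, div_le_one (by linarith), abs_le]
    constructor <;> linarith

theorem isBounded_squareLayer (j : Cell d G s) : (squareLayer j).IsBounded :=
  isBounded_vec (fun _ => isBounded_zero) (fun _ => isBounded_carry _)
    (fun _ => isBounded_zero) (fun _ => isBounded_carry _)
    (fun _ => isBounded_requAffine (abs_coord_le _) (by simp)) (fun _ => isBounded_zero) j

theorem isBounded_flipLayer (j : Cell d G s) : (flipLayer j).IsBounded :=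
  isBounded_vec (fun _ => isBounded_zero) (fun _ => isBounded_carry _)
    (fun _ => isBounded_zero) (fun _ => isBounded_carry _)
    (fun q => isBounded_requAffine (fun i => by simpa using abs_coord_le (t q) i) (by simp))
    (fun _ => isBounded_zero) j

theorem isBounded_seedLayer (j : Cell d G s) : (seedLayer j).IsBounded := by
  refine isBounded_vec (fun _ => isBounded_zero) (fun _ => isBounded_zero)
    (fun _ => isBounded_zero) (fun _ => isBounded_carry _) (fun _ => isBounded_carry _)
    (fun _ => ?_) j
  split_ifs
  exacts [isBounded_carry _, isBounded_zero]

theorem isBounded_bumpLayer (i : Fin d) (j : Cell d G s) : (bumpLayer i j).IsBounded := by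
  refine isBounded_vec (fun _ => isBounded_zero) (fun _ => isBounded_zero)
    (fun _ => isBounded_zero) (fun _ => isBounded_carry _) (fun _ => isBounded_carry _)
    (fun q => isBounded_mulAffine (fun j => ?_) ?_) j
  · unfold bumpForm coord
    rcases j with j | j | j | j | j | j <;> split_ifs <;> simp_all <;>
      split_ifs <;> simp_all [Fin.ext_iff]
  · unfold bumpBias
    split_ifs <;> simp

theorem isBounded_powLayer (τ : ℕ) (j : Cell d G s) : (powLayer τ j).IsBounded := by
  refine isBounded_vec (fun _ => isBounded_zero) (fun _ => isBounded_zero)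
    (fun _ => isBounded_zero) (fun _ => isBounded_carry _) (fun _ => isBounded_zero)
    (fun _ => ?_) j
  split_ifs
  exacts [isBounded_mulShift (by simp) (by simp), isBounded_carry _]

end Cell

theorem runLayers_append {ι : Type} [Fintype ι] (l₁ l₂ : List (ι → Gate ι)) (z : ι → ℝ) :
    runLayers (l₁ ++ l₂) z = runLayers l₂ (runLayers l₁ z) := List.foldl_append

theorem runLayers_cons {ι : Type} [Fintype ι] (g : ι → Gate ι) (l : List (ι → Gate ι))
    (z : ι → ℝ) : runLayers (g :: l) z = runLayers l (fun j => (g j).val z) := rfl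

theorem runLayers_nil {ι : Type} [Fintype ι] (z : ι → ℝ) : runLayers [] z = z := rfl

/-- A smoothened step, equal to one on `y ≤ 0` and to zero on `1 ≤ y`. -/
noncomputable def stepFn (m : ℕ) (y : ℝ) : ℝ := (max (1 - (max y 0) ^ m) 0) ^ m

theorem iterate_requ {n : ℕ} (hn : n ≠ 0) (t : ℝ) : requ^[n] t = (max t 0) ^ 2 ^ n := by
  obtain ⟨n, rfl⟩ := Nat.exists_eq_succ_of_ne_zero hn
  induction n with
  | zero => simp [requ]
  | succ n ih =>
    rw [Function.iterate_succ_apply', ih (by simp), requ, max_eq_left (by positivity), ← pow_mul,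
      ← pow_succ]

theorem iterate_requ_flip {r : ℕ} (hr : r ≠ 0) (t : ℝ) :
    requ^[r - 1] (requ (1 - requ^[r] t)) = stepFn (2 ^ r) t := by
  rw [← Function.iterate_succ_apply, Nat.succ_eq_add_one, Nat.sub_add_cancel (by omega),
    iterate_requ hr, iterate_requ hr, stepFn]

/-- The constant produced by iterating the growth layer. -/
noncomputable def growth : ℕ → ℝ
  | 0 => 1
  | n + 1 => 4 * growth n ^ 2

theorem growth_pos (n : ℕ) : 0 < growth n := by
  induction n with
  | zero => exact one_pos
  | succ n ih => rw [growth]; positivity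

theorem two_pow_le_growth {n : ℕ} (hn : n ≠ 0) : (2 : ℝ) ^ 2 ^ n ≤ growth n := by
  obtain ⟨n, rfl⟩ := Nat.exists_eq_succ_of_ne_zero hn
  induction n with
  | zero => norm_num [growth]
  | succ n ih =>
    have h := pow_le_pow_left₀ (by positivity) (ih (by simp)) 2
    rw [← pow_mul, ← pow_succ] at h
    have h' : 0 ≤ growth n.succ ^ 2 := by positivity
    exact h.trans (show _ ≤ 4 * growth n.succ ^ 2 by linarith)

namespace Cell

open Gate

variable {d G s : ℕ}

theorem val_inputLayer (z : Fin d → ℝ) :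
    (fun j => ((inputLayer j : Gate (Fin d)).val z)) =
      (vec z ![1, 1, 0] 1 0 0 0 : Cell d G s → ℝ) := by
  have h : (requAffine 0 1 : Gate (Fin d)).val z = 1 := by simp [val_requAffine, requ]
  simp only [inputLayer, val_vec, val_carry, val_zero, h]
  congr 1
  funext i
  fin_cases i
  exacts [h, h, val_zero z]

theorem val_countLayer (z : Fin d → ℝ) :
    (fun j => (countLayer j).val (vec z ![1, 1, 0] 1 0 0 0 : Cell d G s → ℝ)) =
      vec z ![1, 1, (G : ℝ)] 0 0 0 0 := by
  simp only [countLayer, val_vec, val_carry, val_zero]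
  congr 1
  funext i
  fin_cases i
  · exact val_carry _ _
  · exact val_carry _ _
  · refine (val_mulAffine _ _ _ _ _).trans ?_
    rw [sum_onesForm_mul]
    simp [vec]

theorem run_growLayer (n : ℕ) (z : Fin d → ℝ) (b : ℝ) :
    runLayers (List.replicate n growLayer) (vec z ![1, 1, b] 0 0 0 0 : Cell d G s → ℝ) =
      vec z ![growth n, growth n, b] 0 0 0 0 := by
  induction n with
  | zero => rfl
  | succ n ih =>
    rw [List.replicate_succ', runLayers_append, ih, runLayers_cons, runLayers_nil]
    have h : requ (growth n + growth n) = growth (n + 1) := by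
      rw [requ, max_eq_left (by linarith [growth_pos n]), growth]; ring
    have h' : (requAffine (coord (c 0) + coord (c 1)) 0).val
        (vec z ![growth n, growth n, b] 0 0 0 0 : Cell d G s → ℝ) = growth (n + 1) := by
      simp only [val_requAffine, Pi.add_apply, add_mul, Finset.sum_add_distrib, sum_coord_mul,
        add_zero]
      exact h
    simp only [growLayer, val_vec, val_carry, val_zero]
    congr 1
    funext i
    fin_cases i
    exacts [h', h', val_carry _ _]

theorem run_idleLayer (n : ℕ) (z : Fin d → ℝ) (b : Fin 3 → ℝ) :
    runLayers (List.replicate n idleLayer) (vec z b 0 0 0 0 : Cell d G s → ℝ) =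
      vec z b 0 0 0 0 := by
  induction n with
  | zero => rfl
  | succ n ih =>
    rw [List.replicate_succ', runLayers_append, ih, runLayers_cons, runLayers_nil]
    simp only [idleLayer, val_vec, val_carry, val_zero]
    rfl

theorem val_localLayer (z : Fin d → ℝ) (a b e : ℝ) :
    (fun j => (localLayer j).val (vec z ![a, b, e] 0 0 0 0 : Cell d G s → ℝ)) =
      vec 0 ![a, b, e] 0 (fun q => e * (z q.1 - ((q.2 : ℕ) + 1 / 2) / G))
        (fun q => e * (z q.1 - ((q.2 : ℕ) - 1 / 2) / G)) 0 := by
  simp only [localLayer, val_vec, val_carry, val_zero, val_mulShift]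
  rfl

theorem run_squareLayer (n : ℕ) (b : Fin 3 → ℝ) (Y T : Fin d × Fin G → ℝ) :
    runLayers (List.replicate n squareLayer) (vec 0 b 0 Y T 0 : Cell d G s → ℝ) =
      vec 0 b 0 Y (fun q => requ^[n] (T q)) 0 := by
  induction n with
  | zero => rfl
  | succ n ih =>
    rw [List.replicate_succ', runLayers_append, ih, runLayers_cons, runLayers_nil]
    simp only [squareLayer, val_vec, val_carry, val_zero, val_requAffine, sum_coord_mul, add_zero,
      Function.iterate_succ_apply']
    rfl

theorem val_flipLayer (b : Fin 3 → ℝ) (Y T : Fin d × Fin G → ℝ) :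
    (fun j => (flipLayer j).val (vec 0 b 0 Y T 0 : Cell d G s → ℝ)) =
      vec 0 b 0 Y (fun q => requ (1 - T q)) 0 := by
  simp only [flipLayer, val_vec, val_carry, val_zero, val_requAffine, Pi.neg_apply, neg_mul,
    Finset.sum_neg_distrib, sum_coord_mul, neg_add_eq_sub]
  rfl

theorem val_seedLayer (b : Fin 3 → ℝ) (Y T : Fin d × Fin G → ℝ) :
    (fun j => (seedLayer j).val (vec 0 b 0 Y T 0 : Cell d G s → ℝ)) =
      vec 0 0 0 Y T (fun q => if deg q.2 = 0 then b 0 else 0) := by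
  simp only [seedLayer, val_vec, val_carry, val_zero]
  congr 1
  funext q
  split_ifs
  exacts [val_carry _ _, val_zero _]

theorem run_bumpLayer (l : List (Fin d)) (Y T : Fin d × Fin G → ℝ)
    (F : (Fin d → Fin G) × (Fin d → Fin s) → ℝ) :
    runLayers (l.map bumpLayer) (vec 0 0 0 Y T F : Cell d G s → ℝ) =
      vec 0 0 0 Y T fun q => F q * (l.map fun i => bumpValue T i (q.1 i)).prod := by
  induction l generalizing F with
  | nil => simp [runLayers_nil]
  | cons i l ih =>
    rw [List.map_cons, runLayers_cons]
    simp only [bumpLayer, val_vec, val_carry, val_zero, val_mulAffine, sum_coord_mul, add_zero,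
      sum_bumpForm_mul]
    refine (ih _).trans ?_
    simp only [List.map_cons, List.prod_cons, mul_assoc]
    rfl

theorem val_powLayer (τ : ℕ) (Y T : Fin d × Fin G → ℝ)
    (F : (Fin d → Fin G) × (Fin d → Fin s) → ℝ) :
    (fun j => (powLayer τ j).val (vec 0 0 0 Y T F : Cell d G s → ℝ)) =
      vec 0 0 0 Y 0 fun q => if h : ∃ i, 0 < (q.2 i : ℕ) ∧ deg q.2 = τ then
        F (q.1, lower q.2 h.choose) * Y (h.choose, q.1 h.choose) else F q := by
  simp only [powLayer, val_vec, val_carry, val_zero]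
  congr 1
  funext q
  split_ifs
  · rw [val_mulShift, sub_zero]; rfl
  · rw [val_carry]; rfl

theorem deg_lower (α : Fin d → Fin s) {i : Fin d} (hi : 0 < (α i : ℕ)) :
    deg (lower α i) + 1 = deg α := by
  unfold deg
  rw [← Finset.add_sum_erase _ _ (Finset.mem_univ i),
    ← Finset.add_sum_erase _ (fun i => (α i : ℕ)) (Finset.mem_univ i),
    Finset.sum_congr rfl (g := fun j => (α j : ℕ))]
  · simp [lower]; omega
  · intro j hj
    rw [lower, Function.update_of_ne (Finset.ne_of_mem_erase hj)]

theorem prod_pow_lower (α : Fin d → Fin s) {i : Fin d} (hi : 0 < (α i : ℕ)) (y : Fin d → ℝ) :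
    (∏ j, y j ^ (lower α i j : ℕ)) * y i = ∏ j, y j ^ (α j : ℕ) := by
  rw [← Finset.mul_prod_erase _ _ (Finset.mem_univ i),
    ← Finset.mul_prod_erase _ (fun j => y j ^ (α j : ℕ)) (Finset.mem_univ i),
    Finset.prod_congr rfl (g := fun j => y j ^ (α j : ℕ))]
  · have : ((α i : ℕ) - 1) + 1 = α i := by omega
    simp only [lower, Function.update_self]
    conv_rhs => rw [← this, pow_succ]
    ring
  · intro j hj
    rw [lower, Function.update_of_ne (Finset.ne_of_mem_erase hj)]

theorem prod_pow_eq_one {α : Fin d → Fin s} (h : deg α = 0) (y : Fin d → ℝ) :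
    ∏ j, y j ^ (α j : ℕ) = 1 := by
  refine Finset.prod_eq_one fun j _ => ?_
  rw [(Finset.sum_eq_zero_iff.mp h) j (Finset.mem_univ j), pow_zero]

theorem run_powLayer (n : ℕ) (Y T : Fin d × Fin G → ℝ) (w : (Fin d → Fin G) → ℝ) :
    ∃ T' : Fin d × Fin G → ℝ,
    runLayers ((List.range n).map fun τ => powLayer (τ + 1))
      (vec 0 0 0 Y T (fun q => if deg q.2 = 0 then w q.1 else 0) : Cell d G s → ℝ) =
      vec 0 0 0 Y T' fun q => if deg q.2 ≤ n then
        w q.1 * ∏ i, Y (i, q.1 i) ^ (q.2 i : ℕ) else 0 := by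
  induction n with
  | zero =>
    refine ⟨T, ?_⟩
    rw [List.range_zero, List.map_nil, runLayers_nil]
    congr 1
    funext q
    simp only [Nat.le_zero]
    split_ifs with h
    · rw [prod_pow_eq_one h (fun i => Y (i, q.1 i)), mul_one]
    · rfl
  | succ n ih =>
    obtain ⟨T', hT'⟩ := ih
    refine ⟨0, ?_⟩
    rw [List.range_succ, List.map_append, runLayers_append, hT', List.map_singleton,
      runLayers_cons, runLayers_nil, val_powLayer]
    congr 1
    funext q
    by_cases h : ∃ i, 0 < (q.2 i : ℕ) ∧ deg q.2 = n + 1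
    · have h1 := deg_lower q.2 h.choose_spec.1
      rw [dif_pos h, if_pos (show deg (lower q.2 h.choose) ≤ n by omega),
        if_pos (by have := h.choose_spec.2; omega),
        ← prod_pow_lower q.2 h.choose_spec.1 (fun i => Y (i, q.1 i)), mul_assoc]
    · rw [dif_neg h]
      have h1 : deg q.2 ≠ n + 1 := fun h1 => h <| by
        by_contra! h2
        have : deg q.2 = 0 := Finset.sum_eq_zero fun i _ => by
          by_contra h3
          exact h2 i (Nat.pos_of_ne_zero h3) h1
        omega
      by_cases h2 : deg q.2 ≤ n
      · rw [if_pos h2, if_pos (by omega)]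
      · rw [if_neg h2, if_neg (by omega)]

noncomputable def program (d G s M pad r : ℕ) : List (Cell d G s → Gate (Cell d G s)) :=
  [countLayer] ++ List.replicate M growLayer ++ List.replicate pad idleLayer ++ [localLayer] ++
    List.replicate r squareLayer ++ [flipLayer] ++ List.replicate (r - 1) squareLayer ++
    [seedLayer] ++ (List.finRange d).map bumpLayer ++
    (List.range (s - 1)).map fun τ => powLayer (τ + 1)

/-- The partition of unity subordinate to the grid. -/
noncomputable def bump (G m : ℕ) (k : Fin G) (t : ℝ) : ℝ :=
  (if (k : ℕ) + 1 < G then stepFn m (G * t - (k + 1 : ℕ) + 1 / 2) else 1) -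
    if (k : ℕ) = 0 then 0 else stepFn m (G * t - (k : ℕ) + 1 / 2)

theorem run_program {M pad r : ℕ} (hr : r ≠ 0) (hG : G ≠ 0) (z : Fin d → ℝ)
    (q : (Fin d → Fin G) × (Fin d → Fin s)) :
    runLayers (program d G s M pad r) (fun j => (inputLayer j).val z) (f q) =
      if deg q.2 ≤ s - 1 then growth M * ((∏ i, bump G (2 ^ r) (q.1 i) (z i)) *
        ∏ i, (G * z i - ((q.1 i : ℕ) + 1 / 2)) ^ (q.2 i : ℕ)) else 0 := by
  have hG' : (G : ℝ) ≠ 0 := Nat.cast_ne_zero.mpr hG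
  simp only [program, runLayers_append, runLayers_cons, runLayers_nil, val_inputLayer,
    val_countLayer, run_growLayer, run_idleLayer, val_localLayer, run_squareLayer, val_flipLayer,
    val_seedLayer, run_bumpLayer, iterate_requ_flip hr]
  set T : Fin d × Fin G → ℝ := fun q => stepFn (2 ^ r) (G * (z q.1 - ((q.2 : ℕ) - 1 / 2) / G))
    with hT
  set Y : Fin d × Fin G → ℝ := fun q => G * (z q.1 - ((q.2 : ℕ) + 1 / 2) / G) with hY
  have h1 : (fun q : (Fin d → Fin G) × (Fin d → Fin s) =>
      (if deg q.2 = 0 then ![growth M, growth M, (G : ℝ)] 0 else 0) *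
        ((List.finRange d).map fun i => bumpValue T i (q.1 i)).prod) =
      fun q => if deg q.2 = 0 then growth M * ∏ i, bumpValue T i (q.1 i) else 0 := by
    funext q
    rw [Fin.prod_univ_def]
    split_ifs <;> simp
  obtain ⟨T', hT'⟩ := run_powLayer (s := s) (s - 1) Y T
    (fun k => growth M * ∏ i, bumpValue T i (k i))
  rw [h1, hT']
  have h2 : ∀ i, bumpValue T i (q.1 i) = bump G (2 ^ r) (q.1 i) (z i) := fun i => by
    have h3 : ∀ a : ℝ, (G : ℝ) * (z i - (a - 1 / 2) / G) = G * z i - a + 1 / 2 := fun a => by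
      field_simp; ring
    simp only [bumpValue, bump, hT, h3]
    congr 1
  have h3 : ∀ i, Y (i, q.1 i) = G * z i - ((q.1 i : ℕ) + 1 / 2) := fun i => by
    simp only [hY]; field_simp
  simp only [vec, Sum.elim_inr, h2, h3, mul_assoc]

theorem length_program (d G s M pad r : ℕ) :
    (program d G s M pad r).length = 1 + M + pad + 1 + r + 1 + (r - 1) + 1 + d + (s - 1) := by
  simp [program]; omega

theorem isBounded_program {M pad r : ℕ} :
    ∀ l ∈ program d G s M pad r, ∀ i, (l i).IsBounded := by
  intro l hl
  simp only [program, List.mem_append, List.mem_singleton, List.mem_replicate, List.mem_map] at hl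
  rcases hl with ((((((((rfl | ⟨_, rfl⟩) | ⟨_, rfl⟩) | rfl) | ⟨_, rfl⟩) | rfl) | ⟨_, rfl⟩) | rfl) |
    ⟨i, _, rfl⟩) | ⟨τ, _, rfl⟩
  exacts [isBounded_countLayer, isBounded_growLayer, isBounded_idleLayer, isBounded_localLayer,
    isBounded_squareLayer, isBounded_flipLayer, isBounded_squareLayer, isBounded_seedLayer,
    isBounded_bumpLayer i, isBounded_powLayer _]

theorem layerCost_program {M pad r : ℕ} :
    ((program d G s M pad r).map layerCost).sum ≤
      (20 * d + 16 * (3 * G) + 72) + M * (20 * d + 60) + pad * (20 * d + 60) +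
      (72 * (d * G) + 60) + r * (25 * (d * G) + 60) + (25 * (d * G) + 60) +
      (r - 1) * (25 * (d * G) + 60) + (40 * (d * G) + 20 * (G ^ d * s ^ d)) +
      d * (40 * (d * G) + 52 * (G ^ d * s ^ d)) +
      (s - 1) * (20 * (d * G) + 36 * (G ^ d * s ^ d)) := by
  simp only [program, List.map_append, List.sum_append, List.map_singleton, List.sum_singleton,
    List.map_replicate, List.sum_replicate, smul_eq_mul, List.map_map]
  have h1 : ((List.finRange d).map (layerCost ∘ (bumpLayer (s := s) (G := G)))).sum ≤
      d * (40 * (d * G) + 52 * (G ^ d * s ^ d)) := by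
    refine (List.sum_le_card_nsmul _ (40 * (d * G) + 52 * (G ^ d * s ^ d)) ?_).trans (by simp)
    simp only [List.mem_map]
    rintro _ ⟨i, _, rfl⟩
    exact layerCost_bumpLayer i
  have h2 : ((List.range (s - 1)).map (layerCost ∘ fun τ => powLayer (d := d) (s := s) (G := G)
      (τ + 1))).sum ≤ (s - 1) * (20 * (d * G) + 36 * (G ^ d * s ^ d)) := by
    refine (List.sum_le_card_nsmul _ (20 * (d * G) + 36 * (G ^ d * s ^ d)) ?_).trans (by simp)
    simp only [List.mem_map]
    rintro _ ⟨i, _, rfl⟩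
    exact layerCost_powLayer _
  gcongr
  exacts [layerCost_countLayer, layerCost_growLayer, layerCost_idleLayer, layerCost_localLayer,
    layerCost_squareLayer, layerCost_flipLayer, layerCost_squareLayer, layerCost_seedLayer]

end Cell

section PartialDerivatives

variable {d : ℕ}

/-- Iterated partial derivative along a word of coordinate directions. -/
noncomputable def lderiv (l : List (Fin d)) (g : (Fin d → ℝ) → ℝ) : (Fin d → ℝ) → ℝ :=
  l.foldr pderiv1 g

theorem lderiv_cons (i : Fin d) (l : List (Fin d)) (g : (Fin d → ℝ) → ℝ) :
    lderiv (i :: l) g = pderiv1 i (lderiv l g) := rfl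

theorem lderiv_append (l₁ l₂ : List (Fin d)) (g : (Fin d → ℝ) → ℝ) :
    lderiv (l₁ ++ l₂) g = lderiv l₁ (lderiv l₂ g) := List.foldr_append

theorem lderiv_eq_iteratedFDeriv (l : List (Fin d)) {g : (Fin d → ℝ) → ℝ}
    (hg : ContDiff ℝ l.length g) (x : Fin d → ℝ) :
    lderiv l g x = iteratedFDeriv ℝ l.length g x fun j => Pi.single (l.get j) 1 := by
  induction l generalizing x with
  | nil => simp [lderiv]
  | cons i l ih =>
    have hg' : ContDiff ℝ l.length g := hg.of_le (by simp)
    have h : lderiv l g = fun x => iteratedFDeriv ℝ l.length g x fun j => Pi.single (l.get j) 1 :=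
      funext (ih hg')
    have hd : Differentiable ℝ fun x => iteratedFDeriv ℝ l.length g x :=
      hg.differentiable_iteratedFDeriv (by simp only [List.length_cons]; norm_cast; omega)
    rw [lderiv_cons, pderiv1, h, fderiv_continuousMultilinear_apply_const_apply (hd x)]
    exact (iteratedFDeriv_succ_apply_left (𝕜 := ℝ) (f := g) (x := x) (n := l.length)
      fun j => Pi.single ((i :: l).get j) 1).symm

theorem abs_lderiv_le (l : List (Fin d)) {g : (Fin d → ℝ) → ℝ} (hg : ContDiff ℝ l.length g)
    (x : Fin d → ℝ) : |lderiv l g x| ≤ ‖iteratedFDeriv ℝ l.length g x‖ := by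
  rw [lderiv_eq_iteratedFDeriv l hg, ← Real.norm_eq_abs]
  refine (ContinuousMultilinearMap.le_opNorm_mul_prod_of_le (iteratedFDeriv ℝ l.length g x)
    (b := fun _ => 1) fun j => ?_).trans (by simp)
  simp [Pi.norm_single]

theorem norm_iteratedFDeriv_le_of_lderiv {n : ℕ} {g : (Fin d → ℝ) → ℝ} (hg : ContDiff ℝ n g)
    {x : Fin d → ℝ} {C : ℝ} (h : ∀ l : List (Fin d), l.length = n → |lderiv l g x| ≤ C) :
    ‖iteratedFDeriv ℝ n g x‖ ≤ d ^ n * C := by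
  have key : ∀ w : Fin n → Fin d,
      |iteratedFDeriv ℝ n g x fun j => Pi.single (w j) 1| ≤ C := fun w => by
    have h1 := h (List.ofFn w) (by simp)
    rw [lderiv_eq_iteratedFDeriv _ (by simpa using hg)] at h1
    have : ∀ {a : ℕ} (ha : a = n) (v : Fin a → Fin d → ℝ),
        iteratedFDeriv ℝ a g x v = iteratedFDeriv ℝ n g x (fun j => v (Fin.cast ha.symm j)) := by
      rintro a rfl v; rfl
    rw [this (by simp)] at h1
    simpa using h1
  rcases isEmpty_or_nonempty (Fin n → Fin d) with he | ⟨⟨w⟩⟩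
  · refine ContinuousMultilinearMap.opNorm_le_bound ?_ fun v => ?_
    all_goals
      obtain ⟨hn, hd⟩ : n ≠ 0 ∧ d = 0 := by
        rw [isEmpty_fun] at he
        obtain ⟨h1, h2⟩ := he
        exact ⟨Fin.pos_iff_nonempty.mpr h1 |>.ne', Nat.eq_zero_of_not_pos fun h => h2.elim ⟨0, h⟩⟩
      subst hd
    · simp [hn]
    · have : v ⟨0, by omega⟩ = 0 := Subsingleton.elim _ _
      rw [ContinuousMultilinearMap.map_coord_zero _ _ this]
      simp [hn]
  have hC : 0 ≤ C := (abs_nonneg _).trans (key w)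
  refine ContinuousMultilinearMap.opNorm_le_bound (by positivity) fun v => ?_
  have hv : v = fun j => ∑ a, v j a • (Pi.single a 1 : Fin d → ℝ) := by
    funext j b
    simp [Finset.sum_apply, Pi.single_apply]
  conv_lhs => rw [hv]
  rw [ContinuousMultilinearMap.map_sum]
  refine (norm_sum_le _ _).trans ((Finset.sum_le_card_nsmul _ _ (C * ∏ i, ‖v i‖)
    fun w _ => ?_).trans ?_)
  · rw [ContinuousMultilinearMap.map_smul_univ, norm_smul, mul_comm, Real.norm_eq_abs, norm_prod]
    exact mul_le_mul (key w) (Finset.prod_le_prod (fun _ _ => norm_nonneg _)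
      fun j _ => norm_le_pi_norm (v j) (w j)) (by positivity) hC
  · simp [mul_assoc]

/-- The word of directions underlying `mderiv`. -/
def multiWord (γ : Fin d → ℕ) : List (Fin d) :=
  (List.finRange d).flatMap fun i => List.replicate (γ i) i

theorem mderiv_eq_lderiv (γ : Fin d → ℕ) (g : (Fin d → ℝ) → ℝ) :
    mderiv γ g = lderiv (multiWord γ) g := by
  have h1 : ∀ (n : ℕ) (i : Fin d) (h : (Fin d → ℝ) → ℝ),
      (pderiv1 i)^[n] h = lderiv (List.replicate n i) h := fun n i h => by
    induction n with
    | zero => rfl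
    | succ n ih => rw [Function.iterate_succ_apply', ih, List.replicate_succ, lderiv_cons]
  unfold mderiv multiWord
  induction List.finRange d with
  | nil => rfl
  | cons i l ih => rw [List.foldr_cons, ih, List.flatMap_cons, lderiv_append, h1]

theorem length_multiWord (γ : Fin d → ℕ) : (multiWord γ).length = ∑ i, γ i := by
  rw [multiWord, List.length_flatMap, Fin.sum_univ_def]
  simp

theorem count_multiWord (γ : Fin d → ℕ) (j : Fin d) : (multiWord γ).count j = γ j := by
  have h : (multiWord γ).count j = ∑ i, if i = j then γ i else 0 := by
    rw [multiWord, List.count_flatMap, Fin.sum_univ_def]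
    congr 1
    refine List.map_congr_left fun i _ => ?_
    simp [List.count_replicate]
  rw [h]
  simp

theorem contDiff_pderiv1 {g : (Fin d → ℝ) → ℝ} (hg : ContDiff ℝ (⊤ : ℕ∞) g) (i : Fin d) :
    ContDiff ℝ (⊤ : ℕ∞) (pderiv1 i g) :=
  (hg.fderiv_right (m := (⊤ : ℕ∞)) (by simp)).clm_apply contDiff_const

theorem contDiff_lderiv {g : (Fin d → ℝ) → ℝ} (hg : ContDiff ℝ (⊤ : ℕ∞) g) (l : List (Fin d)) :
    ContDiff ℝ (⊤ : ℕ∞) (lderiv l g) := by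
  induction l with
  | nil => exact hg
  | cons i l ih => exact contDiff_pderiv1 ih i

theorem pderiv1_comm {g : (Fin d → ℝ) → ℝ} (hg : ContDiff ℝ (⊤ : ℕ∞) g) (i j : Fin d) :
    pderiv1 i (pderiv1 j g) = pderiv1 j (pderiv1 i g) := by
  have hd : Differentiable ℝ (fderiv ℝ g) :=
    (hg.fderiv_right (m := (⊤ : ℕ∞)) (by simp)).differentiable (by simp)
  have key : ∀ (i j : Fin d) (x : Fin d → ℝ), pderiv1 i (pderiv1 j g) x =
      fderiv ℝ (fderiv ℝ g) x (Pi.single i 1) (Pi.single j 1) := fun i j x => by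
    unfold pderiv1
    rw [fderiv_clm_apply (hd x) (differentiableAt_const _)]
    simp
  funext x
  rw [key, key]
  exact (hg.contDiffAt.isSymmSndFDerivAt (by
    rw [minSmoothness_of_isRCLikeNormedField]
    exact WithTop.coe_le_coe.mpr (le_top (a := (2 : ℕ∞))))).eq _ _

theorem lderiv_perm {l₁ l₂ : List (Fin d)} (h : l₁.Perm l₂) {g : (Fin d → ℝ) → ℝ}
    (hg : ContDiff ℝ (⊤ : ℕ∞) g) : lderiv l₁ g = lderiv l₂ g := by
  induction h with
  | nil => rfl
  | cons i _ ih => rw [lderiv_cons, ih, lderiv_cons]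
  | swap i j l =>
    rw [lderiv_cons, lderiv_cons, pderiv1_comm (contDiff_lderiv hg l), lderiv_cons, lderiv_cons]
  | trans _ _ ih₁ ih₂ => rw [ih₁, ih₂]

theorem mderiv_update_succ {g : (Fin d → ℝ) → ℝ} (hg : ContDiff ℝ (⊤ : ℕ∞) g) (γ : Fin d → ℕ)
    (i : Fin d) : mderiv (Function.update γ i (γ i + 1)) g = mderiv γ (pderiv1 i g) := by
  rw [mderiv_eq_lderiv, mderiv_eq_lderiv,
    show pderiv1 i g = lderiv [i] g from rfl, ← lderiv_append]
  refine lderiv_perm (List.perm_iff_count.mpr fun j => ?_) hg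
  rw [List.count_append, count_multiWord, count_multiWord]
  by_cases h : j = i
  · subst h; simp
  · rw [Function.update_of_ne h, List.count_singleton]
    simp [Ne.symm h]

/-- Every word of directions is, for smooth functions, equivalent to a multi-index. -/
theorem lderiv_eq_mderiv {g : (Fin d → ℝ) → ℝ} (hg : ContDiff ℝ (⊤ : ℕ∞) g) (l : List (Fin d)) :
    lderiv l g = mderiv (fun i => l.count i) g := by
  rw [mderiv_eq_lderiv]
  exact lderiv_perm (List.perm_iff_count.mpr fun j => by rw [count_multiWord]) hg

theorem sum_count (l : List (Fin d)) : ∑ i, l.count i = l.length := by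
  simpa using Multiset.sum_count_eq_card (s := Finset.univ) (m := (l : Multiset (Fin d)))

theorem convex_cube : Convex ℝ (cube d) := convex_Icc _ _

theorem norm_sub_le_min_eucDist {x y : Fin d → ℝ} (hx : x ∈ cube d) (hy : y ∈ cube d) :
    ‖x - y‖ ≤ min 1 (eucDist x y) := by
  refine le_min ?_ ?_
  · refine (pi_norm_le_iff_of_nonneg zero_le_one).mpr fun i => ?_
    have h1 := hx.1 i
    have h2 := hx.2 i
    have h3 := hy.1 i
    have h4 := hy.2 i
    simp only [Pi.zero_apply, Pi.one_apply] at h1 h2 h3 h4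
    rw [Pi.sub_apply, Real.norm_eq_abs, abs_le]
    constructor <;> linarith
  · refine (pi_norm_le_iff_of_nonneg (Real.sqrt_nonneg _)).mpr fun i => ?_
    rw [Real.norm_eq_abs, Pi.sub_apply]
    exact Real.abs_le_sqrt (Finset.single_le_sum (f := fun i => (x i - y i) ^ 2)
      (fun _ _ => sq_nonneg _) (Finset.mem_univ i))

theorem eucDist_le (x y : Fin d → ℝ) : eucDist x y ≤ d * ‖x - y‖ := by
  refine Real.sqrt_le_iff.mpr ⟨by positivity, ?_⟩
  have h : ∀ i, (x i - y i) ^ 2 ≤ ‖x - y‖ ^ 2 := fun i => by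
    rw [← sq_abs, ← Real.norm_eq_abs]
    exact pow_le_pow_left₀ (norm_nonneg _) (norm_le_pi_norm (x - y) i) 2
  refine (Finset.sum_le_card_nsmul _ _ _ fun i _ => h i).trans ?_
  rw [Finset.card_univ, Fintype.card_fin, nsmul_eq_mul, mul_pow]
  gcongr
  rcases Nat.eq_zero_or_pos d with rfl | hd
  · simp
  · have : (1 : ℝ) ≤ d := by exact_mod_cast hd
    nlinarith

theorem holderNormLeOn_of_norm_iteratedFDeriv_le {ℓ : ℕ} {g : (Fin d → ℝ) → ℝ} {E : ℝ}
    (hg : ContDiff ℝ ℓ g) (h : ∀ n ≤ ℓ, ∀ x ∈ cube d, ‖iteratedFDeriv ℝ n g x‖ ≤ E) :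
    HolderNormLeOn (cube d) ℓ g E := by
  cases ℓ with
  | zero => exact fun x hx => by simpa using h 0 le_rfl x hx
  | succ m =>
    refine ⟨fun γ hγ x hx => ?_, fun γ hγ x hx y hy _ => ?_⟩
    · rw [mderiv_eq_lderiv]
      have hl : (multiWord γ).length ≤ m + 1 := by rw [length_multiWord]; omega
      exact (abs_lderiv_le _ (hg.of_le (by exact_mod_cast hl)) x).trans (h _ hl x hx)
    · have hl : (multiWord γ).length = m := by rw [length_multiWord, hγ]
      have hg' : ContDiff ℝ (multiWord γ).length g := by
        rw [hl]; exact hg.of_le (by exact_mod_cast Nat.le_succ m)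
      rw [mderiv_eq_lderiv, lderiv_eq_iteratedFDeriv _ hg', lderiv_eq_iteratedFDeriv _ hg',
        ← Real.norm_eq_abs, ← sub_apply]
      refine (ContinuousMultilinearMap.le_opNorm_mul_prod_of_le _ (b := fun _ => 1)
        fun j => by simp [Pi.norm_single]).trans ?_
      rw [Finset.prod_const_one, mul_one]
      have hE : 0 ≤ E := (norm_nonneg _).trans (h 0 (by simp) x hx)
      have hd : Differentiable ℝ fun x => iteratedFDeriv ℝ m g x :=
        hg.differentiable_iteratedFDeriv (by exact_mod_cast Nat.lt_succ_self m)
      refine (Convex.norm_image_sub_le_of_norm_fderiv_le (𝕜 := ℝ) (C := E)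
        (f := iteratedFDeriv ℝ (multiWord γ).length g) (fun z _ => ?_) (fun z hz => ?_)
        convex_cube hy hx).trans
        (mul_le_mul_of_nonneg_left (norm_sub_le_min_eucDist hx hy) hE)
      · rw [hl]; exact hd z
      · rw [hl, norm_fderiv_iteratedFDeriv]
        exact h _ le_rfl z hz

end PartialDerivatives

section Taylor

variable {d s : ℕ}

/-- The monomial `z ^ α / α!`. -/
noncomputable def divMonomial (α : Fin d → ℕ) (z : Fin d → ℝ) : ℝ :=
  ∏ j, z j ^ α j / (Nat.factorial (α j) : ℝ)

/-- The Taylor polynomial of total degree less than `m`, for `m ≤ s`. -/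
noncomputable def taylorPoly (s m : ℕ) (g : (Fin d → ℝ) → ℝ) (t x : Fin d → ℝ) : ℝ :=
  ∑ α : Fin d → Fin s, if Cell.deg α < m then
    mderiv (fun i => (α i : ℕ)) g t * divMonomial (fun i => (α i : ℕ)) (x - t) else 0

theorem contDiff_divMonomial (α : Fin d → ℕ) (t : Fin d → ℝ) :
    ContDiff ℝ (⊤ : ℕ∞) fun x => divMonomial α (x - t) := by
  unfold divMonomial
  refine contDiff_prod fun j _ => ContDiff.div_const (ContDiff.pow ?_ _) _
  exact (contDiff_apply ℝ ℝ j).comp (contDiff_id.sub contDiff_const)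

theorem contDiff_taylorPoly (m : ℕ) (g : (Fin d → ℝ) → ℝ) (t : Fin d → ℝ) :
    ContDiff ℝ (⊤ : ℕ∞) (taylorPoly s m g t) := by
  unfold taylorPoly
  refine ContDiff.sum fun α _ => ?_
  split_ifs
  exacts [contDiff_const.mul (contDiff_divMonomial _ t), contDiff_const]

theorem pderiv1_eq_deriv_update {g : (Fin d → ℝ) → ℝ} {x : Fin d → ℝ}
    (hg : DifferentiableAt ℝ g x) (i : Fin d) :
    pderiv1 i g x = deriv (fun τ => g (Function.update x i τ)) (x i) := by
  have h := hasDerivAt_update x i (x i)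
  have hg' : HasFDerivAt g (fderiv ℝ g x) (Function.update x i (x i)) := by
    rw [Function.update_eq_self]; exact hg.hasFDerivAt
  exact (hg'.comp_hasDerivAt (x i) h).deriv.symm

theorem pderiv1_divMonomial (α : Fin d → ℕ) (t x : Fin d → ℝ) (i : Fin d) :
    pderiv1 i (fun x => divMonomial α (x - t)) x =
      if α i = 0 then 0 else divMonomial (Function.update α i (α i - 1)) (x - t) := by
  rw [pderiv1_eq_deriv_update ((contDiff_divMonomial α t).differentiable (by simp) x)]
  have h1 : (fun τ => divMonomial α (Function.update x i τ - t)) = fun τ =>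
      (τ - t i) ^ α i / (Nat.factorial (α i) : ℝ) *
        ∏ j ∈ Finset.univ.erase i, (x j - t j) ^ α j / (Nat.factorial (α j) : ℝ) := by
    funext τ
    rw [divMonomial, ← Finset.mul_prod_erase _ _ (Finset.mem_univ i)]
    congr 1
    · simp
    · refine Finset.prod_congr rfl fun j hj => ?_
      rw [Pi.sub_apply, Function.update_of_ne (Finset.ne_of_mem_erase hj)]
  have h2 : HasDerivAt (fun τ : ℝ => (τ - t i) ^ α i / (Nat.factorial (α i) : ℝ))
      (α i * (x i - t i) ^ (α i - 1) * 1 / (Nat.factorial (α i) : ℝ)) (x i) :=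
    (((hasDerivAt_id (x i)).sub_const (t i)).pow (α i)).div_const _
  rw [h1, (h2.mul_const _).deriv]
  split_ifs with h
  · simp [h]
  · rw [divMonomial, ← Finset.mul_prod_erase _ _ (Finset.mem_univ i)]
    obtain ⟨n, hn⟩ := Nat.exists_eq_succ_of_ne_zero h
    congr 1
    · rw [Function.update_self, hn, Nat.factorial_succ, Pi.sub_apply]
      have : (Nat.factorial n : ℝ) ≠ 0 := by positivity
      simp only [Nat.succ_eq_add_one, Nat.add_sub_cancel]
      push_cast
      field_simp
    · refine Finset.prod_congr rfl fun j hj => ?_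
      rw [Function.update_of_ne (Finset.ne_of_mem_erase hj), Pi.sub_apply]

theorem pderiv1_taylorPoly {g : (Fin d → ℝ) → ℝ} (hg : ContDiff ℝ (⊤ : ℕ∞) g) {m : ℕ}
    (hm : m + 1 ≤ s) (t : Fin d → ℝ) (i : Fin d) :
    pderiv1 i (taylorPoly s (m + 1) g t) = taylorPoly s m (pderiv1 i g) t := by
  funext x
  have hd : ∀ α : Fin d → ℕ, DifferentiableAt ℝ (fun x => divMonomial α (x - t)) x := fun α =>
    (contDiff_divMonomial α t).differentiable (by simp) x
  have h1 : pderiv1 i (taylorPoly s (m + 1) g t) x = ∑ α : Fin d → Fin s,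
      if Cell.deg α < m + 1 then mderiv (fun i => (α i : ℕ)) g t *
        pderiv1 i (fun x => divMonomial (fun i => (α i : ℕ)) (x - t)) x else 0 := by
    unfold pderiv1 taylorPoly
    rw [fderiv_fun_sum, sum_apply]
    · refine Finset.sum_congr rfl fun α _ => ?_
      split_ifs
      · rw [fderiv_const_mul (hd _)]; rfl
      · simp
    · intro α _
      split_ifs
      exacts [(differentiableAt_const _).mul (hd _), differentiableAt_const _]
  rw [h1, taylorPoly]
  simp only [pderiv1_divMonomial]
  rw [← Finset.sum_filter, ← Finset.sum_filter]
  rw [← Finset.sum_filter_of_ne (p := fun α : Fin d → Fin s => (α i : ℕ) ≠ 0)]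
  swap
  · intro α _ h h0
    exact h (by rw [if_pos h0, mul_zero])
  have hraise : ∀ β : Fin d → Fin s, Cell.deg β < m → (β i : ℕ) + 1 < s := fun β hβ => by
    have := Finset.single_le_sum (f := fun j => (β j : ℕ)) (fun _ _ => Nat.zero_le _)
      (Finset.mem_univ i)
    unfold Cell.deg at hβ
    omega
  symm
  refine Finset.sum_bij' (fun β hβ => Function.update β i
      ⟨β i + 1, hraise β (by simpa using hβ)⟩) (fun α _ => Cell.lower α i) ?_ ?_ ?_ ?_ ?_
  · intro β hβ
    have h0 := Cell.deg_lower (Function.update β i ⟨β i + 1, hraise β (by simpa using hβ)⟩)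
      (i := i) (by simp)
    simp only [Finset.mem_filter, Finset.mem_univ, true_and, Function.update_self] at hβ ⊢
    have h2 : Cell.lower (Function.update β i ⟨β i + 1, hraise β hβ⟩) i = β := by
      simp [Cell.lower]
    rw [h2] at h0
    exact ⟨by omega, by simp⟩
  · intro α hα
    simp only [Finset.mem_filter, Finset.mem_univ, true_and] at hα ⊢
    have := Cell.deg_lower α (i := i) (by omega)
    omega
  · intro β hβ
    simp [Cell.lower]
  · intro α hα
    simp only [Finset.mem_filter, Finset.mem_univ, true_and] at hα
    have : (α i : ℕ) - 1 + 1 = α i := by omega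
    simp [Cell.lower, this]
  · intro β hβ
    have h2 : (fun j => ((Function.update β i ⟨β i + 1, hraise β (by simpa using hβ)⟩ j :
        Fin s) : ℕ)) = Function.update (fun j => (β j : ℕ)) i (β i + 1) := by
      funext j
      by_cases hj : j = i
      · subst hj; simp
      · simp [Function.update_of_ne hj]
    rw [h2, mderiv_update_succ hg (fun j => (β j : ℕ)) i]
    simp

theorem lderiv_taylorPoly {g : (Fin d → ℝ) → ℝ} (hg : ContDiff ℝ (⊤ : ℕ∞) g) (l : List (Fin d))
    {m : ℕ} (hm : m + l.length ≤ s) (t : Fin d → ℝ) :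
    lderiv l (taylorPoly s (m + l.length) g t) = taylorPoly s m (lderiv l g) t := by
  induction l generalizing m with
  | nil => rfl
  | cons i l ih =>
    rw [List.length_cons] at hm
    rw [lderiv_cons, lderiv_cons, List.length_cons, show m + (l.length + 1) = m + 1 + l.length by
      ring, ih (by omega), pderiv1_taylorPoly (contDiff_lderiv hg l) (by omega)]

theorem mderiv_zero (g : (Fin d → ℝ) → ℝ) : mderiv 0 g = g := by
  unfold mderiv
  induction List.finRange d with
  | nil => rfl
  | cons i l ih => simp

theorem taylorPoly_eq_of_forall {m : ℕ} (hm : m ≠ 0) (hs : s ≠ 0) (g : (Fin d → ℝ) → ℝ)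
    (t x : Fin d → ℝ) (h : ∀ α : Fin d → Fin s, Cell.deg α ≠ 0 → Cell.deg α < m →
      divMonomial (fun i => (α i : ℕ)) (x - t) = 0) : taylorPoly s m g t x = g t := by
  rw [taylorPoly, Finset.sum_eq_single (fun _ => ⟨0, Nat.pos_of_ne_zero hs⟩)]
  · rw [if_pos (by simp [Cell.deg]; omega)]
    simp only [divMonomial, pow_zero, Nat.factorial_zero, Nat.cast_one, div_one,
      Finset.prod_const_one, mul_one]
    exact congrFun (mderiv_zero g) t
  · intro α _ hα
    split_ifs with hdeg
    · rw [h α (fun h0 => hα ?_) hdeg, mul_zero]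
      funext i
      exact Fin.ext (Finset.sum_eq_zero_iff.mp h0 i (Finset.mem_univ i))
    · rfl
  · simp

theorem taylorPoly_one (hs : s ≠ 0) (g : (Fin d → ℝ) → ℝ) (t x : Fin d → ℝ) :
    taylorPoly s 1 g t x = g t :=
  taylorPoly_eq_of_forall one_ne_zero hs g t x fun _ _ _ => by omega

theorem taylorPoly_self {m : ℕ} (hm : m ≠ 0) (hs : s ≠ 0) (g : (Fin d → ℝ) → ℝ)
    (t : Fin d → ℝ) : taylorPoly s m g t t = g t := by
  refine taylorPoly_eq_of_forall hm hs g t t fun α h _ => ?_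
  obtain ⟨i, -, hi⟩ := Finset.exists_ne_zero_of_sum_ne_zero h
  exact Finset.prod_eq_zero (Finset.mem_univ i) (by simp [hi])

theorem fderiv_apply_eq_sum_pderiv1 (g : (Fin d → ℝ) → ℝ) (x v : Fin d → ℝ) :
    fderiv ℝ g x v = ∑ i, v i * pderiv1 i g x := by
  have hv : v = ∑ i, v i • (Pi.single i 1 : Fin d → ℝ) := by
    funext b
    simp [Finset.sum_apply, Pi.single_apply]
  conv_lhs => rw [hv]
  simp [pderiv1]

theorem pderiv1_sub {g h : (Fin d → ℝ) → ℝ} (hg : ContDiff ℝ (⊤ : ℕ∞) g)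
    (hh : ContDiff ℝ (⊤ : ℕ∞) h) (i : Fin d) :
    pderiv1 i (fun x => g x - h x) = fun x => pderiv1 i g x - pderiv1 i h x := by
  funext x
  unfold pderiv1
  rw [fderiv_fun_sub (hg.differentiable (by simp) x) (hh.differentiable (by simp) x)]
  rfl

theorem lderiv_sub {g h : (Fin d → ℝ) → ℝ} (hg : ContDiff ℝ (⊤ : ℕ∞) g)
    (hh : ContDiff ℝ (⊤ : ℕ∞) h) (l : List (Fin d)) :
    lderiv l (fun x => g x - h x) = fun x => lderiv l g x - lderiv l h x := by
  induction l with
  | nil => rfl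
  | cons i l ih =>
    rw [lderiv_cons, ih, pderiv1_sub (contDiff_lderiv hg l) (contDiff_lderiv hh l)]; rfl

/-- Taylor's theorem on the cube, assuming Lipschitz derivatives of order `m`. -/
theorem abs_sub_taylorPoly_le {m : ℕ} (hm : m + 1 ≤ s) {g : (Fin d → ℝ) → ℝ}
    (hg : ContDiff ℝ (⊤ : ℕ∞) g) {C : ℝ} (hC : 0 ≤ C)
    (h : ∀ l : List (Fin d), l.length = m → ∀ x ∈ cube d, ∀ y ∈ cube d,
      |lderiv l g x - lderiv l g y| ≤ C * eucDist x y)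
    {t x : Fin d → ℝ} (ht : t ∈ cube d) (hx : x ∈ cube d) :
    |g x - taylorPoly s (m + 1) g t x| ≤
      C * (d * ‖x - t‖) ^ (m + 1) / (Nat.factorial (m + 1) : ℝ) := by
  have hs : s ≠ 0 := by omega
  induction m generalizing g x with
  | zero =>
    rw [taylorPoly_one hs]
    refine (h [] rfl x hx t ht).trans ?_
    simpa using mul_le_mul_of_nonneg_left (eucDist_le x t) hC
  | succ m ih =>
    have hT := contDiff_taylorPoly (s := s) (m + 2) g t
    set R : (Fin d → ℝ) → ℝ := fun x => g x - taylorPoly s (m + 2) g t x with hR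
    have hRd : Differentiable ℝ R := (hg.sub hT).differentiable (by simp)
    set D : ℝ := d * ‖x - t‖ with hD
    have hD0 : 0 ≤ D := by positivity
    have hpath : ∀ τ : ℝ, HasDerivAt (fun τ : ℝ => t + τ • (x - t)) (x - t) τ := fun τ => by
      simpa using ((hasDerivAt_id τ).smul_const (x - t)).const_add t
    have hφ : ∀ τ : ℝ, HasDerivAt (fun τ : ℝ => R (t + τ • (x - t)))
        (fderiv ℝ R (t + τ • (x - t)) (x - t)) τ := fun τ =>
      (hRd _).hasFDerivAt.comp_hasDerivAt τ (hpath τ)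
    have hB : ∀ τ : ℝ, HasDerivAt
        (fun τ : ℝ => C * D ^ (m + 2) / (Nat.factorial (m + 2) : ℝ) * τ ^ (m + 2))
        (C * D ^ (m + 2) / (Nat.factorial (m + 1) : ℝ) * τ ^ (m + 1)) τ := fun τ => by
      refine ((hasDerivAt_pow (m + 2) τ).const_mul _).congr_deriv ?_
      rw [Nat.factorial_succ (m + 1)]
      push_cast
      have h1 : (Nat.factorial (m + 1) : ℝ) ≠ 0 := by positivity
      have h2 : (m : ℝ) + 1 + 1 ≠ 0 := by positivity
      field_simp
      ring
    have hbound : ∀ τ ∈ Set.Ico (0 : ℝ) 1, ‖fderiv ℝ R (t + τ • (x - t)) (x - t)‖ ≤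
        C * D ^ (m + 2) / (Nat.factorial (m + 1) : ℝ) * τ ^ (m + 1) := fun τ hτ => by
      have hz : t + τ • (x - t) ∈ cube d := by
        rw [show t + τ • (x - t) = AffineMap.lineMap t x τ by
          rw [AffineMap.lineMap_apply_module']; exact add_comm _ _]
        exact convex_cube.lineMap_mem ht hx ⟨hτ.1, hτ.2.le⟩
      have hi : ∀ i, |pderiv1 i R (t + τ • (x - t))| ≤
          C * (D * τ) ^ (m + 1) / (Nat.factorial (m + 1) : ℝ) := fun i => by
        have h1 := ih (by omega) (contDiff_pderiv1 hg i) (fun l hl y hy z hz => by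
          have := h (l ++ [i]) (by simp [hl]) y hy z hz
          rwa [lderiv_append] at this) hz
        rw [add_sub_cancel_left, norm_smul, Real.norm_of_nonneg hτ.1] at h1
        rw [hR, pderiv1_sub hg hT, pderiv1_taylorPoly hg (by omega)]
        refine h1.trans (le_of_eq ?_)
        rw [hD]; ring
      rw [fderiv_apply_eq_sum_pderiv1]
      have h2 : ∀ i, ‖(x - t) i * pderiv1 i R (t + τ • (x - t))‖ ≤
          ‖x - t‖ * (C * (D * τ) ^ (m + 1) / (Nat.factorial (m + 1) : ℝ)) := fun i => by
        rw [norm_mul]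
        exact mul_le_mul (norm_le_pi_norm _ i) (hi i) (norm_nonneg _) (norm_nonneg _)
      refine (norm_sum_le _ _).trans ((Finset.sum_le_card_nsmul _ _ _ fun i _ => h2 i).trans
        (le_of_eq ?_))
      rw [Finset.card_univ, Fintype.card_fin, nsmul_eq_mul, ← mul_assoc, ← hD, mul_pow]
      ring
    have h0 : R t = 0 := by
      simp only [hR]; rw [taylorPoly_self (by omega) hs, sub_self]
    have := image_norm_le_of_norm_deriv_right_le_deriv_boundary
      (f := fun τ : ℝ => R (t + τ • (x - t))) (a := 0) (b := 1)
      (fun τ _ => (hφ τ).continuousAt.continuousWithinAt)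
      (fun τ _ => (hφ τ).hasDerivWithinAt) (by simp [h0]) hB hbound
      (Set.right_mem_Icc.mpr zero_le_one)
    simpa [hR] using this

theorem norm_iteratedFDeriv_sub_taylorPoly_le {g : (Fin d → ℝ) → ℝ}
    (hg : ContDiff ℝ (⊤ : ℕ∞) g) {C : ℝ} (hC : 0 ≤ C)
    (h : ∀ l : List (Fin d), l.length = s - 1 → ∀ x ∈ cube d, ∀ y ∈ cube d,
      |lderiv l g x - lderiv l g y| ≤ C * eucDist x y)
    {t x : Fin d → ℝ} (ht : t ∈ cube d) (hx : x ∈ cube d) {j : ℕ} (hj : j < s) :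
    ‖iteratedFDeriv ℝ j (fun x => g x - taylorPoly s s g t x) x‖ ≤
      d ^ j * (C * (d * ‖x - t‖) ^ (s - j) / (Nat.factorial (s - j) : ℝ)) := by
  have hT := contDiff_taylorPoly (s := s) s g t
  refine norm_iteratedFDeriv_le_of_lderiv ((hg.sub hT).of_le (by exact_mod_cast le_top))
    fun l hl => ?_
  obtain ⟨m, rfl⟩ : ∃ m, s = m + 1 + l.length := ⟨s - j - 1, by omega⟩
  have hm : m + 1 + l.length - j = m + 1 := by omega
  rw [lderiv_sub hg hT, hm, lderiv_taylorPoly hg l le_rfl]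
  refine abs_sub_taylorPoly_le (by omega) (contDiff_lderiv hg l) hC (fun l' hl' y hy z hz => ?_)
    ht hx
  have := h (l' ++ l) (by simp; omega) y hy z hz
  rwa [lderiv_append] at this

end Taylor

section IteratedFDeriv

variable {E : Type*} [NormedAddCommGroup E] [NormedSpace ℝ E]

theorem norm_iteratedFDeriv_mul_le_pow {f g : E → ℝ} {n : ℕ} (hf : ContDiff ℝ n f)
    (hg : ContDiff ℝ n g) {x : E} {A B a b : ℝ}
    (hA : ∀ j ≤ n, ‖iteratedFDeriv ℝ j f x‖ ≤ A * a ^ j)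
    (hB : ∀ j ≤ n, ‖iteratedFDeriv ℝ j g x‖ ≤ B * b ^ j) :
    ‖iteratedFDeriv ℝ n (fun y => f y * g y) x‖ ≤ A * B * (a + b) ^ n := by
  refine (norm_iteratedFDeriv_mul_le hf hg x le_rfl).trans ?_
  rw [add_pow, Finset.mul_sum]
  refine Finset.sum_le_sum fun i hi => ?_
  have hi : i ≤ n := Nat.lt_succ_iff.mp (Finset.mem_range.mp hi)
  have h1 := mul_le_mul (hA i hi) (hB (n - i) (n.sub_le i)) (norm_nonneg _)
    ((norm_nonneg _).trans (hA i hi))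
  calc _ = (n.choose i : ℝ) * (‖iteratedFDeriv ℝ i f x‖ * ‖iteratedFDeriv ℝ (n - i) g x‖) := by
        ring
    _ ≤ (n.choose i : ℝ) * (A * a ^ i * (B * b ^ (n - i))) := by gcongr
    _ = _ := by ring

theorem norm_iteratedFDeriv_prod_le_pow {ι : Type*} (u : Finset ι) {f : ι → E → ℝ} {n : ℕ}
    (hf : ∀ i ∈ u, ContDiff ℝ n (f i)) {x : E} {A a : ℝ}
    (hA : ∀ i ∈ u, ∀ j ≤ n, ‖iteratedFDeriv ℝ j (f i) x‖ ≤ A * a ^ j) {j : ℕ} (hj : j ≤ n) :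
    ‖iteratedFDeriv ℝ j (fun y => ∏ i ∈ u, f i y) x‖ ≤ A ^ u.card * (u.card * a) ^ j := by
  induction u using Finset.induction_on generalizing j with
  | empty =>
    rcases Nat.eq_zero_or_pos j with rfl | h
    · simp
    · simp [iteratedFDeriv_const_of_ne h.ne', h.ne']
  | insert i u hi ih =>
    simp only [Finset.prod_insert hi]
    have hf' : ∀ i ∈ u, ContDiff ℝ n (f i) := fun k hk => hf k (Finset.mem_insert_of_mem hk)
    have h := norm_iteratedFDeriv_mul_le_pow (n := j) (x := x)
      ((hf i (Finset.mem_insert_self i u)).of_le (by exact_mod_cast hj))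
      ((contDiff_prod hf').of_le (by exact_mod_cast hj))
      (fun k hk => hA i (Finset.mem_insert_self i u) k (hk.trans hj))
      (fun k hk => ih hf' (fun q hq => hA q (Finset.mem_insert_of_mem hq)) (hk.trans hj))
    refine h.trans (le_of_eq ?_)
    rw [Finset.card_insert_of_notMem hi]
    push_cast
    ring

theorem norm_iteratedFDeriv_comp_clm_le {F : Type*} [NormedAddCommGroup F] [NormedSpace ℝ F]
    (L : E →L[ℝ] F) {f : F → ℝ} {n : ℕ} (hf : ContDiff ℝ n f) (x : E) :
    ‖iteratedFDeriv ℝ n (f ∘ L) x‖ ≤ ‖iteratedFDeriv ℝ n f (L x)‖ * ‖L‖ ^ n := by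
  rw [L.iteratedFDeriv_comp_right hf x le_rfl]
  exact (ContinuousMultilinearMap.norm_compContinuousLinearMap_le _ _).trans (by simp)

end IteratedFDeriv

section PosPow

theorem hasDerivAt_posPow (n : ℕ) (y : ℝ) :
    HasDerivAt (fun y : ℝ => max y 0 ^ (n + 2)) ((n + 2 : ℕ) * max y 0 ^ (n + 1)) y := by
  refine hasDerivAt_of_hasDerivAt_of_ne' (x := 0)
    (g := fun y : ℝ => ((n + 2 : ℕ) : ℝ) * max y 0 ^ (n + 1)) (fun y hy => ?_)
    (by fun_prop) (by fun_prop) y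
  rcases lt_or_gt_of_ne hy with h | h
  · have : (fun y : ℝ => max y 0 ^ (n + 2)) =ᶠ[nhds y] fun _ => 0 := by
      filter_upwards [Iio_mem_nhds h] with z hz
      rw [max_eq_right (le_of_lt hz)]; simp
    rw [max_eq_right h.le]
    simpa using (hasDerivAt_const y (0 : ℝ)).congr_of_eventuallyEq this
  · have : (fun y : ℝ => max y 0 ^ (n + 2)) =ᶠ[nhds y] fun y => y ^ (n + 2) := by
      filter_upwards [Ioi_mem_nhds h] with z hz
      rw [max_eq_left (le_of_lt hz)]
    rw [max_eq_left h.le]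
    exact (hasDerivAt_pow (n + 2) y).congr_of_eventuallyEq this

theorem contDiff_posPow (n : ℕ) : ContDiff ℝ n fun y : ℝ => max y 0 ^ (n + 1) := by
  induction n with
  | zero => exact contDiff_zero.2 (by fun_prop)
  | succ n ih =>
    push_cast
    rw [contDiff_succ_iff_deriv]
    refine ⟨fun y => (hasDerivAt_posPow n y).differentiableAt, by simp, ?_⟩
    rw [show deriv (fun y : ℝ => max y 0 ^ (n + 1 + 1)) =
      fun y => ((n + 2 : ℕ) : ℝ) * max y 0 ^ (n + 1) from
      funext fun y => (hasDerivAt_posPow n y).deriv]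
    exact contDiff_const.mul ih

theorem iteratedDeriv_posPow (n i : ℕ) (y : ℝ) :
    iteratedDeriv i (fun y : ℝ => max y 0 ^ (n + i + 1)) y =
      (n + i + 1).descFactorial i * max y 0 ^ (n + 1) := by
  induction i generalizing n y with
  | zero => simp
  | succ i ih =>
    rw [iteratedDeriv_succ, show n + (i + 1) + 1 = n + 1 + i + 1 by ring,
      funext (ih (n + 1)), deriv_const_mul_field, (hasDerivAt_posPow n y).deriv,
      Nat.descFactorial_succ, show n + 1 + i + 1 - i = n + 2 by omega]
    push_cast
    ring

theorem norm_iteratedFDeriv_posPow_le {m i : ℕ} (hi : i < m) {y : ℝ} (hy : y ≤ 1) :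
    ‖iteratedFDeriv ℝ i (fun y : ℝ => max y 0 ^ m) y‖ ≤ (m : ℝ) ^ i := by
  obtain ⟨n, rfl⟩ : ∃ n, m = n + i + 1 := ⟨m - i - 1, by omega⟩
  rw [norm_iteratedFDeriv_eq_norm_iteratedDeriv, iteratedDeriv_posPow, norm_mul, norm_pow,
    Real.norm_of_nonneg (le_max_right y 0), Real.norm_of_nonneg (Nat.cast_nonneg _)]
  calc _ ≤ (((n + i + 1) ^ i : ℕ) : ℝ) * 1 := by
        gcongr
        · exact Nat.descFactorial_le_pow _ _
        · exact pow_le_one₀ (le_max_right y 0) (max_le hy zero_le_one)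
    _ = _ := by push_cast; ring

end PosPow

namespace Cell

theorem contDiff_stepFn (n : ℕ) : ContDiff ℝ n (stepFn (n + 1)) :=
  (contDiff_posPow n).comp (contDiff_const.sub (contDiff_posPow n))

theorem stepFn_of_one_le {m : ℕ} (hm : m ≠ 0) {y : ℝ} (hy : 1 ≤ y) : stepFn m y = 0 := by
  have : 1 ≤ max y 0 ^ m := one_le_pow₀ (hy.trans (le_max_left _ _))
  rw [stepFn, max_eq_right (by linarith), zero_pow hm]

theorem stepFn_of_nonpos {m : ℕ} (hm : m ≠ 0) {y : ℝ} (hy : y ≤ 0) : stepFn m y = 1 := by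
  rw [stepFn, max_eq_right hy, zero_pow hm]; simp

theorem norm_iteratedFDeriv_stepFn_le {m n : ℕ} (hn : n < m) (y : ℝ) :
    ‖iteratedFDeriv ℝ n (stepFn m) y‖ ≤ (Nat.factorial n : ℝ) * ((m : ℝ) ^ 2) ^ n := by
  rcases le_or_gt y 1 with hy | hy
  · have hc : ContDiff ℝ n fun y : ℝ => max y 0 ^ m := by
      obtain ⟨k, rfl⟩ := Nat.exists_eq_succ_of_ne_zero (by omega : m ≠ 0)
      exact (contDiff_posPow k).of_le (by exact_mod_cast Nat.lt_succ_iff.mp hn)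
    have hm : (1 : ℝ) ≤ m := by exact_mod_cast (by omega : 1 ≤ m)
    have h := norm_iteratedFDeriv_comp_le (n := n) (x := y) (C := (m : ℝ) ^ n) (D := m) hc
      (contDiff_const.sub hc : ContDiff ℝ n fun y : ℝ => 1 - max y 0 ^ m) le_rfl
      (fun i hi => (norm_iteratedFDeriv_posPow_le (hi.trans_lt hn)
        (by have : 0 ≤ max y 0 ^ m := by positivity
            linarith)).trans (pow_le_pow_right₀ hm hi))
      (fun i hi0 hi => by
        rw [norm_iteratedFDeriv_eq_norm_iteratedDeriv, iteratedDeriv_const_sub hi0,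
          iteratedDeriv_neg, norm_neg, ← norm_iteratedFDeriv_eq_norm_iteratedDeriv]
        exact norm_iteratedFDeriv_posPow_le (hi.trans_lt hn) hy)
    refine h.trans (le_of_eq ?_)
    ring
  · have : stepFn m =ᶠ[nhds y] fun _ => 0 := by
      filter_upwards [Ioi_mem_nhds hy] with z hz
      exact stepFn_of_one_le (by omega) (le_of_lt hz)
    rw [(this.iteratedFDeriv ℝ n).eq_of_nhds]
    have : iteratedFDeriv ℝ n (fun _ : ℝ => (0 : ℝ)) y = 0 := by
      simp
    rw [this, norm_zero]
    positivity

/-- The cutoffs whose consecutive differences are the bumps. -/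
noncomputable def ramp (G m j : ℕ) (t : ℝ) : ℝ :=
  if j = 0 then 0 else if j < G then stepFn m (G * t - j + 1 / 2) else 1

theorem bump_eq_ramp_sub {G : ℕ} (m : ℕ) (k : Fin G) (t : ℝ) :
    bump G m k t = ramp G m (k + 1) t - ramp G m k t := by
  simp [bump, ramp, k.2]

theorem sum_bump {G : ℕ} (hG : G ≠ 0) (m : ℕ) (t : ℝ) : ∑ k : Fin G, bump G m k t = 1 := by
  simp only [bump_eq_ramp_sub]
  rw [Fin.sum_univ_eq_sum_range (fun k => ramp G m (k + 1) t - ramp G m k t),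
    Finset.sum_range_sub (fun k => ramp G m k t)]
  simp [ramp, hG]

variable {d : ℕ}

theorem contDiff_ramp {n m : ℕ} (hn : n < m) (G j : ℕ) : ContDiff ℝ n (ramp G m j) := by
  have hs : ContDiff ℝ n (stepFn m) := by
    obtain ⟨k, rfl⟩ := Nat.exists_eq_succ_of_ne_zero (by omega : m ≠ 0)
    exact (contDiff_stepFn k).of_le (by exact_mod_cast Nat.lt_succ_iff.mp hn)
  unfold ramp
  split_ifs
  exacts [contDiff_const, hs.comp (by fun_prop), contDiff_const]

theorem norm_iteratedFDeriv_ramp_le {n m : ℕ} (hn : n < m) (G j : ℕ) (i : Fin d)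
    (x : Fin d → ℝ) :
    ‖iteratedFDeriv ℝ n (fun x : Fin d → ℝ => ramp G m j (x i)) x‖ ≤
      (Nat.factorial n : ℝ) * ((m : ℝ) ^ 2 * G) ^ n := by
  have hconst : ∀ c : ℝ, ‖c‖ ≤ 1 → ‖iteratedFDeriv ℝ n (fun _ : Fin d → ℝ => c) x‖ ≤
      (Nat.factorial n : ℝ) * ((m : ℝ) ^ 2 * G) ^ n := fun c hc => by
    rcases Nat.eq_zero_or_pos n with rfl | h
    · simpa using hc
    · rw [iteratedFDeriv_const_of_ne h.ne']; simp; positivity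
  unfold ramp
  split_ifs
  · exact hconst 0 (by simp)
  · have hs : ContDiff ℝ n (stepFn m) := by
      obtain ⟨k, rfl⟩ := Nat.exists_eq_succ_of_ne_zero (by omega : m ≠ 0)
      exact (contDiff_stepFn k).of_le (by exact_mod_cast Nat.lt_succ_iff.mp hn)
    set L : (Fin d → ℝ) →L[ℝ] ℝ := (G : ℝ) • ContinuousLinearMap.proj i with hL
    have hLn : ‖L‖ ≤ G := by
      refine L.opNorm_le_bound (by positivity) fun y => ?_
      rw [hL, smul_apply, norm_smul, Real.norm_of_nonneg (Nat.cast_nonneg _)]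
      exact mul_le_mul_of_nonneg_left (norm_le_pi_norm y i) (by positivity)
    have h1 : (fun x : Fin d → ℝ => stepFn m (G * x i - j + 1 / 2)) =
        (fun t => stepFn m (t + (-j + 1 / 2))) ∘ L := by
      funext x
      simp [hL, add_assoc, sub_eq_add_neg]
    rw [h1]
    refine (norm_iteratedFDeriv_comp_clm_le L (hs.comp (by fun_prop)) x).trans ?_
    rw [show stepFn m ∘ (fun t => t + (-(j : ℝ) + 1 / 2)) =
      fun t => stepFn m (t + (-(j : ℝ) + 1 / 2)) from rfl, iteratedFDeriv_comp_add_right]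
    calc _ ≤ (Nat.factorial n : ℝ) * ((m : ℝ) ^ 2) ^ n * (G : ℝ) ^ n := by
          gcongr
          exact norm_iteratedFDeriv_stepFn_le hn _
      _ = _ := by ring
  · exact hconst 1 (by simp)

theorem contDiff_bump {n m G : ℕ} (hn : n < m) (k : Fin G) : ContDiff ℝ n (bump G m k) := by
  rw [funext (bump_eq_ramp_sub m k)]
  exact (contDiff_ramp hn _ _).sub (contDiff_ramp hn _ _)

theorem norm_iteratedFDeriv_bump_le {n m ℓ G : ℕ} (hℓ : n ≤ ℓ) (hn : n < m) (k : Fin G)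
    (i : Fin d) (x : Fin d → ℝ) :
    ‖iteratedFDeriv ℝ n (fun x : Fin d → ℝ => bump G m k (x i)) x‖ ≤
      2 * (ℓ * (m : ℝ) ^ 2 * G) ^ n := by
  have hc : ∀ j, ContDiff ℝ n fun x : Fin d → ℝ => ramp G m j (x i) := fun j =>
    (contDiff_ramp hn G j).comp (contDiff_apply ℝ ℝ i)
  simp only [bump_eq_ramp_sub]
  rw [fun_iteratedFDeriv_sub_apply (hc _).contDiffAt (hc _).contDiffAt]
  refine (norm_sub_le _ _).trans ?_
  have h : (Nat.factorial n : ℝ) * ((m : ℝ) ^ 2 * G) ^ n ≤ (ℓ * (m : ℝ) ^ 2 * G) ^ n := by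
    rw [mul_assoc, mul_pow (ℓ : ℝ)]
    refine mul_le_mul_of_nonneg_right ?_ (by positivity)
    exact_mod_cast (Nat.factorial_le_pow n).trans (Nat.pow_le_pow_left hℓ n)
  have h1 := norm_iteratedFDeriv_ramp_le hn G (k + 1) i x
  have h2 := norm_iteratedFDeriv_ramp_le hn G k i x
  linarith

theorem bump_eventuallyEq_zero {m G : ℕ} (hm : m ≠ 0) (k : Fin G) {t : ℝ} (h0 : 0 ≤ t)
    (h1 : t ≤ 1) (h : 1 < |G * t - ((k : ℕ) + 1 / 2)|) :
    bump G m k =ᶠ[nhds t] fun _ => 0 := by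
  have hG : (0 : ℝ) ≤ G := Nat.cast_nonneg G
  have hk : (((k : ℕ) + 1 : ℕ) : ℝ) ≤ G := by exact_mod_cast k.2
  have hcont : Continuous fun t : ℝ => G * t - ((k : ℕ) + 1 / 2) := by fun_prop
  rcases lt_abs.mp h with h | h
  · filter_upwards [(hcont.tendsto t).eventually (lt_mem_nhds h)] with y hy
    have hkG : (k : ℕ) + 1 < G := by
      have : (((k : ℕ) + 1 : ℕ) : ℝ) < G := by push_cast; nlinarith
      exact_mod_cast this
    rw [bump, if_pos hkG, stepFn_of_one_le hm (by push_cast; linarith),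
      stepFn_of_one_le hm (by linarith)]
    simp
  · filter_upwards [(hcont.neg.tendsto t).eventually (lt_mem_nhds h)] with y hy
    rw [Pi.neg_apply] at hy
    have hk0 : (k : ℕ) ≠ 0 := fun h0 => by
      rw [h0] at h
      push_cast at h
      nlinarith
    rw [bump, if_neg hk0, stepFn_of_nonpos hm (by push_cast; linarith),
      stepFn_of_nonpos hm (by linarith)]
    simp

/-- The bumps active at a point. -/
noncomputable def active (G : ℕ) (t : ℝ) : Finset (Fin G) :=
  Finset.univ.filter fun k => |G * t - ((k : ℕ) + 1 / 2)| ≤ 1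

theorem card_active_le (G : ℕ) (t : ℝ) : (active G t).card ≤ 3 := by
  set a := ⌈G * t - 3 / 2⌉₊
  have h : ((active G t).map Fin.valEmbedding) ⊆ Finset.Icc a (a + 2) := fun k hk => by
    obtain ⟨j, hj, rfl⟩ := Finset.mem_map.mp hk
    have hj := abs_le.mp (Finset.mem_filter.mp hj).2
    rw [Fin.valEmbedding_apply, Finset.mem_Icc]
    refine ⟨Nat.ceil_le.mpr (by linarith), ?_⟩
    have h1 : (j : ℝ) ≤ (a : ℝ) + 2 := by
      have := Nat.le_ceil (G * t - 3 / 2)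
      linarith
    exact_mod_cast h1
  calc _ = ((active G t).map Fin.valEmbedding).card := (Finset.card_map _).symm
    _ ≤ (Finset.Icc a (a + 2)).card := Finset.card_le_card h
    _ = 3 := by simp; omega

end Cell

namespace Cell

variable {d s : ℕ}

/-- The center of a grid cell. -/
noncomputable def center {G : ℕ} (k : Fin d → Fin G) : Fin d → ℝ :=
  fun i => ((k i : ℕ) + 1 / 2) / G

/-- The tensor product partition of unity. -/
noncomputable def window (m : ℕ) {G : ℕ} (k : Fin d → Fin G) (x : Fin d → ℝ) : ℝ :=
  ∏ i, bump G m (k i) (x i)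

/-- Taylor polynomials at the cell centers, blended by the partition of unity. -/
noncomputable def blend (s G m : ℕ) (g : (Fin d → ℝ) → ℝ) (x : Fin d → ℝ) : ℝ :=
  ∑ k : Fin d → Fin G, window m k x * taylorPoly s s g (center k) x

theorem sum_window {G : ℕ} (hG : G ≠ 0) (m : ℕ) (x : Fin d → ℝ) :
    ∑ k : Fin d → Fin G, window m k x = 1 := by
  unfold window
  rw [← Fintype.prod_sum fun (i : Fin d) (k : Fin G) => bump G m k (x i)]
  simp [sum_bump hG]

theorem center_mem_cube {G : ℕ} (k : Fin d → Fin G) : center k ∈ cube d := by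
  refine ⟨fun i => ?_, fun i => ?_⟩
  · simp only [center, Pi.zero_apply]; positivity
  · have h1 : (((k i : ℕ) + 1 : ℕ) : ℝ) ≤ G := by exact_mod_cast (k i).2
    push_cast at h1
    simp only [center, Pi.one_apply]
    exact div_le_one_of_le₀ (by linarith) (by positivity)

theorem contDiff_window {n m G : ℕ} (hn : n < m) (k : Fin d → Fin G) :
    ContDiff ℝ n (window m k) :=
  contDiff_prod fun i _ => (contDiff_bump hn (k i)).comp (contDiff_apply ℝ ℝ i)

theorem norm_iteratedFDeriv_window_le {n m ℓ G : ℕ} (hn : n ≤ ℓ) (hℓ : ℓ < m)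
    (k : Fin d → Fin G) (x : Fin d → ℝ) :
    ‖iteratedFDeriv ℝ n (window m k) x‖ ≤ 2 ^ d * (d * (ℓ * (m : ℝ) ^ 2 * G)) ^ n := by
  have h := norm_iteratedFDeriv_prod_le_pow Finset.univ (n := ℓ) (x := x)
    (f := fun i (x : Fin d → ℝ) => bump G m (k i) (x i))
    (fun i _ => (contDiff_bump hℓ (k i)).comp (contDiff_apply ℝ ℝ i))
    (fun i _ j hj => norm_iteratedFDeriv_bump_le hj (hj.trans_lt hℓ) (k i) i x) hn
  rw [Finset.card_univ, Fintype.card_fin] at h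
  exact h

theorem window_eventuallyEq_zero {m G : ℕ} (hm : m ≠ 0) {k : Fin d → Fin G} {x : Fin d → ℝ}
    (hx : x ∈ cube d) (hk : k ∉ Fintype.piFinset fun i => active G (x i)) :
    window m k =ᶠ[nhds x] fun _ => 0 := by
  obtain ⟨i, hi⟩ : ∃ i, k i ∉ active G (x i) := by
    by_contra! h
    exact hk (Fintype.mem_piFinset.mpr h)
  have hi : 1 < |G * x i - ((k i : ℕ) + 1 / 2)| := by
    by_contra! h
    exact hi (Finset.mem_filter.mpr ⟨Finset.mem_univ _, h⟩)
  have h := bump_eventuallyEq_zero hm (k i) (hx.1 i) (hx.2 i) hi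
  filter_upwards [((continuous_apply i).tendsto x).eventually h] with y hy
  exact Finset.prod_eq_zero (Finset.mem_univ i) hy

theorem norm_sub_center_le {G : ℕ} (hG : G ≠ 0) {k : Fin d → Fin G} {x : Fin d → ℝ}
    (hk : k ∈ Fintype.piFinset fun i => active G (x i)) : ‖x - center k‖ ≤ 1 / G := by
  have hG0 : (0 : ℝ) < G := by positivity
  refine (pi_norm_le_iff_of_nonneg (by positivity)).mpr fun i => ?_
  have hi := (Finset.mem_filter.mp (Fintype.mem_piFinset.mp hk i)).2
  rw [Pi.sub_apply, center, Real.norm_eq_abs, le_div_iff₀ hG0, ← abs_of_pos hG0, ← abs_mul,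
    abs_of_pos hG0, sub_mul, div_mul_cancel₀ _ hG0.ne', mul_comm]
  exact hi

theorem sub_blend_eq {G : ℕ} (hG : G ≠ 0) (m : ℕ) (g : (Fin d → ℝ) → ℝ) :
    (fun x => g x - blend s G m g x) = fun x => ∑ k : Fin d → Fin G,
      window m k x * (g x - taylorPoly s s g (center k) x) := by
  funext x
  simp only [mul_sub, Finset.sum_sub_distrib, ← Finset.sum_mul, sum_window hG, one_mul, blend]

theorem contDiff_blend {G m ℓ : ℕ} (hm : ℓ < m) (g : (Fin d → ℝ) → ℝ) :
    ContDiff ℝ ℓ (blend s G m g) :=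
  ContDiff.sum fun k _ => (contDiff_window hm k).mul
    ((contDiff_taylorPoly s g (center k)).of_le (by exact_mod_cast le_top))

theorem norm_iteratedFDeriv_sub_blend_le {g : (Fin d → ℝ) → ℝ}
    (hg : ContDiff ℝ (⊤ : ℕ∞) g) {C : ℝ} (hC : 0 ≤ C)
    (h : ∀ l : List (Fin d), l.length = s - 1 → ∀ x ∈ cube d, ∀ y ∈ cube d,
      |lderiv l g x - lderiv l g y| ≤ C * eucDist x y)
    {G m ℓ n : ℕ} (hG : G ≠ 0) (hn : n ≤ ℓ) (hm : ℓ < m) (hs : ℓ < s) {x : Fin d → ℝ}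
    (hx : x ∈ cube d) :
    ‖iteratedFDeriv ℝ n (fun x => g x - blend s G m g x) x‖ ≤
      6 ^ d * (C / (Nat.factorial s : ℝ) * (d / G) ^ s) *
        (d * (ℓ * (m : ℝ) ^ 2 * G) + G * s) ^ n := by
  have hG0 : (0 : ℝ) < G := by positivity
  set B : ℝ := C / (Nat.factorial s : ℝ) * (d / G) ^ s with hB
  have hR : ∀ k : Fin d → Fin G,
      ContDiff ℝ (⊤ : ℕ∞) fun x => g x - taylorPoly s s g (center k) x :=
    fun k => hg.sub (contDiff_taylorPoly s g _)
  have hle : ∀ j : ℕ, (j : WithTop ℕ∞) ≤ ((⊤ : ℕ∞) : WithTop ℕ∞) := fun j => by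
    exact_mod_cast le_top
  rw [sub_blend_eq hG, iteratedFDeriv_fun_sum_apply fun k _ =>
    ((contDiff_window (hn.trans_lt hm) k).mul ((hR k).of_le (hle n))).contDiffAt]
  set S := Fintype.piFinset fun i => active G (x i) with hS
  rw [← Finset.sum_subset (Finset.subset_univ S) fun k _ hk => ?_]
  · have hk : ∀ k ∈ S, ‖iteratedFDeriv ℝ n
        (fun x => window m k x * (g x - taylorPoly s s g (center k) x)) x‖ ≤
        2 ^ d * B * (d * (ℓ * (m : ℝ) ^ 2 * G) + G * s) ^ n := fun k hk => by
      refine norm_iteratedFDeriv_mul_le_pow (contDiff_window (hn.trans_lt hm) k)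
        ((hR k).of_le (hle n))
        (fun j hj => norm_iteratedFDeriv_window_le (hj.trans hn) hm k x) fun j hj => ?_
      refine (norm_iteratedFDeriv_sub_taylorPoly_le hg hC h (center_mem_cube k) hx
        (by omega : j < s)).trans ?_
      have hjs : j ≤ s := by omega
      have h1 : (Nat.factorial s : ℝ) ≤ Nat.factorial (s - j) * (s : ℝ) ^ j := by
        exact_mod_cast (Nat.factorial_mul_descFactorial hjs) ▸
          Nat.mul_le_mul_left _ (Nat.descFactorial_le_pow s j)
      have h2 : (d : ℝ) * ‖x - center k‖ ≤ d / G := by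
        rw [div_eq_mul_one_div]
        exact mul_le_mul_of_nonneg_left (norm_sub_center_le hG hk) (by positivity)
      have h3 : ((d : ℝ) / G) ^ s * (G : ℝ) ^ j = d ^ j * (d / G) ^ (s - j) := by
        rw [← Nat.sub_add_cancel hjs, pow_add, Nat.add_sub_cancel, div_pow (d : ℝ) (G : ℝ) j]
        field_simp
      have hf1 : (0 : ℝ) < Nat.factorial s := by positivity
      have hf2 : (0 : ℝ) < Nat.factorial (s - j) := by positivity
      calc _ ≤ (d : ℝ) ^ j * (C * (d / G) ^ (s - j) / (Nat.factorial (s - j) : ℝ)) := by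
            gcongr
        _ = C * (d ^ j * (d / G) ^ (s - j)) * (1 / (Nat.factorial (s - j) : ℝ)) := by ring
        _ ≤ C * (d ^ j * (d / G) ^ (s - j)) * ((s : ℝ) ^ j / (Nat.factorial s : ℝ)) := by
            refine mul_le_mul_of_nonneg_left ?_ (by positivity)
            rw [div_le_div_iff₀ hf2 hf1]
            linarith
        _ = _ := by rw [← h3, hB]; ring
    refine (norm_sum_le_of_le S hk).trans ?_
    have hcard : (S.card : ℝ) ≤ 3 ^ d := by
      rw [hS, Fintype.card_piFinset]
      have : ∏ i : Fin d, (active G (x i)).card ≤ ∏ _i : Fin d, 3 :=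
        Finset.prod_le_prod' fun i _ => card_active_le G (x i)
      rw [Finset.prod_const, Finset.card_univ, Fintype.card_fin] at this
      exact_mod_cast this
    rw [Finset.sum_const, nsmul_eq_mul]
    calc _ ≤ (3 : ℝ) ^ d * (2 ^ d * B * (d * (ℓ * (m : ℝ) ^ 2 * G) + G * s) ^ n) := by
          gcongr
      _ = _ := by rw [show (6 : ℝ) = 3 * 2 by norm_num, mul_pow]; ring
  · have h0 := window_eventuallyEq_zero (m := m) (by omega) hx hk
    have h1 : (fun x => window m k x * (g x - taylorPoly s s g (center k) x)) =ᶠ[nhds x]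
        fun _ => 0 := by
      filter_upwards [h0] with y hy
      rw [hy, zero_mul]
    rw [(h1.iteratedFDeriv ℝ n).eq_of_nhds]
    simp

end Cell

section Analytic

variable {d p : ℕ} {Q R : ℝ} {f : (Fin d → ℝ) → Fin p → ℝ}

theorem QRanalytic.abs_mderiv_le (hf : QRanalytic p Q R f) {s : ℕ} (o : Fin p) {γ : Fin d → ℕ}
    (hγ : ∑ i, γ i < s) {x : Fin d → ℝ} (hx : x ∈ cube d) :
    |mderiv γ (fun x => f x o) x| ≤ Q * (R ^ s)⁻¹ * (Nat.factorial s : ℝ) := by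
  have h := hf.2 s o
  obtain ⟨m, rfl⟩ := Nat.exists_eq_succ_of_ne_zero (by omega : s ≠ 0)
  exact h.1 γ (by omega) x hx

theorem QRanalytic.abs_lderiv_sub_le (hf : QRanalytic p Q R f) (hQ : 0 < Q) (hR : 0 < R) {s : ℕ}
    (hs : s ≠ 0) (o : Fin p) {l : List (Fin d)} (hl : l.length = s - 1) {x y : Fin d → ℝ}
    (hx : x ∈ cube d) (hy : y ∈ cube d) :
    |lderiv l (fun x => f x o) x - lderiv l (fun x => f x o) y| ≤
      Q * (R ^ s)⁻¹ * (Nat.factorial s : ℝ) * eucDist x y := by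
  rcases eq_or_ne x y with rfl | hxy
  · rw [sub_self, abs_zero]
    have : 0 ≤ eucDist x x := Real.sqrt_nonneg _
    positivity
  rw [lderiv_eq_mderiv (hf.1 o)]
  have h := hf.2 s o
  obtain ⟨m, rfl⟩ := Nat.exists_eq_succ_of_ne_zero hs
  refine (h.2 _ (by rw [sum_count]; exact hl) x hx y hy hxy).trans ?_
  exact mul_le_mul_of_nonneg_left (min_le_right _ _) (by positivity)

theorem HolderNormLeOn.mono {Ω : Set (Fin d → ℝ)} {ℓ : ℕ} {g : (Fin d → ℝ) → ℝ} {E E' : ℝ}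
    (h : HolderNormLeOn Ω ℓ g E) (hE : E ≤ E') : HolderNormLeOn Ω ℓ g E' := by
  cases ℓ with
  | zero => exact fun x hx => (h x hx).trans hE
  | succ m =>
    refine ⟨fun γ hγ x hx => (h.1 γ hγ x hx).trans hE, fun γ hγ x hx y hy hxy =>
      (h.2 γ hγ x hx y hy hxy).trans ?_⟩
    exact mul_le_mul_of_nonneg_right hE (le_min zero_le_one (Real.sqrt_nonneg _))

end Analytic

namespace Cell

variable {d p G s : ℕ}

/-- The coefficients expressing the blended Taylor polynomials in the weighted monomials. -/
noncomputable def readout (M : ℕ) (g : (Fin d → ℝ) → ℝ) : Cell d G s → ℝ :=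
  vec 0 0 0 0 0 fun q => if deg q.2 < s then
    mderiv (fun i => (q.2 i : ℕ)) g (center q.1) /
      (growth M * ∏ i, ((Nat.factorial (q.2 i) : ℝ) * (G : ℝ) ^ (q.2 i : ℕ))) else 0

theorem formSize_readout_le (M : ℕ) (g : (Fin d → ℝ) → ℝ) :
    formSize (readout M g : Cell d G s → ℝ) ≤ G ^ d * s ^ d := by
  have h : (Finset.univ.filter fun j => (readout M g : Cell d G s → ℝ) j ≠ 0) ⊆
      (Finset.univ : Finset ((Fin d → Fin G) × (Fin d → Fin s))).image Cell.f := fun j hj => by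
    have hj := (Finset.mem_filter.mp hj).2
    rcases j with j | j | j | j | j | j
    all_goals first
      | exact absurd rfl hj
      | exact Finset.mem_image_of_mem _ (Finset.mem_univ j)
  rw [formSize]
  refine (Finset.card_le_card h).trans (Finset.card_image_le.trans (le_of_eq ?_))
  simp

theorem abs_readout_le (hG : G ≠ 0) {M : ℕ} {g : (Fin d → ℝ) → ℝ}
    (hg : ∀ γ : Fin d → ℕ, ∑ i, γ i < s → ∀ x ∈ cube d, |mderiv γ g x| ≤ growth M)
    (j : Cell d G s) : |readout M g j| ≤ 1 := by
  rcases j with j | j | j | j | j | q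
  iterate 5 exact (abs_zero (α := ℝ)).trans_le zero_le_one
  change |ite _ _ _| ≤ (1 : ℝ)
  split_ifs with hq
  · have hM := growth_pos M
    have hprod : (1 : ℝ) ≤ ∏ i, ((Nat.factorial (q.2 i) : ℝ) * (G : ℝ) ^ (q.2 i : ℕ)) := by
      have h : 1 ≤ ∏ i, (Nat.factorial (q.2 i) * G ^ (q.2 i : ℕ)) := Nat.one_le_iff_ne_zero.mpr
        (Finset.prod_ne_zero_iff.mpr fun i _ => by positivity)
      exact_mod_cast h
    rw [abs_div, abs_of_pos (show (0 : ℝ) < growth M * _ by positivity)]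
    exact div_le_one_of_le₀ ((hg _ hq _ (center_mem_cube _)).trans
      (le_mul_of_one_le_right hM.le hprod)) (by positivity)
  · simp

theorem sum_readout_run_program (hG : G ≠ 0) {r : ℕ} (hr : r ≠ 0) (M pad : ℕ)
    (g : (Fin d → ℝ) → ℝ) (z : Fin d → ℝ) :
    ∑ i, readout M g i * runLayers (program d G s M pad r) (fun j => (inputLayer j).val z) i =
      blend s G (2 ^ r) g z := by
  have hM := (growth_pos M).ne'
  have hG0 : (G : ℝ) ≠ 0 := by exact_mod_cast hG
  simp only [Fintype.sum_sum_type]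
  simp only [readout, vec, Sum.elim_inl, Sum.elim_inr, Pi.zero_apply, zero_mul,
    Finset.sum_const_zero, zero_add]
  rw [Fintype.sum_prod_type, blend]
  refine Finset.sum_congr rfl fun k _ => ?_
  rw [taylorPoly, Finset.mul_sum]
  refine Finset.sum_congr rfl fun α _ => ?_
  split_ifs with h
  · rw [run_program hr hG, if_pos (Nat.le_sub_one_of_lt h)]
    have h1 : divMonomial (fun i => (α i : ℕ)) (z - center k) =
        (∏ i, (G * z i - ((k i : ℕ) + 1 / 2)) ^ (α i : ℕ)) /
          ∏ i, ((Nat.factorial (α i) : ℝ) * (G : ℝ) ^ (α i : ℕ)) := by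
      rw [divMonomial, ← Finset.prod_div_distrib]
      refine Finset.prod_congr rfl fun i _ => ?_
      have h2 : (z - center k) i = (G * z i - ((k i : ℕ) + 1 / 2)) / G := by
        rw [Pi.sub_apply, center]; field_simp
      rw [h2, div_pow, div_div, mul_comm ((G : ℝ) ^ _)]
    have h2 : (∏ i, ((Nat.factorial (α i) : ℝ) * (G : ℝ) ^ (α i : ℕ))) ≠ 0 :=
      Finset.prod_ne_zero_iff.mpr fun i _ => by positivity
    rw [h1, window]
    dsimp only
    generalize ∏ i, (G * z i - ((k i : ℕ) + 1 / 2)) ^ (α i : ℕ) = P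
    field_simp
  · simp

/-- The network computing the blended Taylor polynomials. -/
noncomputable def blendNet (d p G s M pad r : ℕ) (f : (Fin d → ℝ) → Fin p → ℝ) : ReQUNet :=
  compileNet inputLayer (program d G s M pad r) fun o : Fin p => readout M fun x => f x o

theorem blendNet_evalVec (hG : G ≠ 0) {r : ℕ} (hr : r ≠ 0) (M pad : ℕ)
    (f : (Fin d → ℝ) → Fin p → ℝ) (z : Fin d → ℝ) (o : Fin p) :
    (blendNet d p G s M pad r f).evalVec d z o = blend s G (2 ^ r) (fun x => f x o) z := by
  rw [blendNet, compileNet_evalVec, sum_readout_run_program hG hr]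

theorem blendNet_numNonzero (M pad r : ℕ) (f : (Fin d → ℝ) → Fin p → ℝ) :
    (blendNet d p G s M pad r f).numNonzero ≤ (20 * d + 3 + G) +
      ((20 * d + 16 * (3 * G) + 72) + M * (20 * d + 60) + pad * (20 * d + 60) +
        (72 * (d * G) + 60) + r * (25 * (d * G) + 60) + (25 * (d * G) + 60) +
        (r - 1) * (25 * (d * G) + 60) + (40 * (d * G) + 20 * (G ^ d * s ^ d)) +
        d * (40 * (d * G) + 52 * (G ^ d * s ^ d)) +
        (s - 1) * (20 * (d * G) + 36 * (G ^ d * s ^ d))) +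
      p * (4 * (G ^ d * s ^ d)) := by
  refine (compileNet_numNonzero _ _ _).trans
    (add_le_add (add_le_add layerCost_inputLayer layerCost_program) ?_)
  refine (Finset.sum_le_card_nsmul Finset.univ _ (4 * (G ^ d * s ^ d)) fun o _ =>
    Nat.mul_le_mul_left 4 (formSize_readout_le M _)).trans ?_
  simp

end Cell

section Arithmetic

theorem mul_le_pow_of_two_le {d a : ℕ} (hd : 0 < d) (ha : 2 ≤ a) : d * a ≤ a ^ d := by
  obtain ⟨d, rfl⟩ := Nat.exists_eq_succ_of_ne_zero hd.ne'
  rw [pow_succ]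
  refine Nat.mul_le_mul_right _ ?_
  exact (Nat.succ_le_of_lt d.lt_two_pow_self).trans (Nat.pow_le_pow_left ha d)

theorem width_arith {d G s K : ℕ} (hd : 0 < d) (hG : 0 < G) (hs : 3 * d + 2 ≤ s)
    (hB : G * s ≤ K + s - 1) (p : ℕ) :
    max d (max (4 * (d + 3 + G + 2 * (d * G) + G ^ d * s ^ d)) p) ≤
      max (4 * d * (K + s - 1) ^ d) (max (12 * (K + 2 * s - 2) + 12) p) := by
  have hW : (G * s) ^ d ≤ (K + s - 1) ^ d := Nat.pow_le_pow_left hB d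
  have hGs : 1 * s ≤ G * s := Nat.mul_le_mul_right s hG
  refine max_le ?_ (max_le ?_ ?_)
  · refine le_max_of_le_left ?_
    have h1 : 1 ≤ (K + s - 1) ^ d := Nat.one_le_pow _ _ (by omega)
    calc d = d * 1 := (mul_one d).symm
      _ ≤ 4 * d * (K + s - 1) ^ d := Nat.mul_le_mul (by omega) h1
  · rcases Nat.lt_or_ge d 2 with h | h
    · obtain rfl : d = 1 := by omega
      refine le_max_of_le_right (le_max_of_le_left ?_)
      have h1 : G * 5 ≤ G * s := Nat.mul_le_mul_left G (by omega)
      simp only [pow_one, one_mul]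
      omega
    · refine le_max_of_le_left ?_
      have h1 : d + 3 + G + 2 * (d * G) ≤ (G * s) ^ d :=
        calc d + 3 + G + 2 * (d * G) ≤ G * (3 * d + 4) := by nlinarith
          _ ≤ G * (s * s) := Nat.mul_le_mul_left G (by nlinarith)
          _ = (G * s) * s := by ring
          _ ≤ (G * s) * (G * s) := Nat.mul_le_mul_left _ (by omega)
          _ = (G * s) ^ 2 := (sq _).symm
          _ ≤ (G * s) ^ d := Nat.pow_le_pow_right (by omega) h
      rw [← mul_pow, mul_assoc]
      refine Nat.mul_le_mul_left 4 ?_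
      calc _ ≤ 2 * (K + s - 1) ^ d := by omega
        _ ≤ _ := Nat.mul_le_mul_right _ h
  · exact le_max_of_le_right (le_max_right _ _)

theorem cost_arith {d p G s K M pad r : ℕ} (hd : 0 < d) (hp : 0 < p) (hG : 0 < G) (hr : r ≠ 0)
    (hs : 3 * d + 2 * r ≤ s) (hB : G * s ≤ K + s - 1) (hpad : pad + 2 * r + 3 ≤ s + M) :
    (20 * d + 3 + G) +
      ((20 * d + 16 * (3 * G) + 72) + M * (20 * d + 60) + pad * (20 * d + 60) +
        (72 * (d * G) + 60) + r * (25 * (d * G) + 60) + (25 * (d * G) + 60) +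
        (r - 1) * (25 * (d * G) + 60) + (40 * (d * G) + 20 * (G ^ d * s ^ d)) +
        d * (40 * (d * G) + 52 * (G ^ d * s ^ d)) +
        (s - 1) * (20 * (d * G) + 36 * (G ^ d * s ^ d))) +
      p * (4 * (G ^ d * s ^ d)) ≤
    p * (K + s - 1) ^ d * (60 * M + 38 + 20 * d ^ 2 + 144 * d * (s - 1) + 8 * d) := by
  have hGs : 1 * s ≤ G * s := Nat.mul_le_mul_right s hG
  have hw : G ^ d * s ^ d ≤ (K + s - 1) ^ d := by
    rw [← mul_pow]; exact Nat.pow_le_pow_left hB d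
  have hu : s * (d * G) ≤ (K + s - 1) ^ d := by
    refine le_trans ?_ ((mul_le_pow_of_two_le hd (by omega)).trans (Nat.pow_le_pow_left hB d))
    exact le_of_eq (by ring)
  generalize G ^ d * s ^ d = w at hw ⊢
  generalize (K + s - 1) ^ d = W at hw hu ⊢
  have hGu : 1 * G ≤ d * G := Nat.mul_le_mul_right G hd
  have hdu : d * 1 ≤ d * G := Nat.mul_le_mul_left d hG
  generalize d * G = u at hu hGu hdu ⊢
  obtain ⟨q, rfl⟩ : ∃ q, r = q + 1 := Nat.exists_eq_succ_of_ne_zero hr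
  obtain ⟨t, rfl⟩ : ∃ t, s = t + 1 := ⟨s - 1, by omega⟩
  simp only [Nat.add_sub_cancel]
  have h5u : 5 * u ≤ W := le_trans (Nat.mul_le_mul_right u (by omega)) hu
  have h3du : 3 * d * u ≤ W := le_trans (Nat.mul_le_mul_right u (by omega)) hu
  have hru : 2 * (q + 1) * u ≤ W := le_trans (Nat.mul_le_mul_right u (by omega)) hu
  have htu : t * u ≤ W := le_trans (Nat.mul_le_mul_right u (by omega)) hu
  have h5d : 5 * d ≤ W := by omega
  have hdw : d * w ≤ d * W := Nat.mul_le_mul_left d hw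
  have htw : t * w ≤ t * W := Nat.mul_le_mul_left t hw
  have hc : 20 * d + 60 ≤ 16 * W := by omega
  have hM : M * (20 * d + 60) ≤ M * (16 * W) := Nat.mul_le_mul_left M hc
  have hP : (pad + 2 * (q + 1)) * (20 * d + 60) ≤ (t + M) * (16 * W) :=
    Nat.mul_le_mul (by omega) hc
  have hdt : (4 * d) * W ≤ (d * t) * W := Nat.mul_le_mul_right W (by nlinarith)
  have htt : (1 * t) * W ≤ (d * t) * W :=
    Nat.mul_le_mul_right W (Nat.mul_le_mul_right t hd)
  have hWd : 1 * W ≤ d * W := Nat.mul_le_mul_right W hd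
  have hrest : (20 * d + 3 + G) +
      ((20 * d + 16 * (3 * G) + 72) + M * (20 * d + 60) + pad * (20 * d + 60) +
        (72 * u + 60) + (q + 1) * (25 * u + 60) + (25 * u + 60) +
        q * (25 * u + 60) + (40 * u + 20 * w) + d * (40 * u + 52 * w) +
        t * (20 * u + 36 * w)) ≤
      W * (60 * M + 34 + 20 * d ^ 2 + 144 * d * t + 8 * d) := by
    have hq : q * 1 ≤ q * d := Nat.mul_le_mul_left q hd
    have hMW : 0 ≤ M * W := Nat.zero_le _
    have hddW : 0 ≤ W * d ^ 2 := Nat.zero_le _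
    nlinarith
  calc _ ≤ W * (60 * M + 34 + 20 * d ^ 2 + 144 * d * t + 8 * d) + p * (4 * w) :=
        Nat.add_le_add_right hrest _
    _ ≤ p * (W * (60 * M + 34 + 20 * d ^ 2 + 144 * d * t + 8 * d)) + p * (4 * W) := by
        refine add_le_add (Nat.le_mul_of_pos_left _ hp) ?_
        exact Nat.mul_le_mul_left p (by omega)
    _ = _ := by ring

end Arithmetic

section Parameters

theorem three_mul_add_le_of_lt_factorial {d ℓ n : ℕ} {A T : ℝ} (hA : 1 ≤ A) (hT : 5 ≤ T)
    (hℓ : (ℓ : ℝ) ≤ T)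
    (h : Real.exp 1 * A ^ ℓ * T ^ (2 * d + 2 * ℓ) * Real.exp (-(n : ℝ)) <
      (Nat.factorial ℓ : ℝ)) :
    3 * d + ℓ + 2 ≤ n ∧ T ^ ℓ ≤ Real.exp n := by
  have he : Real.exp 1 < 2.7182818286 := Real.exp_one_lt_d9
  have h1 : (Nat.factorial ℓ : ℝ) ≤ T ^ ℓ :=
    le_trans (by exact_mod_cast Nat.factorial_le_pow ℓ) (pow_le_pow_left₀ (by positivity) hℓ ℓ)
  have hTℓ : 0 < T ^ ℓ := by positivity
  have hlt : Real.exp 1 * A ^ ℓ * T ^ (2 * d + ℓ) < Real.exp n := by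
    have h2 := h.trans_le h1
    rw [Real.exp_neg, ← div_eq_mul_inv, div_lt_iff₀ (Real.exp_pos _)] at h2
    refine lt_of_mul_lt_mul_left ?_ hTℓ.le
    calc T ^ ℓ * (Real.exp 1 * A ^ ℓ * T ^ (2 * d + ℓ)) =
        Real.exp 1 * A ^ ℓ * T ^ (2 * d + 2 * ℓ) := by ring
      _ < _ := h2
  have hAℓ : 1 ≤ A ^ ℓ := one_le_pow₀ hA
  have h1e : 1 ≤ Real.exp 1 := Real.one_le_exp zero_le_one
  have hge : Real.exp 1 * 1 * T ^ (2 * d + ℓ) ≤ Real.exp 1 * A ^ ℓ * T ^ (2 * d + ℓ) := by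
    gcongr
  constructor
  · have h3 : Real.exp 1 ^ (3 * d + ℓ) ≤ T ^ (2 * d + ℓ) := by
      rw [pow_add, pow_add, pow_mul, pow_mul]
      have h4 : Real.exp 1 ^ 3 ≤ T ^ 2 :=
        calc Real.exp 1 ^ 3 ≤ 2.7182818286 ^ 3 := pow_le_pow_left₀ (by positivity) he.le 3
          _ ≤ 5 ^ 2 := by norm_num
          _ ≤ T ^ 2 := by gcongr
      have h5 : Real.exp 1 ≤ T := by linarith
      gcongr
    have h6 : Real.exp ((3 * d + ℓ + 1 : ℕ) : ℝ) < Real.exp n := by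
      rw [← mul_one ((3 * d + ℓ + 1 : ℕ) : ℝ), Real.exp_nat_mul, pow_succ']
      calc Real.exp 1 * Real.exp 1 ^ (3 * d + ℓ) ≤ Real.exp 1 * T ^ (2 * d + ℓ) := by gcongr
        _ = Real.exp 1 * 1 * T ^ (2 * d + ℓ) := by ring
        _ < _ := hge.trans_lt hlt
    have h7 : 3 * d + ℓ + 1 < n := by exact_mod_cast Real.exp_lt_exp.mp h6
    omega
  · have h8 : T ^ ℓ ≤ Real.exp 1 * 1 * T ^ (2 * d + ℓ) := by
      rw [pow_add]
      have : 1 ≤ T ^ (2 * d) := one_le_pow₀ (by linarith)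
      calc T ^ ℓ = 1 * 1 * (1 * T ^ ℓ) := by ring
        _ ≤ _ := by gcongr
    exact (h8.trans hge).trans hlt.le

theorem two_mul_le_nine_pow {d : ℕ} : 2 * d ≤ 9 ^ d := by
  induction d with
  | zero => simp
  | succ d ih => rw [pow_succ]; have := Nat.one_le_pow d 9 (by norm_num); omega

theorem blend_error_le {d ℓ n s m G j : ℕ} {Q R T : ℝ} (hd : 0 < d) (hG : 0 < G) (hQ : 0 < Q)
    (hR : 0 < R) (hs : s = ℓ + n) (hn : 3 * d + ℓ + 2 ≤ n) (hm : m ≤ 2 * (ℓ + 1)) (hj : j ≤ ℓ)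
    (hT : T = 2 * s - 1) (hTn : T ^ ℓ ≤ Real.exp n)
    (hGR : Real.exp 1 * d * 9 ^ d ≤ G * R) :
    (6 : ℝ) ^ d * (Q * (R ^ s)⁻¹ * (Nat.factorial s : ℝ) / (Nat.factorial s : ℝ) *
        ((d : ℝ) / G) ^ s) * (d * (ℓ * (m : ℝ) ^ 2 * G) + G * s) ^ j ≤
      Q * Real.exp 1 * (Real.sqrt 2 * Real.exp 1 * d * 9 ^ d) ^ ℓ * T ^ (2 * d + 2 * ℓ) *
        (R ^ ℓ)⁻¹ * Real.exp (-(n : ℝ)) := by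
  have he : Real.exp 1 < 2.7182818286 := Real.exp_one_lt_d9
  have h1e : 1 ≤ Real.exp 1 := Real.one_le_exp zero_le_one
  have hd1 : (1 : ℝ) ≤ d := by exact_mod_cast hd
  have hG1 : (1 : ℝ) ≤ G := by exact_mod_cast hG
  have hn' : 3 * (d : ℝ) + ℓ + 2 ≤ n := by exact_mod_cast hn
  have hm' : (m : ℝ) ≤ 2 * (ℓ + 1) := by exact_mod_cast hm
  have hs' : (s : ℝ) = ℓ + n := by exact_mod_cast hs
  have hℓ0 : (0 : ℝ) ≤ ℓ := by positivity
  have h9 : 2 * (d : ℝ) ≤ 9 ^ d := by exact_mod_cast two_mul_le_nine_pow (d := d)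
  have h99 : (9 : ℝ) ≤ 9 ^ d := le_self_pow₀ (by norm_num) hd.ne'
  generalize hB : (9 : ℝ) ^ d = B at *
  have hT5 : 5 ≤ T := by rw [hT]; linarith
  have hX1 : 1 ≤ (d : ℝ) * (ℓ * (m : ℝ) ^ 2) + s := by
    have : 0 ≤ (d : ℝ) * (ℓ * (m : ℝ) ^ 2) := by positivity
    linarith
  have hXT : (d : ℝ) * (ℓ * (m : ℝ) ^ 2) + s ≤ B * T ^ 3 := by
    have h1 : (ℓ : ℝ) + 1 ≤ T / 2 := by rw [hT]; linarith
    have h2 : (m : ℝ) ≤ T := by linarith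
    have h3 : (s : ℝ) ≤ T := by rw [hT]; linarith
    have h4 : T ≤ T ^ 3 := le_self_pow₀ (by linarith) (by norm_num)
    calc (d : ℝ) * (ℓ * (m : ℝ) ^ 2) + s ≤ d * (T * T ^ 2) + 1 * T ^ 3 := by
          gcongr <;> linarith
      _ = (d + 1) * T ^ 3 := by ring
      _ ≤ B * T ^ 3 := by gcongr; linarith
  generalize hXdef : (d : ℝ) * (ℓ * (m : ℝ) ^ 2) + s = X at *
  have hj' : (d * (ℓ * (m : ℝ) ^ 2 * G) + G * s) ^ j ≤ (G * X) ^ ℓ := by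
    rw [← hXdef, show (d * (ℓ * (m : ℝ) ^ 2 * G) + G * s) =
      G * ((d : ℝ) * (ℓ * (m : ℝ) ^ 2) + s) by ring, hXdef]
    exact pow_le_pow_right₀ (one_le_mul_of_one_le_of_one_le hG1 hX1) hj
  have hratio : (d : ℝ) / (R * G) ≤ Real.exp (-1) * B⁻¹ := by
    rw [Real.exp_neg, ← mul_inv, ← one_div, div_le_div_iff₀ (by positivity) (by positivity)]
    linarith
  have hXℓ : X ^ ℓ ≤ B ^ ℓ * T ^ (2 * ℓ) * B ^ n :=
    calc X ^ ℓ ≤ (B * T ^ 3) ^ ℓ := pow_le_pow_left₀ (by linarith) hXT ℓ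
      _ = B ^ ℓ * T ^ (2 * ℓ) * T ^ ℓ := by ring
      _ ≤ B ^ ℓ * T ^ (2 * ℓ) * B ^ n := by
        have : Real.exp n ≤ B ^ n := by
          rw [← mul_one (n : ℝ), Real.exp_nat_mul]
          exact pow_le_pow_left₀ (by positivity) (by linarith) n
        gcongr
        exact hTn.trans this
  have hfac : (Nat.factorial s : ℝ) ≠ 0 := by positivity
  have h6 : (6 : ℝ) ^ d ≤ T ^ (2 * d) := by
    rw [pow_mul]
    exact pow_le_pow_left₀ (by norm_num) (by nlinarith) d
  have hsqrt : 1 ≤ Real.sqrt 2 := Real.one_le_sqrt.mpr (by norm_num)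
  have hdB : ((d : ℝ) * B) ^ ℓ ≤ Real.exp 1 * (Real.sqrt 2 * Real.exp 1 * d * B) ^ ℓ := by
    have : (d : ℝ) * B ≤ Real.sqrt 2 * Real.exp 1 * d * B :=
      calc (d : ℝ) * B = 1 * 1 * d * B := by ring
        _ ≤ _ := by gcongr
    calc ((d : ℝ) * B) ^ ℓ = 1 * ((d : ℝ) * B) ^ ℓ := by ring
      _ ≤ _ := by gcongr
  calc _ ≤ (6 : ℝ) ^ d * (Q * (R ^ s)⁻¹ * (Nat.factorial s : ℝ) / (Nat.factorial s : ℝ) *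
        ((d : ℝ) / G) ^ s) * (G * X) ^ ℓ := by gcongr
    _ = (6 : ℝ) ^ d * Q * (R ^ ℓ)⁻¹ * d ^ ℓ * (d / (R * G)) ^ n * X ^ ℓ := by
      rw [mul_div_assoc, div_self hfac, hs]
      have hG0 : (G : ℝ) ≠ 0 := by positivity
      simp only [div_pow, mul_pow, pow_add]
      field_simp
    _ ≤ T ^ (2 * d) * Q * (R ^ ℓ)⁻¹ * d ^ ℓ * (Real.exp (-1) * B⁻¹) ^ n *
        (B ^ ℓ * T ^ (2 * ℓ) * B ^ n) := by gcongr
    _ = Q * T ^ (2 * d + 2 * ℓ) * (R ^ ℓ)⁻¹ * Real.exp (-1) ^ n * ((d : ℝ) * B) ^ ℓ := by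
      have hB0 : B ≠ 0 := by positivity
      simp only [inv_pow, mul_pow, pow_add]
      field_simp
    _ ≤ Q * T ^ (2 * d + 2 * ℓ) * (R ^ ℓ)⁻¹ * Real.exp (-1) ^ n *
        (Real.exp 1 * (Real.sqrt 2 * Real.exp 1 * d * B) ^ ℓ) := by gcongr
    _ = _ := by
      rw [← Real.exp_nat_mul, mul_neg_one]
      ring

theorem le_growth_of_loglog2_le {H : ℝ} {M : ℕ} (hM : M ≠ 0) (h : loglog2 H ≤ M) :
    H ≤ growth M := by
  refine le_trans ?_ (two_pow_le_growth hM)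
  rw [loglog2] at h
  split_ifs at h with h2
  · exact h2.trans (le_self_pow₀ one_le_two (by positivity))
  · push Not at h2
    have h3 : 0 < Real.logb 2 H := Real.logb_pos one_lt_two (by linarith)
    rw [Real.logb_le_iff_le_rpow one_lt_two h3, Real.logb_le_iff_le_rpow one_lt_two (by linarith),
      Real.rpow_natCast] at h
    exact_mod_cast h

theorem exists_grid {K s n : ℕ} {b R : ℝ} (hK : 0 < K) (hn : 0 < n) (hsn : s ≤ 2 * n)
    (hb : 0 < b) (hR : 0 < R) (hnx : (n : ℝ) ≤ K * R / (2 * b)) :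
    ∃ G : ℕ, 0 < G ∧ G * s ≤ K + s - 1 ∧ b ≤ G * R := by
  refine ⟨(K - 1) / (2 * n) + 1, Nat.succ_pos _, ?_, ?_⟩
  · have h := Nat.div_mul_le_self (K - 1) (2 * n)
    have h2 := Nat.mul_le_mul_left ((K - 1) / (2 * n)) hsn
    rw [add_mul]
    omega
  · have h : K ≤ 2 * n * ((K - 1) / (2 * n) + 1) := by
      have := Nat.lt_mul_div_succ (K - 1) (show 0 < 2 * n by omega)
      omega
    generalize (K - 1) / (2 * n) + 1 = G at h ⊢
    have h' : (K : ℝ) ≤ 2 * n * G := by exact_mod_cast h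
    rw [le_div_iff₀ (by positivity)] at hnx
    have hn' : (0 : ℝ) < n := by exact_mod_cast hn
    refine le_of_mul_le_mul_left ?_ (show (0 : ℝ) < 2 * n by positivity)
    calc 2 * n * b = n * (2 * b) := by ring
      _ ≤ K * R := hnx
      _ ≤ 2 * n * G * R := by gcongr
      _ = 2 * n * (G * R) := by ring

end Parameters

theorem exists_zero_net (d p : ℕ) {L : ℕ} (hL : 0 < L) :
    ∃ N : ReQUNet, N.arch 0 = d ∧ N.arch (N.L + 1) = p ∧ N.width ≤ max d p ∧ N.L = L ∧
      N.weightsIn (Set.Icc (-1) 1) ∧ N.numNonzero = 0 ∧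
      ∀ x : Fin d → ℝ, ∀ i : Fin p, N.evalVec d x i = 0 := by
  refine ⟨compileNet (ι := Empty) (p := p) Empty.elim (List.replicate (L - 1) Empty.elim)
    fun _ => Empty.elim, rfl, compileNet_arch_last _ _ _, ?_, ?_, ?_, ?_, fun x i => ?_⟩
  · simpa using compileNet_width (ι := Empty) (d := d) (p := p) Empty.elim
      (List.replicate (L - 1) Empty.elim) fun _ => Empty.elim
  · rw [compileNet_L, List.length_replicate]
    omega
  · exact compileNet_weightsIn _ _ _ (fun i => i.elim) (fun _ _ i => i.elim) fun _ i => i.elim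
  · refine Nat.le_zero.mp ((compileNet_numNonzero _ _ _).trans (le_of_eq ?_))
    simp [layerCost, formSize]
  · rw [compileNet_evalVec]
    simp

theorem exists_blend_net {d p ℓ n s K : ℕ} (hd : 0 < d) (hp : 0 < p) {Q R : ℝ} (hQ : 0 < Q)
    (hR : 0 < R) {f : (Fin d → ℝ) → Fin p → ℝ} (hf : QRanalytic p Q R f) (hs : s = ℓ + n)
    (hn : 3 * d + ℓ + 2 ≤ n) {T : ℝ} (hT : T = 2 * s - 1) (hTn : T ^ ℓ ≤ Real.exp n)
    (hK : 0 < K) (hnK : (n : ℝ) ≤ K * R / (2 * (Real.exp 1 * d * 9 ^ d)))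
    {M : ℕ} (hsM : 2 * s - 1 ≤ 2 ^ M)
    (hHM : Q * (R ^ s)⁻¹ * (Nat.factorial s : ℝ) ≤ growth M) :
    ∃ N : ReQUNet, N.arch 0 = d ∧ N.arch (N.L + 1) = p ∧
      N.width ≤ max (4 * d * (K + s - 1) ^ d) (max (12 * (K + 2 * s - 2) + 12) p) ∧
      N.L = 6 + 2 * (s - 3) + Nat.clog 2 d + 2 * M ∧
      N.weightsIn (Set.Icc (-1) 1) ∧
      N.numNonzero ≤ p * (K + s - 1) ^ d *
        (60 * M + 38 + 20 * d ^ 2 + 144 * d * (s - 1) + 8 * d) ∧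
      VHolderNormLe p ℓ (fun x i => f x i - N.evalVec d x (i : ℕ))
        (Q * Real.exp 1 * (Real.sqrt 2 * Real.exp 1 * d * 9 ^ d) ^ ℓ *
          T ^ (2 * d + 2 * ℓ) * (R ^ ℓ)⁻¹ * Real.exp (-(n : ℝ))) := by
  obtain ⟨G, hG, hGs, hGR⟩ := exists_grid (s := s) (b := Real.exp 1 * d * 9 ^ d) hK
    (show 0 < n by omega) (by omega) (by positivity) hR hnK
  obtain ⟨r, hr0, hrℓ, hrM, hm1, hm2⟩ : ∃ r : ℕ, r ≠ 0 ∧ r ≤ ℓ + 1 ∧ r ≤ M ∧ ℓ < 2 ^ r ∧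
      2 ^ r ≤ 2 * (ℓ + 1) := by
    have h1 : 0 < Nat.clog 2 (ℓ + 2) := Nat.clog_pos one_lt_two (by omega)
    have h2 := Nat.le_pow_clog one_lt_two (ℓ + 2)
    have h3 := Nat.pow_pred_clog_lt_self one_lt_two (show 1 < ℓ + 2 by omega)
    refine ⟨Nat.clog 2 (ℓ + 2), h1.ne', Nat.clog_le_of_le_pow Nat.lt_two_pow_self,
      Nat.clog_le_of_le_pow (by omega), by omega, ?_⟩
    rw [← Nat.succ_pred_eq_of_pos h1, pow_succ]
    omega
  have hc : Nat.clog 2 d ≤ d := Nat.clog_le_of_le_pow Nat.lt_two_pow_self.le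
  have hlen : ((Cell.program d G s M (s + Nat.clog 2 d + M - 3 - d - 2 * r) r).length) + 1 =
      6 + 2 * (s - 3) + Nat.clog 2 d + 2 * M := by
    rw [Cell.length_program]
    omega
  generalize hpad : s + Nat.clog 2 d + M - 3 - d - 2 * r = pad at hlen
  refine ⟨Cell.blendNet d p G s M pad r f, rfl, compileNet_arch_last _ _ _, ?_, hlen, ?_, ?_,
    fun o => ?_⟩
  · refine (compileNet_width _ _ _).trans ?_
    rw [Cell.card_eq]
    exact width_arith hd hG (by omega) hGs p
  · exact compileNet_weightsIn _ _ _ Cell.isBounded_inputLayer Cell.isBounded_program fun o i =>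
      Cell.abs_readout_le hG.ne' (fun γ hγ x hx => (hf.abs_mderiv_le o hγ hx).trans hHM) i
  · exact (Cell.blendNet_numNonzero M pad r f).trans
      (cost_arith hd hp hG hr0 (by omega) hGs (by omega))
  · simp only [Cell.blendNet_evalVec hG.ne' hr0]
    refine holderNormLeOn_of_norm_iteratedFDeriv_le
      (((hf.1 o).of_le (by exact_mod_cast le_top)).sub (Cell.contDiff_blend hm1 _))
      fun j hj x hx => ?_
    refine (Cell.norm_iteratedFDeriv_sub_blend_le (hf.1 o) (by positivity)
      (fun l hl x hx y hy => hf.abs_lderiv_sub_le hQ hR (by omega) o hl hx hy) hG.ne' hj hm1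
      (by omega) hx).trans ?_
    exact blend_error_le hd hG hQ hR hs hn hm2 hj hT hTn hGR

theorem statement2 (d p : ℕ) (hd : 0 < d) (hp : 0 < p) (ℓ : ℕ) (Q R : ℝ)
    (hQ : 0 < Q) (hR : 0 < R) (f : (Fin d → ℝ) → Fin p → ℝ)
    (hf : QRanalytic p Q R f) (K : ℕ)
    (hK : 2 * Real.exp 1 * (d : ℝ) * (9 : ℝ) ^ d / R < (K : ℝ))
    (s : ℕ) (hs : s = ℓ + ⌊(K : ℝ) * R / (2 * Real.exp 1 * (d : ℝ) * (9 : ℝ) ^ d)⌋₊)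
    (hs3 : 3 ≤ s) :
    ∃ N : ReQUNet,
      N.arch 0 = d ∧ N.arch (N.L + 1) = p ∧
      N.width ≤ max (4 * d * (K + s - 1) ^ d) (max (12 * (K + 2 * s - 2) + 12) p) ∧
      N.L = 6 + 2 * (s - 3) + Nat.clog 2 d +
        2 * max ⌈max (Real.logb 2 (((2 * d * (s - 1) + d : ℕ) : ℝ)))
            (loglog2 (Q * ((R : ℝ) ^ s)⁻¹ * (Nat.factorial s : ℝ)))⌉₊ 1 ∧
      N.weightsIn (Set.Icc (-1) 1) ∧
      N.numNonzero ≤ p * (K + s - 1) ^ d *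
        (60 * max ⌈max (Real.logb 2 (((2 * d * (s - 1) + d : ℕ) : ℝ)))
            (loglog2 (Q * ((R : ℝ) ^ s)⁻¹ * (Nat.factorial s : ℝ)))⌉₊ 1
          + 38 + 20 * d ^ 2 + 144 * d * (s - 1) + 8 * d) ∧
      VHolderNormLe p ℓ (fun x i => f x i - N.evalVec d x (i : ℕ))
        (Q * Real.exp 1 * (Real.sqrt 2 * Real.exp 1 * (d : ℝ) * (9 : ℝ) ^ d) ^ ℓ *
          ((2 * s - 1 : ℕ) : ℝ) ^ (2 * d + 2 * ℓ) * ((R : ℝ) ^ ℓ)⁻¹ *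
          Real.exp (-((⌊(K : ℝ) * R / (2 * Real.exp 1 * (d : ℝ) * (9 : ℝ) ^ d)⌋₊ : ℕ) : ℝ))) := by

  set n := ⌊(K : ℝ) * R / (2 * Real.exp 1 * (d : ℝ) * (9 : ℝ) ^ d)⌋₊ with hn_def
  set M := max ⌈max (Real.logb 2 (((2 * d * (s - 1) + d : ℕ) : ℝ)))
    (loglog2 (Q * ((R : ℝ) ^ s)⁻¹ * (Nat.factorial s : ℝ)))⌉₊ 1 with hM_def
  set A := Real.sqrt 2 * Real.exp 1 * (d : ℝ) * (9 : ℝ) ^ d with hA_def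
  set T : ℝ := ((2 * s - 1 : ℕ) : ℝ) with hT_def
  have hd1 : (1 : ℝ) ≤ d := by exact_mod_cast hd
  have hT : T = 2 * s - 1 := by
    rw [hT_def, Nat.cast_sub (by omega)]
    push_cast
    ring
  have hA : 1 ≤ A := by
    have h1 : 1 ≤ Real.sqrt 2 := Real.one_le_sqrt.mpr (by norm_num)
    have h2 : 1 ≤ Real.exp 1 := Real.one_le_exp zero_le_one
    have h3 : (1 : ℝ) ≤ 9 ^ d := one_le_pow₀ (by norm_num)
    exact one_le_mul_of_one_le_of_one_le (one_le_mul_of_one_le_of_one_le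
      (one_le_mul_of_one_le_of_one_le h1 h2) hd1) h3
  have hK0 : 0 < K := by
    have : (0 : ℝ) < K := lt_of_le_of_lt (by positivity) hK
    exact_mod_cast this
  rcases le_or_gt (Nat.factorial ℓ : ℝ)
    (Real.exp 1 * A ^ ℓ * T ^ (2 * d + 2 * ℓ) * Real.exp (-(n : ℝ))) with h | h
  · obtain ⟨N, h0, hL1, hw, hL, hW, hnum, heval⟩ := exists_zero_net d p
      (show 0 < 6 + 2 * (s - 3) + Nat.clog 2 d + 2 * M by omega)
    refine ⟨N, h0, hL1, hw.trans (max_le_max ?_ (le_max_right _ _)), hL, hW, by omega,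
      fun i => ?_⟩
    · have : 1 ≤ (K + s - 1) ^ d := Nat.one_le_pow _ _ (by omega)
      nlinarith
    · simp only [heval, sub_zero]
      refine (hf.2 ℓ i).mono ?_
      calc Q * (R ^ ℓ)⁻¹ * (Nat.factorial ℓ : ℝ) ≤ Q * (R ^ ℓ)⁻¹ *
            (Real.exp 1 * A ^ ℓ * T ^ (2 * d + 2 * ℓ) * Real.exp (-(n : ℝ))) := by gcongr
        _ = _ := by ring
  · have hs3' : (3 : ℝ) ≤ s := by exact_mod_cast hs3
    have hs' : (s : ℝ) = ℓ + n := by exact_mod_cast hs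
    have hn0 : (0 : ℝ) ≤ n := by positivity
    obtain ⟨hn, hTn⟩ := three_mul_add_le_of_lt_factorial hA (by linarith) (by linarith) h
    have hceil : max (Real.logb 2 (((2 * d * (s - 1) + d : ℕ) : ℝ)))
        (loglog2 (Q * ((R : ℝ) ^ s)⁻¹ * (Nat.factorial s : ℝ))) ≤ M :=
      (Nat.le_ceil _).trans (by exact_mod_cast le_max_left _ _)
    have hM0 : M ≠ 0 := (lt_of_lt_of_le one_pos (le_max_right _ _)).ne'
    refine exists_blend_net hd hp hQ hR hf hs hn hT hTn hK0 ?_ ?_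
      (le_growth_of_loglog2_le hM0 ((le_max_right _ _).trans hceil))
    · refine (Nat.floor_le (by positivity)).trans (le_of_eq ?_)
      ring
    · have h1 := (le_max_left _ _).trans hceil
      rw [Real.logb_le_iff_le_rpow one_lt_two (by positivity), Real.rpow_natCast] at h1
      have h2 : 2 * d * (s - 1) + d ≤ 2 ^ M := by exact_mod_cast h1
      have h3 : 1 * (s - 1) ≤ d * (s - 1) := Nat.mul_le_mul_right _ hd
      rw [mul_assoc] at h2
      omega
end

section
/- Let d ≥ 2 and n ≥ 1 be integers and set v = ⌈log₂ d⌉. There exists a ReQU network g : ℝ^{dn} → ℝ^{n^d} with v hidden layers of widths n^d·2^{v+1}, n^d·2^v, …, n^d·4, all weights in [−1,1], and at most 20 d² n^d nonzero weights, such that for every input (y_{i,j})_{1≤i≤d, 1≤j≤n} ∈ ℝ^{dn}, the output coordinate of g indexed by (j₁, …, j_d) ∈ {1, …, n}^d equals the product y_{1,j₁} · y_{2,j₂} ··· y_{d,j_d}. -/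
open scoped BigOperators Classical

namespace ProductNet

noncomputable def leftSign (u : ℕ) : ℝ := if u = 0 ∨ u = 2 then 1 else -1

noncomputable def rightSign (u : ℕ) : ℝ := if u = 0 ∨ u = 3 then 1 else -1

noncomputable def coef (u : ℕ) : ℝ := if u < 2 then 1 / 4 else -1 / 4

/-- Input coordinate holding `y m (digit m t)`, where `digit m t` is the `m`-th base-`n` digit. -/
def inputIndex (n t m : ℕ) : ℕ := m * n + t / n ^ m % n

/-- The network multiplying `d` factors along a binary tree of depth `w + 1`. The units
`4 * p, …, 4 * p + 3` of a hidden layer jointly compute the product at the tree node `p`. A node of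
the first layer multiplies the factors `q` and `q + 2 ^ w`, the latter being replaced by the
constant `1`, through the biases, if it does not exist. -/
noncomputable def net (d n w : ℕ) : ReQUNet where
  L := w + 1
  arch i :=
    if i = 0 then d * n else if i ≤ w + 1 then n ^ d * 2 ^ (w + 1 + 2 - i) else n ^ d
  W i j k :=
    if i = 0 then
      if k = inputIndex n (j / 4 / 2 ^ w) (j / 4 % 2 ^ w) then leftSign (j % 4)
      else if j / 4 % 2 ^ w + 2 ^ w < d ∧
          k = inputIndex n (j / 4 / 2 ^ w) (j / 4 % 2 ^ w + 2 ^ w) then rightSign (j % 4)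
      else 0
    else if i ≤ w then
      if k / 8 = j / 4 then
        (if k / 4 % 2 = 0 then leftSign (j % 4) else rightSign (j % 4)) * coef (k % 4)
      else 0
    else if k / 4 = j then coef (k % 4) else 0
  v i j := if i = 1 ∧ d ≤ j / 4 % 2 ^ w + 2 ^ w then -rightSign (j % 4) else 0

/-- Value computed at the node `p` of the `i`-th level of a binary multiplication tree. -/
def treeVal (f : ℕ → ℝ) : ℕ → ℕ → ℝ
  | 0, p => f p
  | i + 1, p => treeVal f i (2 * p) * treeVal f i (2 * p + 1)

theorem treeVal_eq_prod (f : ℕ → ℝ) (i p : ℕ) :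
    treeVal f i p = ∏ q ∈ Finset.range (2 ^ i), f (p * 2 ^ i + q) := by
  induction i generalizing p with
  | zero => simp [treeVal]
  | succ i ih =>
    rw [treeVal, ih, ih, pow_succ, mul_two, Finset.prod_range_add]
    congr 1 <;> refine Finset.prod_congr rfl fun q _ => ?_ <;> congr 1 <;> ring

theorem requ_add_requ_neg (t : ℝ) : requ t + requ (-t) = t ^ 2 := by
  unfold requ
  rcases le_total 0 t with h | h
  · rw [max_eq_left h, max_eq_right (by linarith)]; ring
  · rw [max_eq_right h, max_eq_left (by linarith)]; ring

theorem sum_coef_requ (a b : ℝ) :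
    ∑ u ∈ Finset.range 4, coef u * requ (leftSign u * a + rightSign u * b) = a * b := by
  have h₁ := requ_add_requ_neg (a + b)
  have h₂ := requ_add_requ_neg (a - b)
  rw [show -(a + b) = -a + -b by ring] at h₁
  rw [show -(a - b) = -a + b by ring, sub_eq_add_neg] at h₂
  simp [Finset.sum_range_succ, coef, leftSign, rightSign]
  linarith

theorem leftSign_mem (u : ℕ) : leftSign u ∈ Set.Icc (-1 : ℝ) 1 := by
  unfold leftSign; split_ifs <;> norm_num

theorem rightSign_mem (u : ℕ) : rightSign u ∈ Set.Icc (-1 : ℝ) 1 := by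
  unfold rightSign; split_ifs <;> norm_num

theorem neg_rightSign_mem (u : ℕ) : -rightSign u ∈ Set.Icc (-1 : ℝ) 1 := by
  unfold rightSign; split_ifs <;> norm_num

theorem coef_mem (u : ℕ) : coef u ∈ Set.Icc (-1 : ℝ) 1 := by
  unfold coef; split_ifs <;> norm_num

theorem mul_mem_Icc {a b : ℝ} (ha : a ∈ Set.Icc (-1 : ℝ) 1) (hb : b ∈ Set.Icc (-1 : ℝ) 1) :
    a * b ∈ Set.Icc (-1 : ℝ) 1 := by
  rw [Set.mem_Icc, ← abs_le] at *
  rw [abs_mul]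
  exact mul_le_one₀ ha (abs_nonneg b) hb

theorem weightsIn_net (d n w : ℕ) : (net d n w).weightsIn (Set.Icc (-1) 1) := by
  have h0 : (0 : ℝ) ∈ Set.Icc (-1 : ℝ) 1 := by norm_num
  refine ⟨fun i _ j _ k _ => ?_, fun i _ _ j _ => ?_⟩
  · simp only [net]
    split_ifs <;> first
      | exact h0
      | exact leftSign_mem _
      | exact rightSign_mem _
      | exact coef_mem _
      | exact mul_mem_Icc (leftSign_mem _) (coef_mem _)
      | exact mul_mem_Icc (rightSign_mem _) (coef_mem _)
  · simp only [net]
    split_ifs <;> first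
      | exact h0
      | exact neg_rightSign_mem _

theorem sum_range_eq_window {f : ℕ → ℝ} {M a c : ℕ} (hM : a + c ≤ M)
    (hf : ∀ k, ¬(a ≤ k ∧ k < a + c) → f k = 0) :
    ∑ k ∈ Finset.range M, f k = ∑ r ∈ Finset.range c, f (a + r) := by
  have h : ∑ k ∈ Finset.Ico a (a + c), f k = ∑ k ∈ Finset.range M, f k := by
    refine Finset.sum_subset (fun k hk => ?_) fun k _ hk => hf k (by simpa using hk)
    simp only [Finset.mem_Ico, Finset.mem_range] at *
    omega
  rw [← h, Finset.sum_Ico_eq_sum_range, Nat.add_sub_cancel_left]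

theorem inputIndex_div {n : ℕ} (hn : 1 ≤ n) (t m : ℕ) : inputIndex n t m / n = m := by
  unfold inputIndex
  rw [mul_comm, Nat.mul_add_div hn, Nat.div_eq_of_lt (Nat.mod_lt _ hn), add_zero]

theorem inputIndex_mod (n t m : ℕ) : inputIndex n t m % n = t / n ^ m % n := by
  simp [inputIndex]

theorem inputIndex_lt {d n m : ℕ} (hn : 1 ≤ n) (t : ℕ) (hm : m < d) :
    inputIndex n t m < d * n :=
  (Nat.div_lt_iff_lt_mul hn).1 (by rwa [inputIndex_div hn])

noncomputable def leaf (d n w : ℕ) (x : ℕ → ℝ) (p : ℕ) : ℝ :=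
  x (inputIndex n (p / 2 ^ w) (p % 2 ^ w)) *
    if p % 2 ^ w + 2 ^ w < d then x (inputIndex n (p / 2 ^ w) (p % 2 ^ w + 2 ^ w)) else 1

theorem hidden_zero_sub_bias {d n w : ℕ} (hn : 1 ≤ n) (hw : 2 ^ w < d) (x : ℕ → ℝ) (j : ℕ) :
    (net d n w).hidden x 0 j - (net d n w).v 1 j =
      leftSign (j % 4) * x (inputIndex n (j / 4 / 2 ^ w) (j / 4 % 2 ^ w)) +
        rightSign (j % 4) * (if j / 4 % 2 ^ w + 2 ^ w < d then
          x (inputIndex n (j / 4 / 2 ^ w) (j / 4 % 2 ^ w + 2 ^ w)) else 1) := by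
  have hH : 0 < 2 ^ w := by positivity
  have hq : j / 4 % 2 ^ w < 2 ^ w := Nat.mod_lt _ hH
  set q := j / 4 % 2 ^ w
  set t := j / 4 / 2 ^ w
  have hA : inputIndex n t q < d * n := inputIndex_lt hn t (hq.trans hw)
  have hne : inputIndex n t (q + 2 ^ w) ≠ inputIndex n t q := fun h => by
    have := congrArg (· / n) h
    simp only [inputIndex_div hn] at this
    omega
  have key : (net d n w).hidden x 0 j = ∑ k ∈ Finset.range (d * n),
      ((if k = inputIndex n t q then leftSign (j % 4) * x k else 0) +
        if k = inputIndex n t (q + 2 ^ w) then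
          (if q + 2 ^ w < d then rightSign (j % 4) * x k else 0) else 0) := by
    simp only [ReQUNet.hidden, net, if_true]
    refine Finset.sum_congr rfl fun k _ => ?_
    change (if k = inputIndex n t q then leftSign (j % 4)
      else if q + 2 ^ w < d ∧ k = inputIndex n t (q + 2 ^ w) then rightSign (j % 4)
      else 0) * x k = _
    by_cases h₁ : k = inputIndex n t q
    · rw [if_pos h₁, if_pos h₁, if_neg (by rw [h₁]; exact hne.symm), add_zero]
    · by_cases h₂ : k = inputIndex n t (q + 2 ^ w) <;> by_cases h₃ : q + 2 ^ w < d <;>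
        simp [h₁, h₂, h₃, hne]
  have hv : (net d n w).v 1 j = if d ≤ q + 2 ^ w then -rightSign (j % 4) else 0 := by
    simp [net, q]
  rw [key, hv, Finset.sum_add_distrib, Finset.sum_ite_eq', Finset.sum_ite_eq',
    if_pos (Finset.mem_range.2 hA)]
  by_cases h : q + 2 ^ w < d
  · rw [if_pos (Finset.mem_range.2 (inputIndex_lt hn t h)), if_pos h, if_neg (by omega), if_pos h]
    ring
  · simp [h, not_lt.1 h]

theorem arch_net_succ {d n w i : ℕ} (hi : i ≤ w) :
    (net d n w).arch (i + 1) = 4 * (n ^ d * 2 ^ (w - i)) := by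
  have h : w + 1 + 2 - (i + 1) = w - i + 2 := by omega
  simp only [net, if_neg (Nat.succ_ne_zero i), if_pos (Nat.succ_le_succ hi), h]
  ring

theorem hidden_succ_sub_bias {d n w i : ℕ} (hi : i < w) (x : ℕ → ℝ) {p u : ℕ}
    (hp : p < n ^ d * 2 ^ (w - (i + 1))) (hu : u < 4) :
    (net d n w).hidden x (i + 1) (4 * p + u) - (net d n w).v (i + 2) (4 * p + u) =
      leftSign u * (∑ r ∈ Finset.range 4, coef r *
        requ ((net d n w).hidden x i (4 * (2 * p) + r) -
          (net d n w).v (i + 1) (4 * (2 * p) + r))) +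
      rightSign u * ∑ r ∈ Finset.range 4, coef r *
        requ ((net d n w).hidden x i (4 * (2 * p + 1) + r) -
          (net d n w).v (i + 1) (4 * (2 * p + 1) + r)) := by
  have hv : (net d n w).v (i + 2) (4 * p + u) = 0 := by simp [net]
  have hW (k : ℕ) : (net d n w).W (i + 1) (4 * p + u) k =
      if k / 8 = p then
        (if k / 4 % 2 = 0 then leftSign u else rightSign u) * coef (k % 4) else 0 := by
    have h₁ : (4 * p + u) / 4 = p := by omega
    have h₂ : (4 * p + u) % 4 = u := by omega
    simp only [net, if_neg (Nat.succ_ne_zero i), if_pos (Nat.succ_le_of_lt hi), h₁, h₂]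
  have hpow : 2 ^ (w - i) = 2 * 2 ^ (w - (i + 1)) := by
    rw [← pow_succ']; congr 1; omega
  have hM : 8 * p + (4 + 4) ≤ (net d n w).arch (i + 1) := by
    rw [arch_net_succ hi.le, hpow]
    nlinarith
  rw [hv, sub_zero, ReQUNet.hidden, sum_range_eq_window hM fun k hk => by
    rw [hW, if_neg (by omega), zero_mul], Finset.sum_range_add, Finset.mul_sum, Finset.mul_sum]
  congr 1 <;> refine Finset.sum_congr rfl fun r hr => ?_ <;> rw [Finset.mem_range] at hr
  · rw [hW, if_pos (by omega), if_pos (by omega), show (8 * p + r) % 4 = r by omega,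
      show 8 * p + r = 4 * (2 * p) + r by ring, mul_assoc]
  · rw [hW, if_pos (by omega), if_neg (by omega), show (8 * p + (4 + r)) % 4 = r by omega,
      show 8 * p + (4 + r) = 4 * (2 * p + 1) + r by ring, mul_assoc]

theorem readout_eq_treeVal {d n w : ℕ} (hn : 1 ≤ n) (hw : 2 ^ w < d) (x : ℕ → ℝ) {i : ℕ}
    (hi : i ≤ w) {p : ℕ} (hp : p < n ^ d * 2 ^ (w - i)) :
    ∑ u ∈ Finset.range 4, coef u *
        requ ((net d n w).hidden x i (4 * p + u) - (net d n w).v (i + 1) (4 * p + u)) =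
      treeVal (leaf d n w x) i p := by
  induction i generalizing p with
  | zero =>
    rw [treeVal, leaf, ← sum_coef_requ]
    refine Finset.sum_congr rfl fun u hu => ?_
    rw [Finset.mem_range] at hu
    rw [hidden_zero_sub_bias hn hw, show (4 * p + u) / 4 = p by omega,
      show (4 * p + u) % 4 = u by omega]
  | succ i ih =>
    have hpow : 2 ^ (w - i) = 2 * 2 ^ (w - (i + 1)) := by
      rw [← pow_succ']; congr 1; omega
    rw [treeVal, ← ih (by omega) (p := 2 * p) (by rw [hpow]; nlinarith),
      ← ih (by omega) (p := 2 * p + 1) (by rw [hpow]; nlinarith), ← sum_coef_requ]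
    refine Finset.sum_congr rfl fun u hu => ?_
    rw [hidden_succ_sub_bias (by omega) x hp (Finset.mem_range.1 hu)]

theorem eval_net {d n w : ℕ} (hn : 1 ≤ n) (hw : 2 ^ w < d) (x : ℕ → ℝ) {t : ℕ}
    (ht : t < n ^ d) :
    (net d n w).eval x t = treeVal (leaf d n w x) w t := by
  have hW (k : ℕ) : (net d n w).W (w + 1) t k = if k / 4 = t then coef (k % 4) else 0 := by
    simp [net]
  have hM : 4 * t + 4 ≤ (net d n w).arch (w + 1) := by
    rw [arch_net_succ le_rfl, Nat.sub_self, pow_zero]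
    omega
  rw [← readout_eq_treeVal hn hw x le_rfl (by simpa using ht)]
  change (net d n w).hidden x (w + 1) t = _
  rw [ReQUNet.hidden, sum_range_eq_window hM fun k hk => by
    rw [hW, if_neg (by omega), zero_mul]]
  refine Finset.sum_congr rfl fun r hr => ?_
  rw [Finset.mem_range] at hr
  rw [hW, if_pos (by omega), show (4 * t + r) % 4 = r by omega]

theorem treeVal_leaf {d n w : ℕ} (hn : 1 ≤ n) (hw : 2 ^ w < d) (hd : d ≤ 2 ^ (w + 1))
    (y : ℕ → ℕ → ℝ) (t : ℕ) :
    treeVal (leaf d n w fun k => y (k / n) (k % n)) w t =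
      ∏ m ∈ Finset.range d, y m (t / n ^ m % n) := by
  obtain ⟨e, rfl⟩ := Nat.exists_eq_add_of_lt hw
  rw [treeVal_eq_prod, add_assoc, Finset.prod_range_add]
  have hsub : Finset.range (e + 1) ⊆ Finset.range (2 ^ w) := by
    rw [pow_succ] at hd
    exact Finset.range_subset_range.2 (by omega)
  have hsnd : ∏ q ∈ Finset.range (e + 1), y (2 ^ w + q) (t / n ^ (2 ^ w + q) % n) =
      ∏ q ∈ Finset.range (2 ^ w), if q + 2 ^ w < 2 ^ w + e + 1 then
        y (q + 2 ^ w) (t / n ^ (q + 2 ^ w) % n) else 1 := by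
    rw [← Finset.prod_subset hsub fun q _ hq => if_neg (by
      rw [Finset.mem_range] at hq; omega)]
    refine Finset.prod_congr rfl fun q hq => ?_
    rw [if_pos (by rw [Finset.mem_range] at hq; omega), add_comm q]
  rw [hsnd, ← Finset.prod_mul_distrib]
  refine Finset.prod_congr rfl fun q hq => ?_
  rw [Finset.mem_range] at hq
  have h₁ : (t * 2 ^ w + q) / 2 ^ w = t := by
    rw [mul_comm, Nat.mul_add_div (by positivity), Nat.div_eq_of_lt hq, add_zero]
  have h₂ : (t * 2 ^ w + q) % 2 ^ w = q := by
    rw [Nat.mul_add_mod_self_right, Nat.mod_eq_of_lt hq]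
  simp only [leaf, h₁, h₂, inputIndex_div hn, inputIndex_mod, add_assoc]

theorem card_filter_product_le {P : ℕ × ℕ → Prop} [DecidablePred P] {a b c : ℕ}
    (T : ℕ → Finset ℕ) (hT : ∀ j, (T j).card ≤ c) (hP : ∀ j k, P (j, k) → k ∈ T j) :
    ((Finset.range a ×ˢ Finset.range b).filter P).card ≤ a * c := by
  have hsub : (Finset.range a ×ˢ Finset.range b).filter P ⊆
      (Finset.range a).biUnion fun j => (T j).image (Prod.mk j) := by
    rintro ⟨j, k⟩ h
    simp only [Finset.mem_filter, Finset.mem_product, Finset.mem_biUnion, Finset.mem_image] at *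
    exact ⟨j, h.1.1, k, hP j k h.2, rfl⟩
  refine (Finset.card_le_card hsub).trans ?_
  simpa using Finset.card_biUnion_le_card_mul (Finset.range a) _ c fun j _ =>
    Finset.card_image_le.trans (hT j)

theorem sum_two_pow_sub (w : ℕ) :
    ∑ i ∈ Finset.range w, 2 ^ (w - (i + 1)) + 1 = 2 ^ w := by
  induction w with
  | zero => simp
  | succ w ih =>
    rw [Finset.sum_range_succ']
    simp only [Nat.add_sub_add_right, Nat.sub_zero, pow_succ]
    omega

theorem numNonzero_net_add_le (d n w : ℕ) :
    (net d n w).numNonzero + 28 * n ^ d ≤ 44 * 2 ^ w * n ^ d := by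
  have hfirst : ((Finset.range ((net d n w).arch 1) ×ˢ Finset.range ((net d n w).arch 0)).filter
      fun p => (net d n w).W 0 p.1 p.2 ≠ 0).card ≤ (net d n w).arch 1 * 2 := by
    refine card_filter_product_le
      (fun j => {inputIndex n (j / 4 / 2 ^ w) (j / 4 % 2 ^ w),
        inputIndex n (j / 4 / 2 ^ w) (j / 4 % 2 ^ w + 2 ^ w)})
      (fun j => Finset.card_le_two) fun j k h => ?_
    by_contra hk
    simp only [Finset.mem_insert, Finset.mem_singleton, not_or] at hk
    exact h (by simp [net, hk.1, hk.2])
  have hmid (i : ℕ) (hi : i < w) :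
      ((Finset.range ((net d n w).arch (i + 1 + 1)) ×ˢ
        Finset.range ((net d n w).arch (i + 1))).filter
          fun p => (net d n w).W (i + 1) p.1 p.2 ≠ 0).card ≤
        32 * n ^ d * 2 ^ (w - (i + 1)) := by
    rw [show 32 * n ^ d * 2 ^ (w - (i + 1)) = (net d n w).arch (i + 1 + 1) * 8 by
      rw [arch_net_succ (Nat.succ_le_of_lt hi)]; ring]
    refine card_filter_product_le (fun j => Finset.Ico (8 * (j / 4)) (8 * (j / 4) + 8))
      (fun j => by simp) fun j k h => ?_
    by_contra hk
    rw [Finset.mem_Ico] at hk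
    have hne : k / 8 ≠ j / 4 := by omega
    exact h (by simp [net, Nat.succ_le_of_lt hi, hne])
  have hlast : ((Finset.range ((net d n w).arch (w + 1 + 1)) ×ˢ
      Finset.range ((net d n w).arch (w + 1))).filter
        fun p => (net d n w).W (w + 1) p.1 p.2 ≠ 0).card ≤ (net d n w).arch (w + 1 + 1) * 4 := by
    refine card_filter_product_le (fun j => Finset.Ico (4 * j) (4 * j + 4))
      (fun j => by simp) fun j k h => ?_
    by_contra hk
    rw [Finset.mem_Ico] at hk
    have hne : k / 4 ≠ j := by omega
    exact h (by simp [net, hne])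
  have hbias : ∑ i ∈ Finset.Icc 1 (w + 1),
      ((Finset.range ((net d n w).arch i)).filter fun j => (net d n w).v i j ≠ 0).card ≤
        (net d n w).arch 1 := by
    rw [Finset.sum_eq_single_of_mem 1 (by simp) fun i _ hi => by simp [net, hi]]
    exact (Finset.card_filter_le _ _).trans (Finset.card_range _).le
  have harch : (net d n w).arch (w + 1 + 1) = n ^ d := by simp [net]
  have hsum := Finset.sum_le_sum fun i hi => hmid i (Finset.mem_range.1 hi)
  rw [← Finset.mul_sum] at hsum
  have harch₁ : (net d n w).arch 1 = 4 * (n ^ d * 2 ^ w) := arch_net_succ (Nat.zero_le w)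
  have hnum : (net d n w).numNonzero = (∑ i ∈ Finset.range (w + 1 + 1),
      ((Finset.range ((net d n w).arch (i + 1)) ×ˢ Finset.range ((net d n w).arch i)).filter
        fun p => (net d n w).W i p.1 p.2 ≠ 0).card) + ∑ i ∈ Finset.Icc 1 (w + 1),
      ((Finset.range ((net d n w).arch i)).filter fun j => (net d n w).v i j ≠ 0).card := rfl
  rw [hnum, Finset.sum_range_succ, Finset.sum_range_succ', zero_add]
  have hpow := congrArg (32 * n ^ d * ·) (sum_two_pow_sub w)
  simp only [mul_add, mul_one] at hpow
  linarith

end ProductNet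

theorem statement13 (d n : ℕ) (hd : 2 ≤ d) (hn : 1 ≤ n) :
    ∃ N : ReQUNet,
      N.L = Nat.clog 2 d ∧
      (∀ i ≤ N.L + 1, N.arch i =
        if i = 0 then d * n
        else if i ≤ Nat.clog 2 d then n ^ d * 2 ^ (Nat.clog 2 d + 2 - i)
        else n ^ d) ∧
      N.weightsIn (Set.Icc (-1) 1) ∧
      N.numNonzero ≤ 20 * d ^ 2 * n ^ d ∧
      ∀ y : ℕ → ℕ → ℝ, ∀ j : Fin d → ℕ, (∀ m : Fin d, j m < n) →
        N.eval (fun k => y (k / n) (k % n)) (∑ m : Fin d, j m * n ^ (m : ℕ)) =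
          ∏ m : Fin d, y (m : ℕ) (j m) := by
  obtain ⟨w, hw⟩ : ∃ w, Nat.clog 2 d = w + 1 :=
    Nat.exists_eq_succ_of_ne_zero (Nat.clog_pos one_lt_two hd).ne'
  have hlt : 2 ^ w < d := (Nat.lt_clog_iff_pow_lt one_lt_two).1 (by omega)
  have hle : d ≤ 2 ^ (w + 1) := hw ▸ Nat.le_pow_clog one_lt_two d
  rw [hw]
  refine ⟨ProductNet.net d n w, rfl, fun i _ => rfl, ProductNet.weightsIn_net d n w, ?_,
    fun y j hj => ?_⟩
  · have hnum := ProductNet.numNonzero_net_add_le d n w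
    have hcoef : 44 * 2 ^ w ≤ 20 * d ^ 2 + 28 := by nlinarith [sq_nonneg ((d : ℤ) - 1)]
    have := Nat.mul_le_mul_right (n ^ d) hcoef
    linarith
  · let f : Fin d → Fin n := fun m => ⟨j m, hj m⟩
    have ht : ∑ m : Fin d, j m * n ^ (m : ℕ) = (finFunctionFinEquiv f : ℕ) := by
      simp [f]
    have hdigit (m : Fin d) : (finFunctionFinEquiv f : ℕ) / n ^ (m : ℕ) % n = j m :=
      congrArg Fin.val (congrFun (finFunctionFinEquiv.symm_apply_apply f) m)
    rw [ht, ProductNet.eval_net hn hlt _ (finFunctionFinEquiv f).isLt,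
      ProductNet.treeVal_leaf hn hlt hle, ← Fin.prod_univ_eq_prod_range
        (fun m => y m ((finFunctionFinEquiv f : ℕ) / n ^ m % n)) d]
    exact Finset.prod_congr rfl fun m _ => by rw [hdigit]
end
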